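/- Let k be a field, G an algebraic group over k, X a G-scheme, and k'/k a field extension. Then X admits an ample G-linearized line bundle if and only if the base change X_{k'} admits an ample G_{k'}-linearized line bundle. -/

import Mathlib

open AlgebraicGeometry CategoryTheory CategoryTheory.Limits Opposite

universe u

noncomputable section

/-- The spectrum of the field `k`, the base of all schemes considered. -/
abbrev Spk (k : Type u) [Field k] : Scheme.{u} := Spec (CommRingCat.of k)

/-- A scheme over the field `k`: a scheme together with a structure morphism to `Spec k`. -/
structure SchemeOver (k : Type u) [Field k] : Type (u + 1) where
  carrier : Scheme.{u}
  str : carrier ⟶ Spk k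

variable (k : Type u) [Field k]

/-- A group scheme over `k`, presented via its functor of points: for every scheme `T`
and every pair of `T`-points lying over the same `T`-point of `Spec k`, a product point,
together with unit and inverse, satisfying the group axioms functorially. -/
structure GroupSchemeOver extends SchemeOver k where
  mul : ∀ {T : Scheme.{u}} (a b : T ⟶ carrier), a ≫ str = b ≫ str → (T ⟶ carrier)
  one : Spk k ⟶ carrier
  inv : ∀ {T : Scheme.{u}}, (T ⟶ carrier) → (T ⟶ carrier)
  mul_str : ∀ {T : Scheme.{u}} (a b : T ⟶ carrier) (h), mul a b h ≫ str = a ≫ str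
  one_str : one ≫ str = 𝟙 (Spk k)
  inv_str : ∀ {T : Scheme.{u}} (a : T ⟶ carrier), inv a ≫ str = a ≫ str
  mul_natural : ∀ {T' T : Scheme.{u}} (g : T' ⟶ T) (a b : T ⟶ carrier) (h h'),
    g ≫ mul a b h = mul (g ≫ a) (g ≫ b) h'
  inv_natural : ∀ {T' T : Scheme.{u}} (g : T' ⟶ T) (a : T ⟶ carrier),
    g ≫ inv a = inv (g ≫ a)
  mul_assoc : ∀ {T : Scheme.{u}} (a b c : T ⟶ carrier) (h₁ h₂ h₃ h₄),
    mul (mul a b h₁) c h₂ = mul a (mul b c h₃) h₄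
  one_mul : ∀ {T : Scheme.{u}} (a : T ⟶ carrier) (h), mul (a ≫ str ≫ one) a h = a
  mul_one : ∀ {T : Scheme.{u}} (a : T ⟶ carrier) (h), mul a (a ≫ str ≫ one) h = a
  inv_mul : ∀ {T : Scheme.{u}} (a : T ⟶ carrier) (h), mul (inv a) a h = a ≫ str ≫ one

variable {k}

theorem GroupSchemeOver.mul_congr (G : GroupSchemeOver k) {T : Scheme.{u}}
    {a a' b b' : T ⟶ G.carrier} (ha : a = a') (hb : b = b') (h h') :
    G.mul a b h = G.mul a' b' h' := by subst ha; subst hb; rfl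

/-- A homomorphism of group schemes over `k`. -/
structure GroupHom (G H : GroupSchemeOver k) where
  hom : G.carrier ⟶ H.carrier
  hom_str : hom ≫ H.str = G.str
  hom_one : G.one ≫ hom = H.one
  hom_mul : ∀ {T : Scheme.{u}} (a b : T ⟶ G.carrier) (h h'),
    G.mul a b h ≫ hom = H.mul (a ≫ hom) (b ≫ hom) h'

/-- An action of a group scheme `G` over `k` on a scheme `X` over `k`, presented via
its functor of points. -/
structure ActionOver (G : GroupSchemeOver k) (X : SchemeOver k) where
  act : ∀ {T : Scheme.{u}} (g : T ⟶ G.carrier) (x : T ⟶ X.carrier),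
    g ≫ G.str = x ≫ X.str → (T ⟶ X.carrier)
  act_str : ∀ {T : Scheme.{u}} (g : T ⟶ G.carrier) (x : T ⟶ X.carrier) (h),
    act g x h ≫ X.str = x ≫ X.str
  act_natural : ∀ {T' T : Scheme.{u}} (f : T' ⟶ T) (g : T ⟶ G.carrier)
    (x : T ⟶ X.carrier) (h h'), f ≫ act g x h = act (f ≫ g) (f ≫ x) h'
  one_act : ∀ {T : Scheme.{u}} (x : T ⟶ X.carrier) (h), act (x ≫ X.str ≫ G.one) x h = x
  mul_act : ∀ {T : Scheme.{u}} (g g' : T ⟶ G.carrier) (x : T ⟶ X.carrier) (h₁ h₂ h₃ h₄),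
    act (G.mul g g' h₁) x h₂ = act g (act g' x h₃) h₄

theorem ActionOver.act_congr {G : GroupSchemeOver k} {X : SchemeOver k}
    (α : ActionOver G X) {T : Scheme.{u}} {g g' : T ⟶ G.carrier} {x x' : T ⟶ X.carrier}
    (hg : g = g') (hx : x = x') (h h') : α.act g x h = α.act g' x' h' := by
  subst hg; subst hx; rfl

/-- The action of a group scheme on itself by left translations. -/
def GroupSchemeOver.selfAction (G : GroupSchemeOver k) : ActionOver G G.toSchemeOver where
  act g x h := G.mul g x h
  act_str g x h := (G.mul_str g x h).trans h
  act_natural f g x h h' := G.mul_natural f g x h h'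
  one_act x h := G.one_mul x h
  mul_act g g' x h₁ h₂ h₃ h₄ := G.mul_assoc g g' x h₁ h₂ h₃ h₄

/-- Restriction of an action along a homomorphism of group schemes. -/
def ActionOver.res {G H : GroupSchemeOver k} {X : SchemeOver k} (φ : GroupHom H G)
    (α : ActionOver G X) : ActionOver H X where
  act g x h := α.act (g ≫ φ.hom) x (by rw [Category.assoc, φ.hom_str, h])
  act_str g x h := α.act_str _ _ _
  act_natural f g x h h' := by
    refine (α.act_natural f (g ≫ φ.hom) x _ ?_).trans (α.act_congr ?_ rfl _ _)
    · simp only [Category.assoc, φ.hom_str, ← h']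
    · simp only [Category.assoc]
  one_act x h := by
    refine (α.act_congr ?_ rfl _ ?_).trans (α.one_act x ?_)
    · simp only [Category.assoc, φ.hom_one]
    · simp only [Category.assoc, G.one_str, Category.comp_id]
    · simp only [Category.assoc, G.one_str, Category.comp_id]
  mul_act g g' x h₁ h₂ h₃ h₄ := by
    have hg : g ≫ H.str = x ≫ X.str := (H.mul_str g g' h₁).symm.trans h₂
    have hg' : g' ≫ H.str = x ≫ X.str := h₁.symm.trans hg
    have p1 : (g ≫ φ.hom) ≫ G.str = (g' ≫ φ.hom) ≫ G.str := by
      simp only [Category.assoc, φ.hom_str]; exact h₁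
    have p3 : (g' ≫ φ.hom) ≫ G.str = x ≫ X.str := by
      simp only [Category.assoc, φ.hom_str]; exact hg'
    refine (α.act_congr (φ.hom_mul g g' h₁ p1) rfl _ ?_).trans
      (α.mul_act (g ≫ φ.hom) (g' ≫ φ.hom) x p1 ?_ p3 ?_)
    · rw [G.mul_str]
      simp only [Category.assoc, φ.hom_str]; exact hg
    · rw [G.mul_str]
      simp only [Category.assoc, φ.hom_str]; exact hg
    · rw [α.act_str]
      simp only [Category.assoc, φ.hom_str]; exact hg
/-! ### Vector bundles and line bundles, geometrically -/

/-- The data underlying a (geometric) vector bundle on a scheme `X`: a total space `π : tot ⟶ X`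
together with a fiberwise `Γ(T, ⊤)`-module structure on the `T`-points of `tot` over a fixed
`T`-point of `X`, functorially in `T`. -/
structure VecBundleData (X : Scheme.{u}) : Type (u + 1) where
  tot : Scheme.{u}
  π : tot ⟶ X
  zero : X ⟶ tot
  zero_π : zero ≫ π = 𝟙 X
  add : ∀ {T : Scheme.{u}} (a b : T ⟶ tot), a ≫ π = b ≫ π → (T ⟶ tot)
  smul : ∀ {T : Scheme.{u}} (f : Γ(T, ⊤)) (a : T ⟶ tot), T ⟶ tot
  add_π : ∀ {T : Scheme.{u}} (a b : T ⟶ tot) (h), add a b h ≫ π = a ≫ π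
  smul_π : ∀ {T : Scheme.{u}} (f : Γ(T, ⊤)) (a : T ⟶ tot), smul f a ≫ π = a ≫ π
  add_natural : ∀ {T' T : Scheme.{u}} (g : T' ⟶ T) (a b : T ⟶ tot) (h h'),
    g ≫ add a b h = add (g ≫ a) (g ≫ b) h'
  smul_natural : ∀ {T' T : Scheme.{u}} (g : T' ⟶ T) (f : Γ(T, ⊤)) (a : T ⟶ tot),
    g ≫ smul f a = smul (g.appTop f) (g ≫ a)
  add_comm : ∀ {T : Scheme.{u}} (a b : T ⟶ tot) (h h'), add a b h = add b a h'
  add_assoc : ∀ {T : Scheme.{u}} (a b c : T ⟶ tot) (h₁ h₂ h₃ h₄),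
    add (add a b h₁) c h₂ = add a (add b c h₃) h₄
  zero_add : ∀ {T : Scheme.{u}} (a : T ⟶ tot) (h), add ((a ≫ π) ≫ zero) a h = a
  one_smul : ∀ {T : Scheme.{u}} (a : T ⟶ tot), smul 1 a = a
  mul_smul : ∀ {T : Scheme.{u}} (f g : Γ(T, ⊤)) (a : T ⟶ tot), smul (f * g) a = smul f (smul g a)
  smul_add : ∀ {T : Scheme.{u}} (f : Γ(T, ⊤)) (a b : T ⟶ tot) (h h'),
    smul f (add a b h) = add (smul f a) (smul f b) h'
  add_smul : ∀ {T : Scheme.{u}} (f g : Γ(T, ⊤)) (a : T ⟶ tot) (h),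
    smul (f + g) a = add (smul f a) (smul g a) h
  zero_smul : ∀ {T : Scheme.{u}} (a : T ⟶ tot), smul 0 a = (a ≫ π) ≫ zero
  smul_zero : ∀ {T : Scheme.{u}} (f : Γ(T, ⊤)) (x : T ⟶ X), smul f (x ≫ zero) = x ≫ zero

namespace VecBundleData

variable {X : Scheme.{u}} (E : VecBundleData X)

theorem add_congr {T : Scheme.{u}} {a a' b b' : T ⟶ E.tot} (ha : a = a') (hb : b = b')
    (h h') : E.add a b h = E.add a' b' h' := by subst ha; subst hb; rfl

/-- The fiber of a vector bundle over a `T`-point of the base. -/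
abbrev Fiber {T : Scheme.{u}} (x : T ⟶ X) : Type u := { a : T ⟶ E.tot // a ≫ E.π = x }

instance fiberZero {T : Scheme.{u}} (x : T ⟶ X) : Zero (E.Fiber x) :=
  ⟨⟨x ≫ E.zero, by rw [Category.assoc, E.zero_π, Category.comp_id]⟩⟩

instance fiberAdd {T : Scheme.{u}} (x : T ⟶ X) : Add (E.Fiber x) :=
  ⟨fun a b => ⟨E.add a.1 b.1 (a.2.trans b.2.symm), (E.add_π _ _ _).trans a.2⟩⟩

instance fiberSMul {T : Scheme.{u}} (x : T ⟶ X) : SMul Γ(T, ⊤) (E.Fiber x) :=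
  ⟨fun f a => ⟨E.smul f a.1, (E.smul_π _ _).trans a.2⟩⟩

@[simp] theorem coe_fiber_zero {T : Scheme.{u}} (x : T ⟶ X) :
    ((0 : E.Fiber x) : T ⟶ E.tot) = x ≫ E.zero := rfl

@[simp] theorem coe_fiber_add {T : Scheme.{u}} (x : T ⟶ X) (a b : E.Fiber x) :
    ((a + b : E.Fiber x) : T ⟶ E.tot) = E.add a.1 b.1 (a.2.trans b.2.symm) := rfl

@[simp] theorem coe_fiber_smul {T : Scheme.{u}} (x : T ⟶ X) (f : Γ(T, ⊤)) (a : E.Fiber x) :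
    ((f • a : E.Fiber x) : T ⟶ E.tot) = E.smul f a.1 := rfl

instance {T : Scheme.{u}} (x : T ⟶ X) : AddCommMonoid (E.Fiber x) where
  add_assoc a b c := Subtype.ext (E.add_assoc _ _ _ _ _ _ _)
  add_comm a b := Subtype.ext (E.add_comm _ _ _ _)
  zero_add a := Subtype.ext (by
    have hz : ((a.1 ≫ E.π) ≫ E.zero) ≫ E.π = a.1 ≫ E.π := by
      rw [Category.assoc, E.zero_π, Category.comp_id]
    show E.add (x ≫ E.zero) a.1 _ = a.1
    exact (E.add_congr (by rw [a.2]) rfl _ hz).trans (E.zero_add a.1 hz))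
  add_zero a := Subtype.ext (by
    have hz : ((a.1 ≫ E.π) ≫ E.zero) ≫ E.π = a.1 ≫ E.π := by
      rw [Category.assoc, E.zero_π, Category.comp_id]
    have hz' : (x ≫ E.zero) ≫ E.π = a.1 ≫ E.π := by
      rw [Category.assoc, E.zero_π, Category.comp_id, a.2]
    show E.add a.1 (x ≫ E.zero) _ = a.1
    exact (E.add_comm _ _ _ hz').trans
      ((E.add_congr (by rw [a.2]) rfl _ hz).trans (E.zero_add a.1 hz)))
  nsmul := nsmulRec
  nsmul_zero _ := rfl
  nsmul_succ _ _ := rfl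

instance {T : Scheme.{u}} (x : T ⟶ X) : Module Γ(T, ⊤) (E.Fiber x) where
  one_smul a := Subtype.ext (E.one_smul a.1)
  mul_smul f g a := Subtype.ext (E.mul_smul f g a.1)
  smul_zero f := Subtype.ext (E.smul_zero f x)
  smul_add f a b := Subtype.ext (E.smul_add f a.1 b.1 _ _)
  add_smul f g a := Subtype.ext (E.add_smul f g a.1 _)
  zero_smul a := Subtype.ext ((E.zero_smul a.1).trans (by rw [a.2]; rfl))

/-- A family of `n` local sections of `E` over an open subset `U` is a frame if every point
of the total space over `U` is, in a unique way, a linear combination of these sections. -/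
def IsFrame {n : ℕ} (U : X.Opens) (s : Fin n → (U.toScheme ⟶ E.tot)) : Prop :=
  ∃ hs : ∀ i, s i ≫ E.π = U.ι,
    ∀ {T : Scheme.{u}} (x : T ⟶ U.toScheme),
      Function.Bijective (fun f : Fin n → Γ(T, ⊤) =>
        (∑ i, f i • (⟨x ≫ s i, by rw [Category.assoc, hs i]⟩ : E.Fiber (x ≫ U.ι))))

/-- A family of `n` global sections of `E` is a global frame if every point of the total
space is, in a unique way, a linear combination of these sections. -/
def IsGlobalFrame {n : ℕ} (s : Fin n → (X ⟶ E.tot)) : Prop :=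
  ∃ hs : ∀ i, s i ≫ E.π = 𝟙 X,
    ∀ {T : Scheme.{u}} (x : T ⟶ X),
      Function.Bijective (fun f : Fin n → Γ(T, ⊤) =>
        (∑ i, f i • (⟨x ≫ s i, by rw [Category.assoc, hs i, Category.comp_id]⟩ : E.Fiber x)))

end VecBundleData

/-- A (geometric) vector bundle of rank `n` on `X`: bundle data which is locally trivial,
i.e. admits local frames around every point of `X`. -/
structure VecBundle (n : ℕ) (X : Scheme.{u}) extends VecBundleData X where
  locTriv : ∀ x : X, ∃ (U : X.Opens) (s : Fin n → (U.toScheme ⟶ tot)),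
    x ∈ U ∧ toVecBundleData.IsFrame U s

/-- A (geometric) line bundle on a scheme. -/
abbrev LineBundle (X : Scheme.{u}) := VecBundle 1 X

/-- A morphism of total spaces of vector bundles over `X` is linear if it commutes with the
projections, the fiberwise additions and the fiberwise scalar multiplications. -/
def IsLinearHom {X : Scheme.{u}} (E F : VecBundleData X) (φ : E.tot ⟶ F.tot) : Prop :=
  (φ ≫ F.π = E.π) ∧
  (∀ {T : Scheme.{u}} (a b : T ⟶ E.tot) (h h'), E.add a b h ≫ φ = F.add (a ≫ φ) (b ≫ φ) h') ∧
  (∀ {T : Scheme.{u}} (f : Γ(T, ⊤)) (a : T ⟶ E.tot), E.smul f a ≫ φ = F.smul f (a ≫ φ))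

/-- Two vector bundles on `X` are isomorphic if there is a linear isomorphism between them. -/
def VBIso {X : Scheme.{u}} {n m : ℕ} (E : VecBundle n X) (F : VecBundle m X) : Prop :=
  ∃ φ : E.tot ⟶ F.tot, IsLinearHom E.toVecBundleData F.toVecBundleData φ ∧ IsIso φ

/-- `F` is a pullback of the vector bundle `E` along `g : Y ⟶ X`. -/
def IsPullbackBundle {Y X : Scheme.{u}} (g : Y ⟶ X) {n : ℕ} (E : VecBundle n X)
    (F : VecBundle n Y) : Prop :=
  ∃ τ : F.tot ⟶ E.tot,
    (τ ≫ E.π = F.π ≫ g) ∧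
    (∀ {T : Scheme.{u}} (a b : T ⟶ F.tot) (h h'), F.add a b h ≫ τ = E.add (a ≫ τ) (b ≫ τ) h') ∧
    (∀ {T : Scheme.{u}} (f : Γ(T, ⊤)) (a : T ⟶ F.tot), F.smul f a ≫ τ = E.smul f (a ≫ τ)) ∧
    (∀ {T : Scheme.{u}} (y : T ⟶ Y) (a : T ⟶ E.tot), a ≫ E.π = y ≫ g →
      ∃! b : T ⟶ F.tot, b ≫ F.π = y ∧ b ≫ τ = a)

/-- A vector bundle is trivial if it admits a global frame. -/
def IsTrivialBundle {X : Scheme.{u}} {n : ℕ} (E : VecBundle n X) : Prop :=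
  ∃ s : Fin n → (X ⟶ E.tot), E.toVecBundleData.IsGlobalFrame s

/-- `N` is a tensor product of the line bundles `L` and `M`: witnessed by a fiberwise
bilinear pairing taking local frames to local frames. -/
def IsTensor {X : Scheme.{u}} (L M N : LineBundle X) : Prop :=
  ∃ β : ∀ {T : Scheme.{u}} (a : T ⟶ L.tot) (b : T ⟶ M.tot), a ≫ L.π = b ≫ M.π → (T ⟶ N.tot),
    (∀ {T : Scheme.{u}} (a : T ⟶ L.tot) (b : T ⟶ M.tot) (h), β a b h ≫ N.π = a ≫ L.π) ∧
    (∀ {T' T : Scheme.{u}} (g : T' ⟶ T) (a : T ⟶ L.tot) (b : T ⟶ M.tot) (h h'),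
      g ≫ β a b h = β (g ≫ a) (g ≫ b) h') ∧
    (∀ {T : Scheme.{u}} (a a' : T ⟶ L.tot) (b : T ⟶ M.tot) (h₁ h₂ h₃ h₄ h₅),
      β (L.add a a' h₁) b h₂ = N.add (β a b h₃) (β a' b h₄) h₅) ∧
    (∀ {T : Scheme.{u}} (a : T ⟶ L.tot) (b b' : T ⟶ M.tot) (h₁ h₂ h₃ h₄ h₅),
      β a (M.add b b' h₁) h₂ = N.add (β a b h₃) (β a b' h₄) h₅) ∧
    (∀ {T : Scheme.{u}} (f : Γ(T, ⊤)) (a : T ⟶ L.tot) (b : T ⟶ M.tot) (h₁ h₂),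
      β (L.smul f a) b h₁ = N.smul f (β a b h₂)) ∧
    (∀ {T : Scheme.{u}} (f : Γ(T, ⊤)) (a : T ⟶ L.tot) (b : T ⟶ M.tot) (h₁ h₂),
      β a (M.smul f b) h₁ = N.smul f (β a b h₂)) ∧
    (∀ (U : X.Opens) (sL : Fin 1 → (U.toScheme ⟶ L.tot)) (sM : Fin 1 → (U.toScheme ⟶ M.tot)),
      L.toVecBundleData.IsFrame U sL → M.toVecBundleData.IsFrame U sM →
      ∀ (h : sL 0 ≫ L.π = sM 0 ≫ M.π),
        N.toVecBundleData.IsFrame (n := 1) U (fun _ => β (sL 0) (sM 0) h))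

/-- `N` is an `m`-th tensor power of the line bundle `L`. -/
def IsTensorPow {X : Scheme.{u}} (L : LineBundle X) : ℕ → LineBundle X → Prop
  | 0, N => IsTrivialBundle N
  | m + 1, N => ∃ M : LineBundle X, IsTensorPow L m M ∧ IsTensor M L N

/-- A line bundle is ample if the base is quasi-compact and quasi-separated and the
non-vanishing loci of global sections of positive tensor powers give an affine open cover. -/
def IsAmple {X : Scheme.{u}} (L : LineBundle X) : Prop :=
  CompactSpace X ∧ QuasiSeparatedSpace X ∧
  ∀ x : X, ∃ (m : ℕ), 0 < m ∧ ∃ (N : LineBundle X), IsTensorPow L m N ∧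
    ∃ (s : X ⟶ N.tot), s ≫ N.π = 𝟙 X ∧
      ∃ U : X.Opens, IsAffineOpen U ∧ x ∈ U ∧
        (U : Set X) = {y : X | s.base y ≠ N.zero.base y}
/-! ### Properties of schemes and group schemes over `k` -/

/-- An algebraic group over `k` is a group scheme of finite type over `k`. -/
def GroupSchemeOver.IsAlgebraic {k : Type u} [Field k] (G : GroupSchemeOver k) : Prop :=
  LocallyOfFiniteType G.str ∧ QuasiCompact G.str

/-- A scheme of finite type over `k`. -/
def SchemeOver.IsFiniteType {k : Type u} [Field k] (X : SchemeOver k) : Prop :=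
  LocallyOfFiniteType X.str ∧ QuasiCompact X.str

/-- A variety over `k`: an integral separated scheme of finite type over `k`. -/
def SchemeOver.IsVariety {k : Type u} [Field k] (X : SchemeOver k) : Prop :=
  IsIntegral X.carrier ∧ AlgebraicGeometry.IsSeparated X.str ∧ X.IsFiniteType

/-- A scheme is normal if all its local rings are integrally closed domains. -/
def IsNormalScheme (X : Scheme.{u}) : Prop :=
  ∀ x : X, IsDomain (X.presheaf.stalk x) ∧ IsIntegrallyClosed (X.presheaf.stalk x)

/-- The base change of a scheme over `k` to the algebraic closure of `k`. -/
def SchemeOver.geomFiber {k : Type u} [Field k] (X : SchemeOver k) : Scheme.{u} :=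
  pullback X.str (Spec.map (CommRingCat.ofHom (algebraMap k (AlgebraicClosure k))))

/-- A scheme over `k` is geometrically integral if its base change to an algebraic
closure of `k` is integral. -/
def SchemeOver.IsGeomIntegral {k : Type u} [Field k] (X : SchemeOver k) : Prop :=
  IsIntegral X.geomFiber

/-- A scheme over `k` is geometrically connected if its base change to an algebraic
closure of `k` is connected. -/
def SchemeOver.IsGeomConnected {k : Type u} [Field k] (X : SchemeOver k) : Prop :=
  ConnectedSpace X.geomFiber

/-- A scheme over `k` is geometrically irreducible if its base change to an algebraic
closure of `k` is irreducible. -/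
def SchemeOver.IsGeomIrreducible {k : Type u} [Field k] (X : SchemeOver k) : Prop :=
  IrreducibleSpace X.geomFiber

/-- An open subscheme of a scheme over `k`, as a scheme over `k`. -/
def SchemeOver.ofOpens {k : Type u} [Field k] (X : SchemeOver k) (U : X.carrier.Opens) :
    SchemeOver k :=
  ⟨U.toScheme, U.ι ≫ X.str⟩

/-- A scheme over `k` is quasi-projective if it is separated, of finite type, and carries
an ample line bundle. -/
def SchemeOver.IsQuasiProjective {k : Type u} [Field k] (X : SchemeOver k) : Prop :=
  AlgebraicGeometry.IsSeparated X.str ∧ X.IsFiniteType ∧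
    ∃ L : LineBundle X.carrier, IsAmple L

/-- An open subset of `X` is stable under an action of `G` if the action preserves its
`T`-points, for all `T`. -/
def ActionOver.Stable {k : Type u} [Field k] {G : GroupSchemeOver k} {X : SchemeOver k}
    (α : ActionOver G X) (U : X.carrier.Opens) : Prop :=
  ∀ {T : Scheme.{u}} (g : T ⟶ G.carrier) (x : T ⟶ X.carrier) (h),
    Set.range x.base ⊆ (U : Set X.carrier) →
      Set.range (α.act g x h).base ⊆ (U : Set X.carrier)

/-- A `G`-linearization of a vector bundle `E` on a `G`-scheme `X`: an action of `G` on the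
total space of `E`, lifting the action on `X` and acting linearly on the fibers (equivalently,
an action of `G × 𝔾ₘ` on `E` for which the projection is equivariant and `𝔾ₘ` acts by
multiplication on the fibers). -/
structure LinearizationData {k : Type u} [Field k] {G : GroupSchemeOver k} {X : SchemeOver k}
    (α : ActionOver G X) {n : ℕ} (E : VecBundle n X.carrier) where
  lact : ∀ {T : Scheme.{u}} (g : T ⟶ G.carrier) (e : T ⟶ E.tot),
    g ≫ G.str = (e ≫ E.π) ≫ X.str → (T ⟶ E.tot)
  lact_π : ∀ {T : Scheme.{u}} (g : T ⟶ G.carrier) (e : T ⟶ E.tot) (h h'),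
    lact g e h ≫ E.π = α.act g (e ≫ E.π) h'
  lact_natural : ∀ {T' T : Scheme.{u}} (f : T' ⟶ T) (g : T ⟶ G.carrier) (e : T ⟶ E.tot) (h h'),
    f ≫ lact g e h = lact (f ≫ g) (f ≫ e) h'
  one_lact : ∀ {T : Scheme.{u}} (e : T ⟶ E.tot) (h), lact (((e ≫ E.π) ≫ X.str) ≫ G.one) e h = e
  mul_lact : ∀ {T : Scheme.{u}} (g g' : T ⟶ G.carrier) (e : T ⟶ E.tot) (h₁ h₂ h₃ h₄),
    lact (G.mul g g' h₁) e h₂ = lact g (lact g' e h₃) h₄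
  lact_add : ∀ {T : Scheme.{u}} (g : T ⟶ G.carrier) (a b : T ⟶ E.tot) (h₁ h₂ h₃ h₄ h₅),
    lact g (E.add a b h₁) h₂ = E.add (lact g a h₃) (lact g b h₄) h₅
  lact_smul : ∀ {T : Scheme.{u}} (g : T ⟶ G.carrier) (f : Γ(T, ⊤)) (a : T ⟶ E.tot) (h₁ h₂),
    lact g (E.smul f a) h₁ = E.smul f (lact g a h₂)

/-- A vector bundle is `G`-linearized (linearizable) if it admits a linearization. -/
def ActionOver.IsLinearized {k : Type u} [Field k] {G : GroupSchemeOver k} {X : SchemeOver k}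
    (α : ActionOver G X) {n : ℕ} (E : VecBundle n X.carrier) : Prop :=
  Nonempty (LinearizationData α E)

/-- Equivariance of a morphism relative to a homomorphism of group schemes. -/
def IsEquivariantRel {k : Type u} [Field k] {G H : GroupSchemeOver k} {X Y : SchemeOver k}
    (φ : GroupHom G H) (α : ActionOver G X) (β : ActionOver H Y)
    (f : X.carrier ⟶ Y.carrier) : Prop :=
  f ≫ Y.str = X.str ∧
  ∀ {T : Scheme.{u}} (g : T ⟶ G.carrier) (x : T ⟶ X.carrier) (h h'),
    α.act g x h ≫ f = β.act (g ≫ φ.hom) (x ≫ f) h'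

/-- Equivariance of a morphism of `G`-schemes. -/
def IsEquivariant {k : Type u} [Field k] {G : GroupSchemeOver k} {X Y : SchemeOver k}
    (α : ActionOver G X) (β : ActionOver G Y) (f : X.carrier ⟶ Y.carrier) : Prop :=
  f ≫ Y.str = X.str ∧
  ∀ {T : Scheme.{u}} (g : T ⟶ G.carrier) (x : T ⟶ X.carrier) (h h'),
    α.act g x h ≫ f = β.act g (x ≫ f) h'

/-- A `T`-point of `G` acts trivially if it acts trivially on all points of `X` over `T`. -/
def ActionOver.ActsTrivially {k : Type u} [Field k] {G : GroupSchemeOver k}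
    {X : SchemeOver k} (α : ActionOver G X) {T : Scheme.{u}} (g : T ⟶ G.carrier) : Prop :=
  ∀ {T' : Scheme.{u}} (t : T' ⟶ T) (x : T' ⟶ X.carrier) (h), α.act (t ≫ g) x h = x

/-- An action is almost faithful if its kernel is finite, i.e. all trivially acting points
factor through a fixed closed subscheme of `G` which is finite over `k`. -/
def ActionOver.IsAlmostFaithful {k : Type u} [Field k] {G : GroupSchemeOver k}
    {X : SchemeOver k} (α : ActionOver G X) : Prop :=
  ∃ (K : Scheme.{u}) (ι : K ⟶ G.carrier), IsClosedImmersion ι ∧ IsFinite (ι ≫ G.str) ∧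
    ∀ {T : Scheme.{u}} (g : T ⟶ G.carrier), α.ActsTrivially g → ∃ g' : T ⟶ K, g' ≫ ι = g

/-- An abelian variety over `k` is a smooth connected proper algebraic group over `k`. -/
def GroupSchemeOver.IsAbelianVariety {k : Type u} [Field k] (G : GroupSchemeOver k) : Prop :=
  G.IsAlgebraic ∧ IsSmooth G.str ∧ ConnectedSpace G.carrier ∧ IsProper G.str

set_option linter.unusedVariables false
set_option linter.style.haveILetI false

theorem reasc {A B D Z : Scheme.{u}} {f : A ⟶ B} {g : B ⟶ D} {e : A ⟶ D} (h : f ≫ g = e) (z : D ⟶ Z) :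
    f ≫ g ≫ z = e ≫ z := by rw [← Category.assoc, h]

theorem reasc2 {A B B' D Z : Scheme.{u}} {f : A ⟶ B} {g : B ⟶ D} {a : A ⟶ B'} {b : B' ⟶ D} (h : f ≫ g = a ≫ b)
    (z : D ⟶ Z) : f ≫ g ≫ z = a ≫ b ≫ z := by rw [← Category.assoc, h, Category.assoc]

/-! ### Values of local functions at points -/

/-- The point `x` lands in the open `U`. -/
abbrev Land {X T : Scheme.{u}} (x : T ⟶ X) (U : X.Opens) : Prop := ⊤ ≤ x ⁻¹ᵁ U

/-- Value of a local function at a point. -/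
def ev {X T : Scheme.{u}} {U : X.Opens} (f : Γ(X, U)) (x : T ⟶ X) (h : Land x U) : Γ(T, ⊤) :=
  x.appLE U ⊤ h f

section ev
variable {X T T' : Scheme.{u}} {U V : X.Opens}

theorem Land.comp {x : T ⟶ X} (h : Land x U) (t : T' ⟶ T) : Land (t ≫ x) U := by
  intro z _
  exact h (show t z ∈ (⊤ : T.Opens) from trivial)

theorem Land.inf {x : T ⟶ X} (h : Land x U) (h' : Land x V) : Land x (U ⊓ V) :=
  fun z hz => ⟨h hz, h' hz⟩
theorem Land.left {x : T ⟶ X} (h : Land x (U ⊓ V)) : Land x U := fun z hz => (h hz).1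
theorem Land.right {x : T ⟶ X} (h : Land x (U ⊓ V)) : Land x V := fun z hz => (h hz).2
theorem Land.mono {x : T ⟶ X} (h : Land x U) (h' : U ≤ V) : Land x V := fun _ hz => h' (h hz)
theorem Land.ι (U : X.Opens) : Land U.ι U := fun z _ => z.2
theorem Land.iff {x : T ⟶ X} : Land x U ↔ ∀ t, x t ∈ U := ⟨fun h t => h trivial, fun h t _ => h t⟩

@[simp] theorem ev_add (f f' : Γ(X, U)) (x : T ⟶ X) (h) : ev (f + f') x h = ev f x h + ev f' x h :=
  map_add _ _ _
@[simp] theorem ev_mul (f f' : Γ(X, U)) (x : T ⟶ X) (h) : ev (f * f') x h = ev f x h * ev f' x h :=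
  map_mul _ _ _
@[simp] theorem ev_one (x : T ⟶ X) (h) : ev (1 : Γ(X, U)) x h = 1 := map_one _
@[simp] theorem ev_zero (x : T ⟶ X) (h) : ev (0 : Γ(X, U)) x h = 0 := map_zero _
@[simp] theorem ev_pow (f : Γ(X, U)) (n : ℕ) (x : T ⟶ X) (h) : ev (f ^ n) x h = ev f x h ^ n :=
  map_pow _ _ _
theorem ev_sum {ι : Type*} (s : Finset ι) (f : ι → Γ(X, U)) (x : T ⟶ X) (h) :
    ev (∑ i ∈ s, f i) x h = ∑ i ∈ s, ev (f i) x h := map_sum (x.appLE U ⊤ h).hom _ _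

theorem ev_comp (f : Γ(X, U)) (x : T ⟶ X) (h : Land x U) (t : T' ⟶ T) (h' : Land (t ≫ x) U) :
    ev f (t ≫ x) h' = t.appTop (ev f x h) := by
  unfold ev
  have e : (⊤ : T'.Opens) ≤ t ⁻¹ᵁ ⊤ := fun _ _ => trivial
  have h1 : t.appTop = t.appLE ⊤ ⊤ e := Scheme.Hom.app_eq_appLE t
  have h2 := Scheme.Hom.appLE_comp_appLE t x U ⊤ ⊤ h e
  rw [h1, ← CommRingCat.comp_apply, h2]

theorem ev_comp' (f : Γ(X, U)) (x : T ⟶ X) (h : Land x U) (t : T' ⟶ T) :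
    t.appTop (ev f x h) = ev f (t ≫ x) (h.comp t) := (ev_comp ..).symm

theorem ev_congr {f f' : Γ(X, U)} {x x' : T ⟶ X} (hf : f = f') (hx : x = x') (h h') :
    ev f x h = ev f' x' h' := by subst hf; subst hx; rfl

theorem ev_res {i : V ≤ U} (f : Γ(X, U)) (x : T ⟶ X) (h : Land x V) (h' : Land x U) :
    ev (X.presheaf.map (homOfLE i).op f) x h = ev f x h' := by
  unfold ev
  rw [← CommRingCat.comp_apply, Scheme.Hom.map_appLE]

theorem ev_ι (f : Γ(X, U)) : ev f U.ι (Land.ι U) = U.topIso.inv f := by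
  unfold ev
  rw [Scheme.Opens.ι_appLE]
  rfl

theorem ev_ext {f f' : Γ(X, U)} (h : ev f U.ι (Land.ι U) = ev f' U.ι (Land.ι U)) : f = f' := by
  rw [ev_ι, ev_ι] at h
  have := congrArg U.topIso.hom h
  rwa [Iso.inv_hom_id_apply, Iso.inv_hom_id_apply] at this

/-- A natural function on points landing in `U` comes from a unique element. -/
theorem exists_ev (φ : ∀ {T : Scheme.{u}} (x : T ⟶ X), Land x U → Γ(T, ⊤))
    (hφ : ∀ {T T' : Scheme.{u}} (t : T' ⟶ T) (x : T ⟶ X) (h h'), φ (t ≫ x) h' = t.appTop (φ x h)) :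
    ∃ f : Γ(X, U), ∀ {T : Scheme.{u}} (x : T ⟶ X) (h : Land x U), ev f x h = φ x h := by
  refine ⟨U.topIso.hom (φ U.ι (Land.ι U)), fun {T} x h => ?_⟩
  obtain ⟨y, rfl⟩ : ∃ y : T ⟶ U.toScheme, y ≫ U.ι = x :=
    ⟨IsOpenImmersion.lift U.ι x (by rw [Scheme.Opens.range_ι]; rintro _ ⟨t, rfl⟩; exact h trivial), IsOpenImmersion.lift_fac _ _ _⟩
  rw [ev_comp _ U.ι (Land.ι U), ev_ι, hφ y U.ι (Land.ι U), Iso.hom_inv_id_apply]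

theorem ev_basicOpen (f : Γ(X, U)) (x : T ⟶ X) (h : Land x U) :
    T.basicOpen (ev f x h) = x ⁻¹ᵁ X.basicOpen f := by
  unfold ev Scheme.Hom.appLE
  rw [CommRingCat.comp_apply, Scheme.basicOpen_res, ← Scheme.preimage_basicOpen]
  simp

end ev

section locfun
variable {T : Scheme.{u}}

/-- Restriction of a global function to an open subscheme. -/
theorem appTop_ι (O : T.Opens) (f : Γ(T, ⊤)) :
    O.ι.appTop f = O.topIso.inv (T.presheaf.map (homOfLE (le_top : O ≤ ⊤)).op f) := by
  have h : Land O.ι (⊤ : T.Opens) := fun _ _ => trivial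
  have := ev_res (i := (le_top : O ≤ ⊤)) f O.ι (Land.ι O) h
  rw [ev_ι] at this
  rw [this]
  have h2 : O.ι.appTop = O.ι.appLE ⊤ ⊤ h := Scheme.Hom.app_eq_appLE _
  rw [h2]; rfl

theorem res_eq_iff (O : T.Opens) (f f' : Γ(T, ⊤)) :
    O.ι.appTop f = O.ι.appTop f' ↔ T.presheaf.map (homOfLE (le_top : O ≤ ⊤)).op f =
      T.presheaf.map (homOfLE (le_top : O ≤ ⊤)).op f' := by
  rw [appTop_ι, appTop_ι]
  constructor
  · intro h
    have := congrArg O.topIso.hom h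
    rwa [Iso.inv_hom_id_apply, Iso.inv_hom_id_apply] at this
  · intro h; rw [h]

theorem fun_ext_local {f f' : Γ(T, ⊤)}
    (h : ∀ z : T, ∃ O : T.Opens, z ∈ O ∧ O.ι.appTop f = O.ι.appTop f') : f = f' := by
  choose O hO h using h
  refine T.sheaf.eq_of_locally_eq' O ⊤ (fun i => homOfLE le_top) ?_ _ _ (fun z => ?_)
  · intro z _
    exact TopologicalSpace.Opens.mem_iSup.mpr ⟨z, hO z⟩
  · exact (res_eq_iff _ _ _).mp (h z)

theorem appTop_comp {T' T'' : Scheme.{u}} (s : T'' ⟶ T') (t : T' ⟶ T) (f : Γ(T, ⊤)) :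
    (s ≫ t).appTop f = s.appTop (t.appTop f) := by
  rw [Scheme.Hom.comp_appTop, CommRingCat.comp_apply]

/-- Gluing of functions from local unique existence. -/
theorem locfun (P : ∀ {T' : Scheme.{u}} (t : T' ⟶ T), Γ(T', ⊤) → Prop)
    (nat : ∀ {T' T'' : Scheme.{u}} (s : T'' ⟶ T') (t : T' ⟶ T) (f), P t f → P (s ≫ t) (s.appTop f))
    (uniq : ∀ {T' : Scheme.{u}} (t : T' ⟶ T) (f f'), P t f → P t f' → f = f')
    (ex : ∀ z : T, ∃ O : T.Opens, z ∈ O ∧ ∃ f, P O.ι f) :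
    ∃ f : Γ(T, ⊤), ∀ {T' : Scheme.{u}} (t : T' ⟶ T) (f'), P t f' → t.appTop f = f' := by
  choose O hO f hf using ex
  have hP : ∀ z : T, ∀ {T' : Scheme.{u}} (t : T' ⟶ T) (h : Land t (O z)),
      P t (ev ((O z).topIso.hom (f z)) t h) := by
    intro z T' t h
    obtain ⟨y, rfl⟩ : ∃ y : T' ⟶ (O z).toScheme, y ≫ (O z).ι = t :=
      ⟨IsOpenImmersion.lift (O z).ι t (by
        rw [Scheme.Opens.range_ι]; rintro _ ⟨t, rfl⟩; exact h trivial), IsOpenImmersion.lift_fac _ _ _⟩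
    rw [ev_comp _ _ (Land.ι _), ev_ι, Iso.hom_inv_id_apply]
    exact nat _ _ _ (hf z)
  obtain ⟨F, hF, -⟩ := T.sheaf.existsUnique_gluing' O ⊤ (fun i => homOfLE le_top)
    (fun z _ => TopologicalSpace.Opens.mem_iSup.mpr ⟨z, hO z⟩)
    (fun z => (O z).topIso.hom (f z)) (by
      intro z w
      apply ev_ext
      have hz : Land (O z ⊓ O w).ι (O z) := (Land.ι _).left
      have hw : Land (O z ⊓ O w).ι (O w) := (Land.ι _).right
      exact (ev_res (i := inf_le_left) _ _ _ hz).trans (((uniq _ _ _ (hP z _ _) (hP w _ _))).trans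
        (ev_res (i := inf_le_right) _ _ _ hw).symm))
  replace hF : ∀ i : T, T.presheaf.map (homOfLE (le_top : O i ≤ ⊤)).op (F : Γ(T, ⊤)) =
    (O i).topIso.hom (f i) := hF
  change Γ(T, ⊤) at F
  refine ⟨F, fun {T'} t f' hf' => fun_ext_local fun z => ⟨t ⁻¹ᵁ O (t z), hO _, ?_⟩⟩
  have hl : Land ((t ⁻¹ᵁ O (t z)).ι ≫ t) (O (t z)) := Land.iff.mpr fun s => s.2
  refine Eq.trans ?_ (uniq _ _ _ (hP (t z) _ hl) (nat (t ⁻¹ᵁ O (t z)).ι t f' hf'))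
  rw [← hF (t z), ← appTop_comp]
  have hl' : Land ((t ⁻¹ᵁ O (t z)).ι ≫ t) (⊤ : T.Opens) := Land.iff.mpr fun s => trivial
  refine Eq.trans ?_ (ev_res (i := le_top) F _ hl hl').symm
  unfold ev
  have h2 : ((t ⁻¹ᵁ O (t z)).ι ≫ t).appTop = ((t ⁻¹ᵁ O (t z)).ι ≫ t).appLE ⊤ ⊤ hl' :=
    Scheme.Hom.app_eq_appLE _
  rw [h2]

theorem preim_basicOpen {T' : Scheme.{u}} (t : T' ⟶ T) (f : Γ(T, ⊤)) :
    t ⁻¹ᵁ T.basicOpen f = T'.basicOpen (t.appTop f) := Scheme.preimage_basicOpen t f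

theorem isUnit_iff_basicOpen {f : Γ(T, ⊤)} : IsUnit f ↔ T.basicOpen f = ⊤ := by
  constructor
  · intro h; exact T.basicOpen_of_isUnit h
  · intro h
    have := T.toRingedSpace.isUnit_of_isUnit_germ ⊤ f (fun x hx => ?_)
    · exact this
    · exact (T.toRingedSpace.mem_basicOpen f x hx).mp (h.ge hx)

theorem isUnit_local {f : Γ(T, ⊤)}
    (h : ∀ z : T, ∃ O : T.Opens, z ∈ O ∧ IsUnit (O.ι.appTop f)) : IsUnit f := by
  rw [isUnit_iff_basicOpen]
  refine le_antisymm le_top fun z _ => ?_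
  obtain ⟨O, hz, h⟩ := h z
  have h1 := preim_basicOpen O.ι f
  rw [isUnit_iff_basicOpen.mp h] at h1
  have : (⟨z, hz⟩ : O) ∈ O.ι ⁻¹ᵁ (T.basicOpen f) := by rw [h1]; trivial
  exact this

end locfun

/-! ### Cocycles -/

/-- A line bundle presented by a cocycle on a finite open cover; `g i j` is the ratio `e_i / e_j`
of the frames. -/
structure Cocyc (X : Scheme.{u}) : Type (u + 1) where
  J : Type u
  fin : Finite J
  V : J → X.Opens
  cov : ∀ x : X, ∃ i, x ∈ V i
  g : ∀ i j, Γ(X, V i ⊓ V j)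
  g_self : ∀ i {T : Scheme.{u}} (x : T ⟶ X) (h : Land x (V i ⊓ V i)), ev (g i i) x h = 1
  g_mul : ∀ i j l {T : Scheme.{u}} (x : T ⟶ X) (h : Land x (V i ⊓ V j)) (h' : Land x (V j ⊓ V l))
    (h'' : Land x (V i ⊓ V l)), ev (g i j) x h * ev (g j l) x h' = ev (g i l) x h''

namespace Cocyc
variable {X Y : Scheme.{u}} (C : Cocyc X)

/-- Homogeneous sections of degree `m`. -/
structure HS (m : ℕ) where
  σ : ∀ i, Γ(X, C.V i)
  hom : ∀ i j {T : Scheme.{u}} (x : T ⟶ X) (hi : Land x (C.V i)) (hj : Land x (C.V j))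
    (hij : Land x (C.V i ⊓ C.V j)), ev (σ j) x hj = ev (C.g i j) x hij ^ m * ev (σ i) x hi

/-- The nonvanishing locus of a section is `U`. -/
def HS.NV {C : Cocyc X} {m : ℕ} (s : C.HS m) (U : X.Opens) : Prop :=
  ∀ i, C.V i ⊓ U = X.basicOpen (s.σ i)

/-- Ampleness of a cocycle. -/
def Ample : Prop := CompactSpace X ∧ QuasiSeparatedSpace X ∧
  ∀ x : X, ∃ m : ℕ, 0 < m ∧ ∃ s : C.HS m, ∃ U : X.Opens, IsAffineOpen U ∧ x ∈ U ∧ s.NV U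

theorem ev_appLE (f : Y ⟶ X) {U : X.Opens} {W : Y.Opens} (e : W ≤ f ⁻¹ᵁ U) (a : Γ(X, U))
    {T : Scheme.{u}} (x : T ⟶ Y) (h : Land x W) (h' : Land (x ≫ f) U) :
    ev (f.appLE U W e a) x h = ev a (x ≫ f) h' := by
  unfold ev
  rw [← CommRingCat.comp_apply, Scheme.Hom.appLE_comp_appLE]

theorem land_pre {f : Y ⟶ X} {U : X.Opens} {T : Scheme.{u}} {x : T ⟶ Y} (h : Land x (f ⁻¹ᵁ U)) :
    Land (x ≫ f) U := h

theorem land_pre2 {f : Y ⟶ X} {U U' : X.Opens} {T : Scheme.{u}} {x : T ⟶ Y}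
    (h : Land x (f ⁻¹ᵁ U ⊓ f ⁻¹ᵁ U')) : Land (x ≫ f) (U ⊓ U') := h

theorem pre_inf_le (f : Y ⟶ X) (U V : X.Opens) : f ⁻¹ᵁ U ⊓ f ⁻¹ᵁ V ≤ f ⁻¹ᵁ (U ⊓ V) := le_rfl

/-- Pullback of a cocycle. -/
abbrev pull (f : Y ⟶ X) : Cocyc Y where
  J := C.J
  fin := C.fin
  V i := f ⁻¹ᵁ C.V i
  cov y := C.cov (f y)
  g i j := f.appLE (C.V i ⊓ C.V j) (f ⁻¹ᵁ C.V i ⊓ f ⁻¹ᵁ C.V j) (pre_inf_le f _ _) (C.g i j)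
  g_self i T x h := by
    rw [ev_appLE _ _ _ _ _ (land_pre2 h)]
    exact C.g_self i (x ≫ f) _
  g_mul i j l T x h h' h'' := by
    rw [ev_appLE _ _ _ _ _ (land_pre2 h), ev_appLE _ _ _ _ _ (land_pre2 h'),
      ev_appLE _ _ _ _ _ (land_pre2 h'')]
    exact C.g_mul i j l (x ≫ f) _ _ _

theorem pull_g (f : Y ⟶ X) (i j : C.J) {T : Scheme.{u}} (x : T ⟶ Y) (h) (h') :
    ev ((C.pull f).g i j) x h = ev (C.g i j) (x ≫ f) h' := ev_appLE _ _ _ _ _ _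

variable {C} in
/-- Pullback of a section. -/
abbrev HS.pull {m : ℕ} (s : C.HS m) (f : Y ⟶ X) : (C.pull f).HS m where
  σ i := f.appLE _ _ le_rfl (s.σ i)
  hom i j T x hi hj hij := by
    rw [ev_appLE _ _ _ _ _ (land_pre hi), ev_appLE _ _ _ _ _ (land_pre hj),
      C.pull_g f i j x hij (land_pre2 hij)]
    exact s.hom _ _ _ _ _ _

theorem HS.NV.pull {C : Cocyc X} {m : ℕ} {s : C.HS m} {U : X.Opens} (h : s.NV U) (f : Y ⟶ X) :
    (s.pull f).NV (f ⁻¹ᵁ U) := fun i => by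
  have : f ⁻¹ᵁ (C.V i ⊓ U) = f ⁻¹ᵁ X.basicOpen (s.σ i) := by rw [h i]
  rw [Scheme.preimage_basicOpen] at this
  refine this.trans ?_
  rw [Scheme.Hom.app_eq_appLE]

theorem Ample.pull {C : Cocyc X} (h : C.Ample) (f : Y ⟶ X) [IsAffineHom f] : (C.pull f).Ample := by
  obtain ⟨h1, h2, h3⟩ := h
  refine ⟨?_, ?_, fun y => ?_⟩
  · exact QuasiCompact.compactSpace_of_compactSpace f
  · exact quasiSeparatedSpace_of_quasiSeparated f
  · obtain ⟨m, hm, s, U, hU, hx, hs⟩ := h3 (f y)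
    exact ⟨m, hm, s.pull f, f ⁻¹ᵁ U, hU.preimage f, hx, hs.pull f⟩

end Cocyc

/-- Linearization of a cocycle. -/
structure Lin {G : GroupSchemeOver k} {X : SchemeOver k} (α : ActionOver G X) (C : Cocyc X.carrier) where
  u : ∀ (i j : C.J) {T : Scheme.{u}} (g : T ⟶ G.carrier) (x : T ⟶ X.carrier)
    (h : g ≫ G.str = x ≫ X.str), Land x (C.V i) → Land (α.act g x h) (C.V j) → Γ(T, ⊤)
  u_nat : ∀ (i j : C.J) {T T' : Scheme.{u}} (t : T' ⟶ T) (g : T ⟶ G.carrier) (x : T ⟶ X.carrier)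
    (h) (hi) (hj) (h') (hi') (hj'), u i j (t ≫ g) (t ≫ x) h' hi' hj' = t.appTop (u i j g x h hi hj)
  u_one : ∀ (i j : C.J) {T : Scheme.{u}} (x : T ⟶ X.carrier) (h) (hi) (hj) (hij),
    u i j (x ≫ X.str ≫ G.one) x h hi hj = ev (C.g i j) x hij
  u_mul : ∀ (i j l : C.J) {T : Scheme.{u}} (g g' : T ⟶ G.carrier) (x : T ⟶ X.carrier)
    (h₁ h₂ h₃ h₄ hi hj hl hl'),
    u i l (G.mul g g' h₁) x h₂ hi hl = u i j g' x h₃ hi hj * u j l g (α.act g' x h₃) h₄ hj hl'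

theorem Lin.u_congr {G : GroupSchemeOver k} {X : SchemeOver k} {α : ActionOver G X}
    {C : Cocyc X.carrier} (l : Lin α C) (i j : C.J) {T : Scheme.{u}} {g g' : T ⟶ G.carrier}
    {x x' : T ⟶ X.carrier} (hg : g = g') (hx : x = x') (h hi hj h' hi' hj') :
    l.u i j g x h hi hj = l.u i j g' x' h' hi' hj' := by subst hg; subst hx; rfl

theorem Land.congr {X T : Scheme.{u}} {U : X.Opens} {x x' : T ⟶ X} (h : Land x U) (e : x = x') :
    Land x' U := e ▸ h

/-- Pullback of linearizations. -/
def Lin.pull {k' : Type u} [Field k'] {G : GroupSchemeOver k} {X : SchemeOver k}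
    {α : ActionOver G X} {C : Cocyc X.carrier} (l : Lin α C)
    {G' : GroupSchemeOver k'} {X' : SchemeOver k'} (α' : ActionOver G' X')
    (prG : G'.carrier ⟶ G.carrier) (prX : X'.carrier ⟶ X.carrier) (r : Spk k' ⟶ Spk k)
    (hG : prG ≫ G.str = G'.str ≫ r) (hX : prX ≫ X.str = X'.str ≫ r)
    (hGmul : ∀ {T : Scheme.{u}} (a b : T ⟶ G'.carrier) (h h'),
      G'.mul a b h ≫ prG = G.mul (a ≫ prG) (b ≫ prG) h')
    (hGone : G'.one ≫ prG = r ≫ G.one)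
    (hα : ∀ {T : Scheme.{u}} (g : T ⟶ G'.carrier) (x : T ⟶ X'.carrier) (h h'),
      α'.act g x h ≫ prX = α.act (g ≫ prG) (x ≫ prX) h') : Lin α' (C.pull prX) :=
  have key : ∀ {T : Scheme.{u}} (g : T ⟶ G'.carrier) (x : T ⟶ X'.carrier)
      (h : g ≫ G'.str = x ≫ X'.str), (g ≫ prG) ≫ G.str = (x ≫ prX) ≫ X.str := by
    intro T g x h
    rw [Category.assoc, Category.assoc, hG, hX, reasc2 h]
  have land : ∀ {j : C.J} {T : Scheme.{u}} {g : T ⟶ G'.carrier} {x : T ⟶ X'.carrier}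
      {h : g ≫ G'.str = x ≫ X'.str} (hj : Land (α'.act g x h) (prX ⁻¹ᵁ C.V j)),
      Land (α.act (g ≫ prG) (x ≫ prX) (key g x h)) (C.V j) := by
    intro j T g x h hj
    exact Land.congr (x := α'.act g x h ≫ prX) hj (hα g x h _)
  { u := fun i j T g x h hi hj => l.u i j (g ≫ prG) (x ≫ prX) (key g x h) (Cocyc.land_pre hi) (land hj)
    u_nat := fun i j T T' t g x h hi hj h' hi' hj' => by
      rw [← l.u_nat i j t _ _ _ _ _ (by rw [Category.assoc, key g x h]; simp only [Category.assoc]) (Land.comp (Cocyc.land_pre hi) _)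
        ((Land.comp (land hj) t).congr (α.act_natural _ _ _ _ _))]
      exact l.u_congr _ _ (by simp) (by simp) _ _ _ _ _ _
    u_one := fun i j T x h hi hj hij => by
      rw [C.pull_g prX i j x hij (Cocyc.land_pre2 hij), ← l.u_one i j (x ≫ prX) (by simp [G.one_str])
        (Cocyc.land_pre hi) ((Cocyc.land_pre2 hij).right.congr (α.one_act _ _).symm) _]
      exact l.u_congr _ _ (by simp [hGone, reasc2 hX]) rfl _ _ _ _ _ _
    u_mul := fun i j m T g g' x h₁ h₂ h₃ h₄ hi hj hl hl' => by
      have e1 : (g ≫ prG) ≫ G.str = (g' ≫ prG) ≫ G.str := by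
        rw [Category.assoc, Category.assoc, hG, reasc2 h₁]
      have e2 := key g' x h₃
      have e3 : (g ≫ prG) ≫ G.str = α.act (g' ≫ prG) (x ≫ prX) e2 ≫ X.str := by
        rw [e1, e2, α.act_str]
      have e4 : (G.mul (g ≫ prG) (g' ≫ prG) e1) ≫ G.str = (x ≫ prX) ≫ X.str := by
        rw [G.mul_str, e1, e2]
      have e5 : α.act (g ≫ prG) (α'.act g' x h₃ ≫ prX) (key _ _ h₄) =
        α.act (g ≫ prG) (α.act (g' ≫ prG) (x ≫ prX) e2) e3 := α.act_congr rfl (hα _ _ _ _) _ _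
      have := l.u_mul i j m (g ≫ prG) (g' ≫ prG) (x ≫ prX) e1 e4 e2 e3
        (Cocyc.land_pre hi) (land hj) (((land hl').congr e5).congr (α.mul_act _ _ _ _ _ _ _).symm) ((land hl').congr e5)
      refine Eq.trans ?_ (this.trans ?_)
      · exact l.u_congr _ _ (hGmul _ _ _ _) rfl _ _ _ _ _ _
      · congr 1
        exact l.u_congr _ _ rfl (hα _ _ _ _).symm _ _ _ _ _ _ }

/-! ### From line bundles to cocycles -/

section secAt
variable {X Y T T' : Scheme.{u}} {U : X.Opens}

/-- Value of a local section at a point. -/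
def secAt (ℓ : U.toScheme ⟶ Y) (x : T ⟶ X) (h : Land x U) : T ⟶ Y :=
  IsOpenImmersion.lift U.ι x (by
    rw [Scheme.Opens.range_ι]; rintro _ ⟨t, rfl⟩; exact h trivial) ≫ ℓ

theorem secAt_lift (ℓ : U.toScheme ⟶ Y) (y : T ⟶ U.toScheme) (h : Land (y ≫ U.ι) U) :
    secAt ℓ (y ≫ U.ι) h = y ≫ ℓ := by
  unfold secAt
  congr 1
  rw [← cancel_mono U.ι, IsOpenImmersion.lift_fac]

theorem exists_lift (x : T ⟶ X) (h : Land x U) : ∃ y : T ⟶ U.toScheme, y ≫ U.ι = x :=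
  ⟨IsOpenImmersion.lift U.ι x (by
    rw [Scheme.Opens.range_ι]; rintro _ ⟨t, rfl⟩; exact h trivial), IsOpenImmersion.lift_fac _ _ _⟩

theorem secAt_comp (ℓ : U.toScheme ⟶ Y) (x : T ⟶ X) (h : Land x U) (t : T' ⟶ T) (h') :
    t ≫ secAt ℓ x h = secAt ℓ (t ≫ x) h' := by
  obtain ⟨y, rfl⟩ := exists_lift x h
  have h'' : Land ((t ≫ y) ≫ U.ι) U := by simpa using h'
  rw [secAt_lift, ← Category.assoc, ← secAt_lift _ _ h'']
  congr 1

theorem secAt_congr (ℓ : U.toScheme ⟶ Y) {x x' : T ⟶ X} (e : x = x') (h h') :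
    secAt ℓ x h = secAt ℓ x' h' := by subst e; rfl

end secAt

namespace VecBundleData
variable {X : Scheme.{u}} (E : VecBundleData X) {T T' : Scheme.{u}} {U : X.Opens}

/-- A single local section is a frame. -/
def Fr1 (U : X.Opens) (ℓ : U.toScheme ⟶ E.tot) : Prop :=
  ℓ ≫ E.π = U.ι ∧ ∀ {T : Scheme.{u}} (x : T ⟶ X) (h : Land x U) (a : T ⟶ E.tot), a ≫ E.π = x →
    ∃! f : Γ(T, ⊤), a = E.smul f (secAt ℓ x h)

theorem fr1_iff (ℓ : Fin 1 → (U.toScheme ⟶ E.tot)) : E.IsFrame U ℓ ↔ E.Fr1 U (ℓ 0) := by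
  constructor
  · rintro ⟨hs, H⟩
    refine ⟨hs 0, fun {T} x h a ha => ?_⟩
    obtain ⟨y, rfl⟩ := exists_lift x h
    obtain ⟨f, hf, hf'⟩ := (Function.bijective_iff_existsUnique _).mp (H y) ⟨a, ha⟩
    refine ⟨f 0, ?_, fun f₂ h₂ => ?_⟩
    · have := congrArg Subtype.val hf
      simp only [Fin.sum_univ_one] at this
      rw [secAt_lift]; exact this.symm
    · have := hf' (fun _ => f₂) (by
        apply Subtype.ext
        simp only [Fin.sum_univ_one]
        rw [secAt_lift] at h₂
        exact h₂.symm)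
      rw [← this]
  · rintro ⟨hs, H⟩
    have hs' : ∀ i, ℓ i ≫ E.π = U.ι := fun i => by rw [Fin.eq_zero i, hs]
    refine ⟨hs', fun {T} y => (Function.bijective_iff_existsUnique _).mpr ?_⟩
    rintro ⟨a, ha⟩
    have hl : Land (y ≫ U.ι) U := (Land.ι U).comp y
    obtain ⟨f, hf, hf'⟩ := H _ hl a ha
    refine ⟨fun _ => f, ?_, fun f₂ h₂ => ?_⟩
    · apply Subtype.ext
      simp only [Fin.sum_univ_one]
      simp only [secAt_lift] at hf
      exact hf.symm
    · funext i
      rw [Fin.eq_zero i]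
      apply hf'
      have := congrArg Subtype.val h₂
      simp only [Fin.sum_univ_one] at this
      simp only [secAt_lift]; exact this.symm

variable {E}

theorem Fr1.secAt_π {ℓ : U.toScheme ⟶ E.tot} (hℓ : E.Fr1 U ℓ) (x : T ⟶ X) (h : Land x U) :
    secAt ℓ x h ≫ E.π = x := by
  obtain ⟨y, rfl⟩ := exists_lift x h
  rw [secAt_lift, Category.assoc, hℓ.1]

/-- Coordinate with respect to a frame. -/
def Fr1.coord {ℓ : U.toScheme ⟶ E.tot} (hℓ : E.Fr1 U ℓ) (a : T ⟶ E.tot) (h : Land (a ≫ E.π) U) :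
    Γ(T, ⊤) := (hℓ.2 (a ≫ E.π) h a rfl).choose

theorem Fr1.coord_spec {ℓ : U.toScheme ⟶ E.tot} (hℓ : E.Fr1 U ℓ) (a : T ⟶ E.tot)
    (h : Land (a ≫ E.π) U) : a = E.smul (hℓ.coord a h) (secAt ℓ (a ≫ E.π) h) :=
  (hℓ.2 (a ≫ E.π) h a rfl).choose_spec.1

theorem Fr1.coord_uniq {ℓ : U.toScheme ⟶ E.tot} (hℓ : E.Fr1 U ℓ) {a : T ⟶ E.tot}
    {h : Land (a ≫ E.π) U} {f : Γ(T, ⊤)} (x : T ⟶ X) (h' : Land x U) 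
    (e : a = E.smul f (secAt ℓ x h')) : hℓ.coord a h = f := by
  have : a ≫ E.π = x := by rw [e, E.smul_π, hℓ.secAt_π]
  subst this
  exact ((hℓ.2 (a ≫ E.π) h a rfl).choose_spec.2 f e).symm

theorem Fr1.coord_congr {ℓ : U.toScheme ⟶ E.tot} (hℓ : E.Fr1 U ℓ) {a a' : T ⟶ E.tot}
    (e : a = a') (h h') : hℓ.coord a h = hℓ.coord a' h' := by subst e; rfl

theorem Fr1.coord_nat {ℓ : U.toScheme ⟶ E.tot} (hℓ : E.Fr1 U ℓ) (a : T ⟶ E.tot)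
    (h : Land (a ≫ E.π) U) (t : T' ⟶ T) (h') :
    hℓ.coord (t ≫ a) h' = t.appTop (hℓ.coord a h) := by
  apply hℓ.coord_uniq (t ≫ a ≫ E.π) (h.comp t)
  rw [← secAt_comp _ _ h, ← E.smul_natural, ← hℓ.coord_spec]

theorem Fr1.coord_smul {ℓ : U.toScheme ⟶ E.tot} (hℓ : E.Fr1 U ℓ) (f : Γ(T, ⊤)) (a : T ⟶ E.tot)
    (h : Land (a ≫ E.π) U) (h') : hℓ.coord (E.smul f a) h' = f * hℓ.coord a h := by
  apply hℓ.coord_uniq (a ≫ E.π) h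
  rw [E.mul_smul, ← hℓ.coord_spec]

theorem Fr1.coord_zero {ℓ : U.toScheme ⟶ E.tot} (hℓ : E.Fr1 U ℓ) (x : T ⟶ X)
    (h : Land x U) (h') : hℓ.coord (x ≫ E.zero) h' = 0 := by
  apply hℓ.coord_uniq x h
  rw [E.zero_smul, hℓ.secAt_π]

theorem Fr1.coord_inj {ℓ : U.toScheme ⟶ E.tot} (hℓ : E.Fr1 U ℓ) {a b : T ⟶ E.tot} (h h')
    (e : a ≫ E.π = b ≫ E.π) (e' : hℓ.coord a h = hℓ.coord b h') : a = b := by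
  rw [hℓ.coord_spec a h, hℓ.coord_spec b h', e']
  congr 1
  exact secAt_congr _ e _ _

theorem Fr1.exists_sec {ℓ : U.toScheme ⟶ E.tot} (hℓ : E.Fr1 U ℓ) (s : X ⟶ E.tot)
    (hs : s ≫ E.π = 𝟙 X) : ∃ σ : Γ(X, U), ∀ {T : Scheme.{u}} (x : T ⟶ X) (h : Land x U) (h'),
      ev σ x h = hℓ.coord (x ≫ s) h' := by
  have key : ∀ {T : Scheme.{u}} (x : T ⟶ X) (h : Land x U), Land ((x ≫ s) ≫ E.π) U := by
    intro T x h
    exact h.congr (by simp [hs])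
  obtain ⟨f, hf⟩ := exists_ev (fun {T} x h => hℓ.coord (x ≫ s) (key x h)) (by
    intro T T' t x h h'
    rw [← hℓ.coord_nat _ (key x h) _ (by simpa using (key x h).comp t)]
    exact hℓ.coord_congr (by simp) _ _)
  exact ⟨f, fun x h h' => hf x h⟩

/-- The universal coordinate function. -/
theorem Fr1.exists_univ {ℓ : U.toScheme ⟶ E.tot} (hℓ : E.Fr1 U ℓ) :
    ∃ κ : Γ(E.tot, E.π ⁻¹ᵁ U), ∀ {T : Scheme.{u}} (a : T ⟶ E.tot) (h : Land a (E.π ⁻¹ᵁ U)) (h'),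
      ev κ a h = hℓ.coord a h' := by
  obtain ⟨f, hf⟩ := exists_ev (fun {T} (a : T ⟶ E.tot) (h : Land a (E.π ⁻¹ᵁ U)) =>
    hℓ.coord a (Cocyc.land_pre h)) (by
      intro T T' t x h h'
      exact hℓ.coord_nat _ _ _ _)
  exact ⟨f, fun x h h' => hf x h⟩

theorem mem_basicOpen_iff_ne {ℓ : U.toScheme ⟶ E.tot} (hℓ : E.Fr1 U ℓ) (s : X ⟶ E.tot)
    (hs : s ≫ E.π = 𝟙 X) (σ : Γ(X, U))
    (hσ : ∀ {T : Scheme.{u}} (x : T ⟶ X) (h : Land x U) (h'), ev σ x h = hℓ.coord (x ≫ s) h')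
    (y : X) (hy : y ∈ U) : y ∈ X.basicOpen σ ↔ s.base y ≠ E.zero.base y := by
  obtain ⟨κ, hκ⟩ := hℓ.exists_univ
  have key : ∀ (s' : X ⟶ E.tot) (hs' : s' ≫ E.π = 𝟙 X) (σ' : Γ(X, U))
      (hσ' : ∀ {T : Scheme.{u}} (x : T ⟶ X) (h : Land x U) (h'), ev σ' x h = hℓ.coord (x ≫ s') h'),
      y ∈ X.basicOpen σ' ↔ s' y ∈ E.tot.basicOpen κ := by
    intro s' hs' σ' hσ'
    have hl : Land (U.ι ≫ s') (E.π ⁻¹ᵁ U) := by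
      have := (Land.ι U).congr (show U.ι = (U.ι ≫ s') ≫ E.π by simp [hs'])
      exact this
    have h1 := ev_basicOpen σ' U.ι (Land.ι U)
    have h2 := ev_basicOpen κ (U.ι ≫ s') hl
    rw [hσ' _ _ (Cocyc.land_pre hl)] at h1
    rw [hκ _ _ (Cocyc.land_pre hl)] at h2
    have h3 := h1.symm.trans h2
    have : (⟨y, hy⟩ : U) ∈ U.ι ⁻¹ᵁ X.basicOpen σ' ↔ (⟨y, hy⟩ : U) ∈ (U.ι ≫ s') ⁻¹ᵁ E.tot.basicOpen κ := by
      rw [h3]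
    exact this
  constructor
  · intro h h'
    have h1 := (key s hs σ hσ).mp h
    have h2 := (key E.zero E.zero_π 0 (fun x h h' => by rw [hℓ.coord_zero x h, ev_zero])).mpr
      (by rw [← show s y = E.zero y from h']; exact h1)
    simp at h2
  · intro h
    by_contra hn
    apply h
    let x := X.fromSpecResidueField y
    have hx : ∀ t, x t = y := fun t => X.fromSpecResidueField_apply y t
    have hl : Land x U := Land.iff.mpr fun t => by rw [hx]; exact hy
    have h1 : ev σ x hl = 0 := by
      have := ev_basicOpen σ x hl
      rw [← basicOpen_eq_bot_iff, this]
      ext t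
      simp only [TopologicalSpace.Opens.coe_bot, Set.mem_empty_iff_false, iff_false]
      intro ht
      exact hn (by rw [← hx t]; exact ht)
    have h2 : x ≫ s = x ≫ E.zero := by
      have l1 : Land ((x ≫ s) ≫ E.π) U := hl.congr (by simp [hs])
      have l2 : Land ((x ≫ E.zero) ≫ E.π) U := hl.congr (by simp [E.zero_π])
      apply hℓ.coord_inj l1 l2 (by simp [hs, E.zero_π])
      rw [hℓ.coord_zero _ hl, ← hσ x hl, h1]
    let t : Spec (X.residueField y) := default
    have := congrArg (fun f => f.base t) h2
    simp only [Scheme.Hom.comp_base, TopCat.hom_comp, ContinuousMap.comp_apply] at this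
    have e := hx t
    change s.base (x t) = E.zero.base (x t) at this
    rwa [e] at this

end VecBundleData

section vbpart
/-! ### From line bundles to cocycles -/

namespace VecBundleData
variable {X : Scheme.{u}} {E : VecBundleData X} {T T' : Scheme.{u}} {U V : X.Opens}

theorem Fr1.smul_inj {ℓ : U.toScheme ⟶ E.tot} (hℓ : E.Fr1 U ℓ) (x : T ⟶ X) (h : Land x U)
    {f f' : Γ(T, ⊤)} (e : E.smul f (secAt ℓ x h) = E.smul f' (secAt ℓ x h)) : f = f' := by
  have hl : Land (E.smul f (secAt ℓ x h) ≫ E.π) U :=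
    h.congr (by rw [E.smul_π, hℓ.secAt_π])
  rw [← hℓ.coord_uniq (h := hl) x h rfl, hℓ.coord_uniq x h e]

theorem Fr1.exists_trans {ℓ : U.toScheme ⟶ E.tot} (hℓ : E.Fr1 U ℓ) {ℓ' : V.toScheme ⟶ E.tot}
    (hℓ' : E.Fr1 V ℓ') : ∃ g : Γ(X, U ⊓ V), ∀ {T : Scheme.{u}} (x : T ⟶ X) (h : Land x (U ⊓ V))
      (hi : Land x U) (hj : Land x V), secAt ℓ x hi = E.smul (ev g x h) (secAt ℓ' x hj) := by
  have key : ∀ {T : Scheme.{u}} (x : T ⟶ X) (h : Land x (U ⊓ V)),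
      Land (secAt ℓ x h.left ≫ E.π) V := by
    intro T x h
    exact h.right.congr (hℓ.secAt_π _ _).symm
  obtain ⟨f, hf⟩ := exists_ev (U := U ⊓ V) (fun {T} x h => hℓ'.coord (secAt ℓ x h.left) (key x h)) (by
    intro T T' t x h h'
    rw [← hℓ'.coord_nat _ (key x h) t (by
      have := (key x h).comp t
      rwa [← Category.assoc] at this)]
    exact hℓ'.coord_congr (secAt_comp _ _ _ _ _).symm _ _)
  refine ⟨f, fun x h hi hj => ?_⟩
  rw [hf x h]
  refine (hℓ'.coord_spec (secAt ℓ x hi) (key x h)).trans ?_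
  congr 1
  exact secAt_congr _ (hℓ.secAt_π _ _) _ _

end VecBundleData

open VecBundleData

theorem LineBundle.exists_frames {X : Scheme.{u}} [CompactSpace X] (L : LineBundle X) :
    ∃ (J : Type u) (_ : Finite J) (V : J → X.Opens) (ℓ : ∀ i, (V i).toScheme ⟶ L.tot),
      (∀ x : X, ∃ i, x ∈ V i) ∧ ∀ i, L.toVecBundleData.Fr1 (V i) (ℓ i) := by
  choose U s hx hs using L.locTriv
  obtain ⟨t, ht⟩ := CompactSpace.elim_nhds_subcover (fun x => (U x : Set X))
    (fun x => (U x).isOpen.mem_nhds (hx x))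
  refine ⟨t, inferInstance, fun i => U i.1, fun i => s i.1 0, fun x => ?_, fun i => ?_⟩
  · have : x ∈ ⋃ x ∈ t, (U x : Set X) := by rw [ht]; trivial
    simp only [Set.mem_iUnion] at this
    obtain ⟨i, hi, h⟩ := this
    exact ⟨⟨i, hi⟩, h⟩
  · exact (fr1_iff _ _).mp (hs i.1)

/-- A cocycle with a compatible system of frames. -/
structure FrCoc {X : Scheme.{u}} (L : LineBundle X) (C : Cocyc X) where
  ℓ : ∀ i, (C.V i).toScheme ⟶ L.tot
  fr : ∀ i, L.toVecBundleData.Fr1 (C.V i) (ℓ i)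
  tr : ∀ i j {T : Scheme.{u}} (x : T ⟶ X) (h : Land x (C.V i ⊓ C.V j))
      (hi : Land x (C.V i)) (hj : Land x (C.V j)),
      secAt (ℓ i) x hi = L.smul (ev (C.g i j) x h) (secAt (ℓ j) x hj)

theorem LineBundle.exists_frCoc {X : Scheme.{u}} [CompactSpace X] (L : LineBundle X) :
    ∃ C : Cocyc X, Nonempty (FrCoc L C) := by
  obtain ⟨J, fin, V, ℓ, cov, fr⟩ := L.exists_frames
  choose g hg using fun i j => (fr i).exists_trans (fr j)
  refine ⟨⟨J, fin, V, cov, g, fun i T x h => ?_, fun i j l T x h h' h'' => ?_⟩, ⟨ℓ, fr, ?_⟩⟩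
  · apply (fr i).smul_inj x h.left
    rw [← hg i i x h h.left h.left, L.one_smul]
  · apply (fr l).smul_inj x h'.right
    rw [L.mul_smul, ← hg j l x h' h'.left, ← hg i j x h h.left, ← hg i l x h'' h.left]
  · exact fun i j {T} x h hi hj => hg i j x h hi hj

theorem secAt_β {X : Scheme.{u}} {L M N : LineBundle X}
    (β : ∀ {T : Scheme.{u}} (a : T ⟶ L.tot) (b : T ⟶ M.tot), a ≫ L.π = b ≫ M.π → (T ⟶ N.tot))
    (hnat : ∀ {T' T : Scheme.{u}} (g : T' ⟶ T) (a : T ⟶ L.tot) (b : T ⟶ M.tot) (h h'),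
      g ≫ β a b h = β (g ≫ a) (g ≫ b) h') {U : X.Opens}
    (a : U.toScheme ⟶ L.tot) (b : U.toScheme ⟶ M.tot) (h) {T : Scheme.{u}} (x : T ⟶ X) (hx : Land x U)
    (h') : secAt (β a b h) x hx = β (secAt a x hx) (secAt b x hx) h' := hnat _ _ _ _ _

theorem FrCoc.pow {X : Scheme.{u}} {L : LineBundle X} {C : Cocyc X} (F : FrCoc L C) (m : ℕ) :
    ∀ (N : LineBundle X), IsTensorPow L m N → ∃ e : ∀ i, (C.V i).toScheme ⟶ N.tot,
    (∀ i, N.toVecBundleData.Fr1 (C.V i) (e i)) ∧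
    ∀ i j {T : Scheme.{u}} (x : T ⟶ X) (h : Land x (C.V i ⊓ C.V j))
      (hi : Land x (C.V i)) (hj : Land x (C.V j)),
      secAt (e i) x hi = N.smul (ev (C.g i j) x h ^ m) (secAt (e j) x hj) := by
  induction m with
  | zero =>
    rintro N ⟨s, hs, H⟩
    have e : ∀ (i) {T : Scheme.{u}} (x : T ⟶ X) (h : Land x (C.V i)),
        secAt ((C.V i).ι ≫ s 0) x h = x ≫ s 0 := by
      intro i T x h
      obtain ⟨y, rfl⟩ := exists_lift x h
      rw [secAt_lift, Category.assoc]
    refine ⟨fun i => (C.V i).ι ≫ s 0, fun i => ⟨by rw [Category.assoc, hs, Category.comp_id], ?_⟩, ?_⟩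
    · intro T x h a ha
      rw [e]
      obtain ⟨f, hf, hf'⟩ := (Function.bijective_iff_existsUnique _).mp (H x) ⟨a, ha⟩
      refine ⟨f 0, ?_, fun f₂ h₂ => ?_⟩
      · have := congrArg Subtype.val hf
        simp only [Fin.sum_univ_one] at this
        exact this.symm
      · have := hf' (fun _ => f₂) (by
          apply Subtype.ext
          simp only [Fin.sum_univ_one]
          exact h₂.symm)
        rw [← this]
    · intro i j T x h hi hj
      rw [e, e, pow_zero, N.one_smul]
  | succ m ih =>
    rintro N ⟨M, hM, β, h1, h2, h3, h4, h5, h6, h7⟩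
    obtain ⟨e, he, he'⟩ := ih M hM
    have hc : ∀ i, e i ≫ M.π = F.ℓ i ≫ L.π := fun i => by rw [(he i).1, (F.fr i).1]
    have hs : ∀ i {T : Scheme.{u}} (x : T ⟶ X) (hi : Land x (C.V i)),
      secAt (e i) x hi ≫ M.π = secAt (F.ℓ i) x hi ≫ L.π := fun i T x hi => by
        rw [(he i).secAt_π, (F.fr i).secAt_π]
    refine ⟨fun i => β (e i) (F.ℓ i) (hc i), fun i => ?_, fun i j T x h hi hj => ?_⟩
    · exact (fr1_iff _ _).mp (h7 (C.V i) (fun _ => e i) (fun _ => F.ℓ i) ((fr1_iff _ _).mpr (he i))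
        ((fr1_iff _ _).mpr (F.fr i)) (hc i))
    · rw [secAt_β β h2 _ _ _ _ _ (hs i x hi), secAt_β β h2 _ _ _ _ _ (hs j x hj)]
      have E1 := he' i j x h hi hj
      have E2 := F.tr i j x h hi hj
      have e3 : M.smul (ev (C.g i j) x h ^ m) (secAt (e j) x hj) ≫ M.π =
          L.smul (ev (C.g i j) x h) (secAt (F.ℓ j) x hj) ≫ L.π := by rw [← E1, ← E2, hs]
      have e4 : M.smul (ev (C.g i j) x h ^ m) (secAt (e j) x hj) ≫ M.π =
          (secAt (F.ℓ j) x hj) ≫ L.π := by rw [M.smul_π, hs]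
      trans β _ _ e3
      · congr 1
      · rw [h6 _ _ _ _ e4, h5 _ _ _ _ (hs j x hj), ← N.mul_smul]
        congr 1
        ring

theorem FrCoc.ample {X : Scheme.{u}} {L : LineBundle X} {C : Cocyc X} (F : FrCoc L C)
    (hL : IsAmple L) : C.Ample := by
  obtain ⟨h1, h2, h3⟩ := hL
  refine ⟨h1, h2, fun x => ?_⟩
  obtain ⟨m, hm, N, hN, s, hs, U, hU, hx, hUs⟩ := h3 x
  obtain ⟨e, he, he'⟩ := F.pow m N hN
  choose σ hσ using fun i => (he i).exists_sec s hs
  refine ⟨m, hm, ⟨σ, fun i j T x hi hj hij => ?_⟩, U, hU, hx, fun i => ?_⟩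
  · have l : ∀ i, Land x (C.V i) → Land ((x ≫ s) ≫ N.π) (C.V i) := by
      intro i hi
      exact hi.congr (by simp [hs])
    rw [hσ j x hj (l j hj)]
    apply (he j).coord_uniq x hj
    rw [mul_comm, N.mul_smul, ← he' i j x hij hi hj, hσ i x hi (l i hi)]
    refine ((he i).coord_spec (x ≫ s) (l i hi)).trans ?_
    congr 1
    exact secAt_congr _ (by simp [hs]) _ _
  · ext y
    constructor
    · rintro ⟨hy, hyU⟩
      refine (mem_basicOpen_iff_ne (he i) s hs (σ i) (hσ i) y hy).mpr ?_
      change y ∈ (U : Set X) at hyU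
      rw [hUs] at hyU
      exact hyU
    · intro hy
      have hyV : y ∈ C.V i := X.basicOpen_le _ hy
      refine ⟨hyV, ?_⟩
      have := (mem_basicOpen_iff_ne (he i) s hs (σ i) (hσ i) y hyV).mp hy
      rw [hUs]
      exact this

theorem LinearizationData.lact_congr {G : GroupSchemeOver k} {X : SchemeOver k}
    {α : ActionOver G X} {L : LineBundle X.carrier} (l : LinearizationData α L) {T : Scheme.{u}}
    {g g' : T ⟶ G.carrier} {e e' : T ⟶ L.tot} (hg : g = g') (he : e = e') (h h') :
    l.lact g e h = l.lact g' e' h' := by subst hg; subst he; rfl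

/-- The linearization of the cocycle. -/
def FrCoc.lin {G : GroupSchemeOver k} {X : SchemeOver k} {α : ActionOver G X}
    {L : LineBundle X.carrier} {C : Cocyc X.carrier} (F : FrCoc L C) (l : LinearizationData α L) :
    Lin α C :=
  have key : ∀ {i} {T : Scheme.{u}} {g : T ⟶ G.carrier} {x : T ⟶ X.carrier}
      (h : g ≫ G.str = x ≫ X.str) (hi : Land x (C.V i)),
      g ≫ G.str = (secAt (F.ℓ i) x hi ≫ L.π) ≫ X.str := by
    intro i T g x h hi; rw [(F.fr i).secAt_π, h]
  have hπ : ∀ {i} {T : Scheme.{u}} {g : T ⟶ G.carrier} {x : T ⟶ X.carrier}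
      (h : g ≫ G.str = x ≫ X.str) (hi : Land x (C.V i)),
      l.lact g (secAt (F.ℓ i) x hi) (key h hi) ≫ L.π = α.act g x h := by
    intro i T g x h hi
    rw [l.lact_π _ _ _ (key h hi)]
    exact α.act_congr rfl ((F.fr i).secAt_π _ _) _ _
  { u := fun i j T g x h hi hj => (F.fr j).coord (l.lact g (secAt (F.ℓ i) x hi) (key h hi))
      (hj.congr (hπ h hi).symm)
    u_nat := fun i j T T' t g x h hi hj h' hi' hj' => by
      have e1 : t ≫ secAt (F.ℓ i) x hi = secAt (F.ℓ i) (t ≫ x) hi' := secAt_comp _ _ _ _ _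
      have e2 : (t ≫ g) ≫ G.str = ((t ≫ secAt (F.ℓ i) x hi) ≫ L.π) ≫ X.str := by
        rw [e1]; exact key h' hi'
      have e3 := l.lact_natural t g (secAt (F.ℓ i) x hi) (key h hi) e2
      have e4 : t ≫ l.lact g (secAt (F.ℓ i) x hi) (key h hi) =
        l.lact (t ≫ g) (secAt (F.ℓ i) (t ≫ x) hi') (key h' hi') :=
          e3.trans (l.lact_congr rfl e1 _ _)
      have hl : Land ((t ≫ l.lact g (secAt (F.ℓ i) x hi) (key h hi)) ≫ L.π) (C.V j) := by
        rw [e4]; exact hj'.congr (hπ h' hi').symm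
      rw [← (F.fr j).coord_nat _ _ _ hl]
      exact (F.fr j).coord_congr e4.symm _ _
    u_one := fun i j T x h hi hj hij => by
      apply (F.fr j).coord_uniq x hij.right
      rw [← F.tr i j x hij hi]
      refine (l.lact_congr ?_ rfl _ ?_).trans (l.one_lact (secAt (F.ℓ i) x hi) ?_)
      · rw [(F.fr i).secAt_π, Category.assoc]
      · simp [G.one_str]
      · simp [G.one_str]
    u_mul := fun i j m T g g' x h₁ h₂ h₃ h₄ hi hj hl hl' => by
      have e1 : l.lact g' (secAt (F.ℓ i) x hi) (key h₃ hi) =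
          L.smul ((F.fr j).coord (l.lact g' (secAt (F.ℓ i) x hi) (key h₃ hi))
            (hj.congr (hπ h₃ hi).symm)) (secAt (F.ℓ j) (α.act g' x h₃) hj) := by
        refine ((F.fr j).coord_spec (l.lact g' (secAt (F.ℓ i) x hi) (key h₃ hi)) 
            (hj.congr (hπ h₃ hi).symm)).trans ?_
        congr 1
        exact secAt_congr _ (hπ h₃ hi) _ _
      have e2 : g ≫ G.str = (l.lact g' (secAt (F.ℓ i) x hi) (key h₃ hi) ≫ L.π) ≫ X.str := by
        rw [hπ, h₄]
      have e3 : l.lact (G.mul g g' h₁) (secAt (F.ℓ i) x hi) (key h₂ hi) =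
         L.smul ((F.fr j).coord (l.lact g' (secAt (F.ℓ i) x hi) (key h₃ hi))
            (hj.congr (hπ h₃ hi).symm)) (l.lact g (secAt (F.ℓ j) (α.act g' x h₃) hj) (key h₄ hj)) := by
        refine (l.mul_lact _ _ _ _ _ (key h₃ hi) e2).trans ?_
        refine (l.lact_congr rfl e1 _ (by rw [← e1]; exact e2)).trans ?_
        exact l.lact_smul _ _ _ _ _
      rw [← (F.fr m).coord_smul _ _ _ (by rw [L.smul_π]; exact hl'.congr (hπ h₄ hj).symm)]
      exact (F.fr m).coord_congr e3 _ _ }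

theorem partA {G : GroupSchemeOver k} {X : SchemeOver k} (α : ActionOver G X)
    (L : LineBundle X.carrier) (hL : IsAmple L) (hl : α.IsLinearized L) :
    ∃ C : Cocyc X.carrier, C.Ample ∧ Nonempty (Lin α C) := by
  haveI := hL.1
  obtain ⟨C, ⟨F⟩⟩ := L.exists_frCoc
  exact ⟨C, F.ample hL, hl.map F.lin⟩

end vbpart

/-! ### Gluing the total space -/

/-- The affine line. -/
abbrev A1 (S : Scheme.{u}) : Scheme.{u} := AffineSpace PUnit.{u+1} S
/-- The projection. -/
def prA (S : Scheme.{u}) : A1 S ⟶ S := A1 S ↘ S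
/-- The coordinate of a point. -/
def cA {S T : Scheme.{u}} (z : T ⟶ A1 S) : Γ(T, ⊤) := z.appTop (AffineSpace.coord S PUnit.unit)
/-- A point of the affine line. -/
def mkA {S T : Scheme.{u}} (y : T ⟶ S) (f : Γ(T, ⊤)) : T ⟶ A1 S := AffineSpace.homOfVector y (fun _ => f)

section A1
variable {S T T' : Scheme.{u}}
@[simp] theorem mkA_pr (y : T ⟶ S) (f : Γ(T, ⊤)) : mkA y f ≫ prA S = y :=
  AffineSpace.homOfVector_over _ _
@[simp] theorem mkA_pr_assoc (y : T ⟶ S) (f : Γ(T, ⊤)) {Z : Scheme.{u}} (h : S ⟶ Z) :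
    mkA y f ≫ prA S ≫ h = y ≫ h := by rw [← Category.assoc, mkA_pr]
@[simp] theorem cA_mk (y : T ⟶ S) (f : Γ(T, ⊤)) : cA (mkA y f) = f :=
  AffineSpace.homOfVector_appTop_coord _ _ _
theorem A1_ext {z z' : T ⟶ A1 S} (h : z ≫ prA S = z' ≫ prA S) (h' : cA z = cA z') : z = z' :=
  AffineSpace.hom_ext h (fun _ => h')
theorem cA_comp (t : T' ⟶ T) (z : T ⟶ A1 S) : cA (t ≫ z) = t.appTop (cA z) := appTop_comp _ _ _
end A1

namespace Cocyc
variable {X : Scheme.{u}} (C : Cocyc X)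

/-- Index type for the gluing. -/
structure Idx : Type u where
  i : C.J
  W : X.Opens
  le : W ≤ C.V i

instance : Preorder C.Idx where
  le p q := p.W ≤ q.W
  le_refl p := le_refl p.W
  le_trans p q r h h' := le_trans (α := X.Opens) h h'

variable {C} in
theorem Idx.le_def {p q : C.Idx} : p ≤ q ↔ p.W ≤ q.W := Iff.rfl

/-- The cover by small opens. -/
@[simps] def dcov : X.OpenCover where
  I₀ := C.Idx
  X p := p.W.toScheme
  f p := p.W.ι
  mem₀ := by
    rw [Scheme.presieve₀_mem_precoverage_iff]
    refine ⟨fun x => ?_, inferInstance⟩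
    obtain ⟨i, hi⟩ := C.cov x
    exact ⟨⟨i, C.V i, le_rfl⟩, ⟨x, hi⟩, rfl⟩

instance : Preorder C.dcov.I₀ := inferInstanceAs <| Preorder C.Idx
instance : Small.{u} C.dcov.I₀ := inferInstanceAs <| Small.{u} C.Idx

instance : C.dcov.LocallyDirected :=
  .ofIsBasisOpensRange (by
    intro p q
    change p.W ≤ q.W ↔ (Scheme.Opens.ι p.W).opensRange ≤ (Scheme.Opens.ι q.W).opensRange
    rw [Scheme.Opens.opensRange_ι, Scheme.Opens.opensRange_ι]) <| by
    rw [TopologicalSpace.Opens.isBasis_iff_nbhd]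
    intro U x hx
    obtain ⟨i, hi⟩ := C.cov x
    refine ⟨U ⊓ C.V i, ⟨⟨i, U ⊓ C.V i, inf_le_right⟩, ?_⟩, ⟨hx, hi⟩, inf_le_left⟩
    exact Scheme.Opens.opensRange_ι _

/-- transition on the base -/
def trW {p q : C.Idx} (h : p ⟶ q) : p.W.toScheme ⟶ q.W.toScheme := C.dcov.trans (i := p) (j := q) h

theorem trW_ι {p q : C.Idx} (h : p ⟶ q) : C.trW h ≫ q.W.ι = p.W.ι := C.dcov.trans_map h
theorem trW_id (p : C.Idx) : C.trW (𝟙 p) = 𝟙 _ := C.dcov.trans_id p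
theorem trW_comp {p q r : C.Idx} (h : p ⟶ q) (h' : q ⟶ r) : C.trW (h ≫ h') = C.trW h ≫ C.trW h' :=
  C.dcov.trans_comp (i := p) (j := q) (k := r) h h'

variable {C} in
theorem Idx.land (p q : C.Idx) (h : p ≤ q) {T : Scheme.{u}} (y : T ⟶ p.W.toScheme) :
    Land (y ≫ p.W.ι) (C.V p.i ⊓ C.V q.i) :=
  (((Land.ι p.W).comp y).mono p.le).inf (((Land.ι p.W).comp y).mono (le_trans (α := X.Opens) h q.le))

/-- transition maps -/
def trA {p q : C.Idx} (h : p ⟶ q) : A1 p.W.toScheme ⟶ A1 q.W.toScheme :=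
  mkA (prA _ ≫ C.trW h) (ev (C.g p.i q.i) (prA _ ≫ p.W.ι) (p.land q (leOfHom h) _) * cA (𝟙 _))

theorem trA_pr {p q : C.Idx} (h : p ⟶ q) :
    C.trA h ≫ prA _ = prA _ ≫ C.trW h := mkA_pr _ _

theorem cA_trA {p q : C.Idx} (h : p ⟶ q) {T : Scheme.{u}} (z : T ⟶ A1 p.W.toScheme) (hl) :
    cA (z ≫ C.trA h) = ev (C.g p.i q.i) (z ≫ prA _ ≫ p.W.ι) hl * cA z := by
  rw [cA_comp, trA, cA_mk, map_mul, ← cA_comp, Category.comp_id, ev_comp']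

theorem trA_id (p : C.Idx) : C.trA (𝟙 p) = 𝟙 _ := by
  apply A1_ext
  · rw [trA_pr, Category.id_comp, trW_id, Category.comp_id]
  · have hl := p.land p le_rfl (prA _)
    have := C.cA_trA (𝟙 p) (𝟙 _) (by rwa [Category.id_comp])
    rw [Category.id_comp, C.g_self, one_mul] at this
    exact this

theorem trA_comp {p q r : C.Idx} (h : p ⟶ q) (h' : q ⟶ r) :
    C.trA (h ≫ h') = C.trA h ≫ C.trA h' := by
  apply A1_ext
  · rw [trA_pr, Category.assoc, trA_pr, reasc2 (C.trA_pr h), trW_comp]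
  · have e1 : C.trA h ≫ prA q.W.toScheme ≫ q.W.ι = prA p.W.toScheme ≫ p.W.ι := by
      rw [reasc2 (C.trA_pr h), trW_ι]
    have hl := p.land r (leOfHom (h ≫ h')) (prA _)
    have hl1 := p.land q (leOfHom h) (prA _)
    have hl2 : Land (prA p.W.toScheme ≫ p.W.ι) (C.V q.i ⊓ C.V r.i) := hl1.right.inf hl.right
    have h1 := C.cA_trA (h ≫ h') (𝟙 _) (by rwa [Category.id_comp])
    have h2 := C.cA_trA h' (C.trA h) (hl2.congr e1.symm)
    have h3 := C.cA_trA h (𝟙 _) (by rwa [Category.id_comp])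
    rw [Category.id_comp] at h1 h3
    rw [h1, h2, h3, ev_congr rfl e1 _ hl2, ← mul_assoc, mul_comm (ev _ _ _) (ev _ _ _)]
    congr 1
    rw [ev_congr rfl (Category.id_comp _) _ hl, ev_congr rfl (Category.id_comp _) _ hl1]
    exact (C.g_mul _ _ _ _ _ _ _).symm

theorem trA_isPullback {p q : C.Idx} (h : p ⟶ q) :
    IsPullback (C.trA h) (prA _) (prA _) (C.trW h) := by
  refine ⟨⟨C.trA_pr h⟩, ⟨PullbackCone.IsLimit.mk _ (fun s => ?_) (fun s => ?_) (fun s => ?_) ?_⟩⟩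
  · exact mkA s.snd (ev (C.g q.i p.i) (s.snd ≫ p.W.ι) 
      ((p.land q (leOfHom h) _).right.inf (p.land q (leOfHom h) _).left) * cA s.fst)
  · have hl := p.land q (leOfHom h) s.snd
    apply A1_ext
    · rw [Category.assoc, trA_pr, mkA_pr_assoc, s.condition]
    · have e : mkA s.snd (ev (C.g q.i p.i) (s.snd ≫ p.W.ι) 
        ((p.land q (leOfHom h) _).right.inf (p.land q (leOfHom h) _).left) * cA s.fst) ≫
          prA _ ≫ p.W.ι = s.snd ≫ p.W.ι := by rw [mkA_pr_assoc]
      rw [cA_trA _ _ _ (hl.congr e.symm), cA_mk, ev_congr rfl e _ hl, ← mul_assoc,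
        C.g_mul _ _ _ _ _ _ (hl.left.inf hl.left), C.g_self, one_mul]
  · rw [mkA_pr]
  · intro s m h1 h2
    have hl := p.land q (leOfHom h) s.snd
    apply A1_ext
    · rw [mkA_pr, h2]
    · have e : m ≫ prA _ ≫ p.W.ι = s.snd ≫ p.W.ι := by rw [← h2, Category.assoc]
      rw [cA_mk, ← h1, cA_trA _ _ _ (hl.congr e.symm), ev_congr rfl e _ hl, ← mul_assoc,
        C.g_mul _ _ _ _ _ _ (hl.right.inf hl.right), C.g_self, one_mul]

/-- The gluing data -/
def rgd : C.dcov.RelativeGluingData where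
  functor := 
    { obj := fun (p : C.Idx) => A1 p.W.toScheme
      map := fun {p q} h => C.trA h
      map_id := fun p => C.trA_id p
      map_comp := fun h h' => C.trA_comp h h' }
  natTrans := 
    { app := fun (p : C.Idx) => prA p.W.toScheme
      naturality := fun p q h => C.trA_pr h }
  equifibered := fun p q h => C.trA_isPullback h

/-- The total space of the line bundle. -/
structure Tot where
  tot : Scheme.{u}
  π : tot ⟶ X
  co : ∀ (i : C.J) {T : Scheme.{u}} (a : T ⟶ tot), Land (a ≫ π) (C.V i) → Γ(T, ⊤)
  co_nat : ∀ (i : C.J) {T T' : Scheme.{u}} (t : T' ⟶ T) (a : T ⟶ tot) (h h'),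
    co i (t ≫ a) h' = t.appTop (co i a h)
  co_hom : ∀ i j {T : Scheme.{u}} (a : T ⟶ tot) (hi hj hij),
    co j a hj = ev (C.g i j) (a ≫ π) hij * co i a hi
  univ : ∀ i {T : Scheme.{u}} (x : T ⟶ X) (hi : Land x (C.V i)) (f : Γ(T, ⊤)),
    ∃! a : T ⟶ tot, ∃ h : a ≫ π = x, co i a (hi.congr h.symm) = f

theorem exists_tot : Nonempty C.Tot := by
  let d := C.rgd
  let ιA : ∀ p : C.Idx, A1 p.W.toScheme ⟶ d.glued := fun p => colimit.ι d.functor p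
  have hιA : ∀ {p q : C.Idx} (h : p ⟶ q), C.trA h ≫ ιA q = ιA p := fun h => colimit.w d.functor h
  have hpb : ∀ p : C.Idx, IsPullback (prA _) (ιA p) p.W.ι d.toBase :=
    fun p => d.isPullback_natTrans_ι_toBase p
  let z : ∀ (p : C.Idx) {T : Scheme.{u}} (a : T ⟶ d.glued) (h : Land (a ≫ d.toBase) p.W),
      T ⟶ A1 p.W.toScheme := fun p T a h => (hpb p).lift (exists_lift _ h).choose a
        (exists_lift _ h).choose_spec
  have hz : ∀ (p : C.Idx) {T : Scheme.{u}} (a : T ⟶ d.glued) (h : Land (a ≫ d.toBase) p.W),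
      z p a h ≫ ιA p = a := fun p T a h => (hpb p).lift_snd _ _ _
  have hιpr : ∀ p, ιA p ≫ d.toBase = prA _ ≫ p.W.ι := fun p => (hpb p).w.symm
  have zu : ∀ (p : C.Idx) {T : Scheme.{u}} (z z' : T ⟶ A1 p.W.toScheme) (h : z ≫ ιA p = z' ≫ ιA p),
      z = z' := by
    intro p T z z' h
    apply (hpb p).hom_ext _ h
    rw [← cancel_mono p.W.ι, Category.assoc, Category.assoc, (hpb p).w, reasc2 h]
  have zc : ∀ (p : C.Idx) {T : Scheme.{u}} {a a' : T ⟶ d.glued} (h h'), a = a' → z p a h = z p a' h' := by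
    rintro p T a _ h h' rfl; rfl
  refine ⟨⟨d.glued, d.toBase, fun i T a h => cA (z ⟨i, C.V i, le_rfl⟩ a h), ?_, ?_, ?_⟩⟩
  · intro i T T' t a h h'
    rw [← cA_comp]
    congr 1
    exact zu _ _ _ ((hz _ _ h').trans (by rw [Category.assoc, hz _ _ h]))
  · intro i j T a hi hj hij
    let p : C.Idx := ⟨i, C.V i, le_rfl⟩
    let q : C.Idx := ⟨j, C.V j, le_rfl⟩
    let r : C.Idx := ⟨i, C.V i ⊓ C.V j, inf_le_left⟩
    have rp : r ≤ p := (inf_le_left : C.V i ⊓ C.V j ≤ C.V i)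
    have rq : r ≤ q := (inf_le_right : C.V i ⊓ C.V j ≤ C.V j)
    have h1 : z p a hi = z r a hij ≫ C.trA (homOfLE rp) := by
      exact zu _ _ _ ((hz _ _ hi).trans (by rw [Category.assoc, hιA, hz _ _ hij]))
    have h2 : z q a hj = z r a hij ≫ C.trA (homOfLE rq) := by
      exact zu _ _ _ ((hz _ _ hj).trans (by rw [Category.assoc, hιA, hz _ _ hij]))
    have e : z r a hij ≫ prA r.W.toScheme ≫ r.W.ι = a ≫ d.toBase := by
      rw [← hιpr, ← Category.assoc, hz r a hij]
    change cA (z q a hj) = _ * cA (z p a hi)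
    rw [h1, h2, C.cA_trA _ _ (hij.congr e.symm), 
      C.cA_trA _ _ ((hij.left.inf hij.left).congr e.symm), C.g_self, one_mul]
    congr 1
    exact ev_congr rfl e _ _
  · intro i T x hi f
    let p : C.Idx := ⟨i, C.V i, le_rfl⟩
    obtain ⟨y, rfl⟩ := exists_lift x hi
    have e : (mkA y f ≫ ιA p) ≫ d.toBase = y ≫ (C.V i).ι := by
      rw [Category.assoc, hιpr, mkA_pr_assoc]
    refine ⟨mkA y f ≫ ιA p, ⟨e, ?_⟩, ?_⟩
    · change cA (z p _ (hi.congr e.symm)) = _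
      rw [show z p (mkA y f ≫ ιA p) (hi.congr e.symm) = mkA y f from zu _ _ _ (hz _ _ (hi.congr e.symm)), cA_mk]
    · rintro a ⟨h1, h2⟩
      rw [← hz p a (hi.congr h1.symm)]
      congr 1
      apply A1_ext
      · rw [← cancel_mono p.W.ι, Category.assoc, ← hιpr, ← Category.assoc, hz p a (hi.congr h1.symm), h1, mkA_pr]
      · rw [cA_mk]; exact h2

end Cocyc

/-! ### Gluing morphisms -/

theorem hom_ext_local {T Y : Scheme.{u}} {a b : T ⟶ Y}
    (h : ∀ z : T, ∃ O : T.Opens, z ∈ O ∧ O.ι ≫ a = O.ι ≫ b) : a = b := by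
  choose O hO h using h
  let 𝒰 := Scheme.openCoverOfIsOpenCover T O (TopologicalSpace.IsOpenCover.mk
    (eq_top_iff.mpr fun z _ => TopologicalSpace.Opens.mem_iSup.mpr ⟨z, hO z⟩))
  exact Scheme.Cover.hom_ext 𝒰 _ _ h

theorem lochom {T Y : Scheme.{u}} (P : ∀ {T' : Scheme.{u}} (t : T' ⟶ T), (T' ⟶ Y) → Prop)
    (nat : ∀ {T' T'' : Scheme.{u}} (s : T'' ⟶ T') (t : T' ⟶ T) (f), P t f → P (s ≫ t) (s ≫ f))
    (uniq : ∀ {T' : Scheme.{u}} (t : T' ⟶ T) (f f'), P t f → P t f' → f = f')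
    (ex : ∀ z : T, ∃ O : T.Opens, z ∈ O ∧ ∃ f, P O.ι f) :
    ∃ b : T ⟶ Y, ∀ z : T, ∃ O : T.Opens, z ∈ O ∧ P O.ι (O.ι ≫ b) := by
  choose O hO f hf using ex
  let 𝒰 := Scheme.openCoverOfIsOpenCover T O (TopologicalSpace.IsOpenCover.mk
    (eq_top_iff.mpr fun z _ => TopologicalSpace.Opens.mem_iSup.mpr ⟨z, hO z⟩))
  refine ⟨Scheme.Cover.glueMorphisms 𝒰 f ?_, fun z => ⟨O z, hO z, ?_⟩⟩
  · intro x y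
    refine uniq (pullback.fst (𝒰.f x) (𝒰.f y) ≫ (O x).ι) _ _ (nat _ _ _ (hf x)) ?_
    have e : pullback.fst (𝒰.f x) (𝒰.f y) ≫ (O x).ι = pullback.snd (𝒰.f x) (𝒰.f y) ≫ (O y).ι :=
      pullback.condition
    rw [e]
    exact nat _ _ _ (hf y)
  · have := Scheme.Cover.ι_glueMorphisms 𝒰 f (by
      intro x y
      refine uniq (pullback.fst (𝒰.f x) (𝒰.f y) ≫ (O x).ι) _ _ (nat _ _ _ (hf x)) ?_
      have e : pullback.fst (𝒰.f x) (𝒰.f y) ≫ (O x).ι = pullback.snd (𝒰.f x) (𝒰.f y) ≫ (O y).ι :=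
        pullback.condition
      rw [e]
      exact nat _ _ _ (hf y)) z
    exact this.symm ▸ hf z

namespace Cocyc.Tot
variable {X : Scheme.{u}} {C : Cocyc X} (E : C.Tot)
open Classical in
/-- Total version of the coordinate. -/
def cc (i : C.J) {T : Scheme.{u}} (a : T ⟶ E.tot) : Γ(T, ⊤) :=
  if h : Land (a ≫ E.π) (C.V i) then E.co i a h else 0

variable {T T' : Scheme.{u}}

theorem cc_eq (i : C.J) (a : T ⟶ E.tot) (h : Land (a ≫ E.π) (C.V i)) : E.cc i a = E.co i a h :=
  dif_pos h

theorem cc_neg (i : C.J) (a : T ⟶ E.tot) (h : ¬ Land (a ≫ E.π) (C.V i)) : E.cc i a = 0 :=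
  dif_neg h

theorem cc_nat (i : C.J) (t : T' ⟶ T) (a : T ⟶ E.tot) (h : Land (a ≫ E.π) (C.V i)) :
    E.cc i (t ≫ a) = t.appTop (E.cc i a) := by
  have h' : Land ((t ≫ a) ≫ E.π) (C.V i) := (h.comp t).congr (Category.assoc _ _ _).symm
  rw [E.cc_eq i a h, E.cc_eq i _ h', E.co_nat]

theorem cc_hom (i j : C.J) (a : T ⟶ E.tot) (h : Land (a ≫ E.π) (C.V i ⊓ C.V j)) :
    E.cc j a = ev (C.g i j) (a ≫ E.π) h * E.cc i a := by
  rw [E.cc_eq i a h.left, E.cc_eq j _ h.right, E.co_hom i j a h.left h.right h]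

theorem exu (i : C.J) (x : T ⟶ X) (hi : Land x (C.V i)) (f : Γ(T, ⊤)) :
    ∃ a : T ⟶ E.tot, a ≫ E.π = x ∧ E.cc i a = f := by
  obtain ⟨a, ⟨h, h'⟩, -⟩ := E.univ i x hi f
  exact ⟨a, h, by rw [E.cc_eq i a (hi.congr h.symm), h']⟩

theorem ext1 (i : C.J) {a b : T ⟶ E.tot} (h : a ≫ E.π = b ≫ E.π) (hi : Land (a ≫ E.π) (C.V i))
    (h' : E.cc i a = E.cc i b) : a = b := by
  obtain ⟨c, -, hc⟩ := E.univ i (a ≫ E.π) hi (E.cc i a)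
  rw [hc a ⟨rfl, (E.cc_eq _ _ _).symm⟩, hc b ⟨h.symm, by rw [h', E.cc_eq]⟩]

theorem covT (x : T ⟶ X) (z : T) : ∃ (i : C.J) (O : T.Opens), z ∈ O ∧ Land (O.ι ≫ x) (C.V i) := by
  obtain ⟨i, hi⟩ := C.cov (x z)
  exact ⟨i, x ⁻¹ᵁ C.V i, hi, Land.iff.mpr fun s => s.2⟩

theorem ext {a b : T ⟶ E.tot} (h : a ≫ E.π = b ≫ E.π)
    (h' : ∀ i {T' : Scheme.{u}} (t : T' ⟶ T), Land (t ≫ a ≫ E.π) (C.V i) → 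
      E.cc i (t ≫ a) = E.cc i (t ≫ b)) : a = b := by
  apply hom_ext_local
  intro z
  obtain ⟨i, O, hz, hl⟩ := covT (C := C) (a ≫ E.π) z
  refine ⟨O, hz, E.ext1 i (by simp [h]) (by simpa using hl) (h' i _ hl)⟩

theorem exists_pt (x : T ⟶ X) (φ : ∀ (i : C.J) {T' : Scheme.{u}} (t : T' ⟶ T), Γ(T', ⊤))
    (nat : ∀ i {T' T'' : Scheme.{u}} (s : T'' ⟶ T') (t : T' ⟶ T), Land (t ≫ x) (C.V i) →
      φ i (s ≫ t) = s.appTop (φ i t))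
    (hom : ∀ i j {T' : Scheme.{u}} (t : T' ⟶ T) (h : Land (t ≫ x) (C.V i ⊓ C.V j)),
      φ j t = ev (C.g i j) (t ≫ x) h * φ i t) :
    ∃ a : T ⟶ E.tot, a ≫ E.π = x ∧ ∀ i {T' : Scheme.{u}} (t : T' ⟶ T),
      Land (t ≫ x) (C.V i) → E.cc i (t ≫ a) = φ i t := by
  refine Exists.elim (lochom (T := T) (Y := E.tot) (fun {T'} t a => a ≫ E.π = t ≫ x ∧
    ∀ i {T'' : Scheme.{u}} (s : T'' ⟶ T'), Land (s ≫ t ≫ x) (C.V i) →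
      E.cc i (s ≫ a) = φ i (s ≫ t)) ?_ ?_ ?_) fun b hb => ?_
  rotate_left 3
  · have hbx : b ≫ E.π = x := by
      apply hom_ext_local
      intro z
      obtain ⟨O, hz, h1, h2⟩ := hb z
      exact ⟨O, hz, by simpa using h1⟩
    refine ⟨b, hbx, fun i T' t hl => ?_⟩
    apply fun_ext_local
    intro z
    obtain ⟨O, hz, h1, h2⟩ := hb (t z)
    refine ⟨t ⁻¹ᵁ O, hz, ?_⟩
    have h3 := h2 i (t ∣_ O) ((hl.comp (t ⁻¹ᵁ O).ι).congr (by 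
      rw [← Category.assoc, ← Category.assoc, morphismRestrict_ι]))
    rw [← Category.assoc, morphismRestrict_ι, Category.assoc, 
      E.cc_nat _ _ _ (by simpa [hbx] using hl), nat _ _ _ hl] at h3
    exact h3
  · rintro T' T'' s t f ⟨h1, h2⟩
    refine ⟨by simp [h1], fun i T3 r hl => ?_⟩
    rw [← Category.assoc, h2, Category.assoc]
    simpa using hl
  · rintro T' t f f' ⟨h1, h2⟩ ⟨h3, h4⟩
    apply E.ext (h1.trans h3.symm)
    intro i T'' s hl
    rw [h1] at hl
    rw [h2 i s hl, h4 i s hl]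
  · intro z
    obtain ⟨i, O, hz, hl⟩ := covT (C := C) x z
    obtain ⟨a, h1, h2⟩ := E.exu i (O.ι ≫ x) hl (φ i O.ι)
    refine ⟨O, hz, a, h1, fun j T'' s hj => ?_⟩
    have hl2 : Land ((s ≫ a) ≫ E.π) (C.V i ⊓ C.V j) :=
      ((hl.comp s).inf hj).congr (by simp [h1])
    have hl1 : Land ((s ≫ O.ι) ≫ x) (C.V i ⊓ C.V j) :=
      ((hl.comp s).inf hj).congr (by simp)
    rw [E.cc_hom i j _ hl2, E.cc_nat _ _ _ (hl.congr h1.symm), h2, hom i j _ hl1, nat i _ _ hl]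
    congr 1
    exact ev_congr rfl (by simp [h1]) _ _

/-! operations -/
theorem exists_add (a b : T ⟶ E.tot) (h : a ≫ E.π = b ≫ E.π) :
    ∃ c : T ⟶ E.tot, c ≫ E.π = a ≫ E.π ∧ ∀ i {T' : Scheme.{u}} (t : T' ⟶ T),
      E.cc i (t ≫ c) = E.cc i (t ≫ a) + E.cc i (t ≫ b) := by
  refine Exists.elim (E.exists_pt (a ≫ E.π) (fun i T' t => E.cc i (t ≫ a) + E.cc i (t ≫ b)) ?_ ?_) fun c hc => ?_
  rotate_left 2
  · obtain ⟨h1, h2⟩ := hc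
    refine ⟨c, h1, fun i T' t => ?_⟩
    by_cases hl : Land (t ≫ a ≫ E.π) (C.V i)
    · exact h2 i t hl
    · rw [E.cc_neg, E.cc_neg, E.cc_neg, add_zero]
      · simpa [← h] using hl
      · simpa using hl
      · simpa [h1] using hl
  · intro i T' T'' s t hl
    rw [map_add, Category.assoc, Category.assoc, E.cc_nat i s (t ≫ a), E.cc_nat i s (t ≫ b)]
    · simpa [← h] using hl
    · simpa using hl
  · intro i j T' t hl
    rw [E.cc_hom i j (t ≫ a) (hl.congr (Category.assoc _ _ _).symm), 
      E.cc_hom i j (t ≫ b) (hl.congr (by simp [h])), mul_add]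
    congr 2
    · exact ev_congr rfl (by simp [h]) _ _

theorem exists_smul (f : Γ(T, ⊤)) (a : T ⟶ E.tot) :
    ∃ c : T ⟶ E.tot, c ≫ E.π = a ≫ E.π ∧ ∀ i {T' : Scheme.{u}} (t : T' ⟶ T),
      E.cc i (t ≫ c) = t.appTop f * E.cc i (t ≫ a) := by
  refine Exists.elim (E.exists_pt (a ≫ E.π) (fun i T' t => t.appTop f * E.cc i (t ≫ a)) ?_ ?_) fun c hc => ?_
  rotate_left 2
  · obtain ⟨h1, h2⟩ := hc
    refine ⟨c, h1, fun i T' t => ?_⟩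
    by_cases hl : Land (t ≫ a ≫ E.π) (C.V i)
    · exact h2 i t hl
    · rw [E.cc_neg, E.cc_neg, mul_zero]
      · simpa using hl
      · simpa [h1] using hl
  · intro i T' T'' s t hl
    rw [map_mul, Category.assoc, appTop_comp, E.cc_nat i s (t ≫ a)]
    simpa using hl
  · intro i j T' t hl
    rw [E.cc_hom i j (t ≫ a) (hl.congr (Category.assoc _ _ _).symm), mul_left_comm]
    congr 1

theorem exists_sec {m : ℕ} (σ : ∀ i, Γ(X, C.V i)) (hσ : ∀ i j {T : Scheme.{u}} (x : T ⟶ X)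
    (hi : Land x (C.V i)) (hj : Land x (C.V j))
    (hij : Land x (C.V i ⊓ C.V j)), ev (σ j) x hj = ev (C.g i j) x hij * ev (σ i) x hi) :
    ∃ c : X ⟶ E.tot, c ≫ E.π = 𝟙 X ∧ ∀ i {T' : Scheme.{u}} (t : T' ⟶ X) (h : Land t (C.V i)),
      E.cc i (t ≫ c) = ev (σ i) t h := by
  classical
  have e : ∀ {T' : Scheme.{u}} (t : T' ⟶ X) (i), Land (t ≫ 𝟙 X) (C.V i) → Land t (C.V i) := by
    intro T' t i h; simpa using h
  refine Exists.elim (E.exists_pt (𝟙 X)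
    (fun i T' t => if h : Land t (C.V i) then ev (σ i) t h else 0) ?_ ?_) fun c hc => ?_
  rotate_left 2
  · obtain ⟨h1, h2⟩ := hc
    refine ⟨c, h1, fun i T' t hl => ?_⟩
    rw [h2 i t (by simpa using hl), dif_pos hl]
  · intro i T' T'' s t hl
    have hl := e _ _ hl
    rw [dif_pos hl, dif_pos (hl.comp s), ev_comp]
  · intro i j T' t hl
    have hi := e _ _ hl.left
    have hj := e _ _ hl.right
    rw [dif_pos hi, dif_pos hj, hσ i j t hi hj (hi.inf hj)]
    congr 1

/-- zero -/
def zero : X ⟶ E.tot := (E.exists_sec (m := 0) (fun i => 0) (by simp)).choose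
theorem zero_π : E.zero ≫ E.π = 𝟙 X := (E.exists_sec (m := 0) (fun i => 0) (by simp)).choose_spec.1
theorem cc_zero (i : C.J) (t : T ⟶ X) : E.cc i (t ≫ E.zero) = 0 := by
  by_cases hl : Land t (C.V i)
  · exact ((E.exists_sec (m := 0) (fun i => 0) (by simp)).choose_spec.2 i t hl).trans (ev_zero _ _)
  · rw [E.cc_neg]
    simpa [E.zero_π] using hl
/-- add -/
def add (a b : T ⟶ E.tot) (h : a ≫ E.π = b ≫ E.π) : T ⟶ E.tot := (E.exists_add a b h).choose
theorem add_π (a b : T ⟶ E.tot) (h : a ≫ E.π = b ≫ E.π) : E.add a b h ≫ E.π = a ≫ E.π :=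
  (E.exists_add a b h).choose_spec.1
theorem cc_add (a b : T ⟶ E.tot) (h : a ≫ E.π = b ≫ E.π) (i : C.J) (t : T' ⟶ T) :
  E.cc i (t ≫ E.add a b h) = E.cc i (t ≫ a) + E.cc i (t ≫ b) :=
  (E.exists_add a b h).choose_spec.2 i t
/-- smul -/
def smul (f : Γ(T, ⊤)) (a : T ⟶ E.tot) : T ⟶ E.tot := (E.exists_smul f a).choose
theorem smul_π (f : Γ(T, ⊤)) (a : T ⟶ E.tot) : E.smul f a ≫ E.π = a ≫ E.π :=
  (E.exists_smul f a).choose_spec.1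
theorem cc_smul (f : Γ(T, ⊤)) (a : T ⟶ E.tot) (i : C.J) (t : T' ⟶ T) :
  E.cc i (t ≫ E.smul f a) = t.appTop f * E.cc i (t ≫ a) :=
  (E.exists_smul f a).choose_spec.2 i t

/-- the bundle data -/
abbrev vbd : VecBundleData X where
  tot := E.tot
  π := E.π
  zero := E.zero
  zero_π := E.zero_π
  add a b h := E.add a b h
  smul f a := E.smul f a
  add_π a b h := E.add_π a b h
  smul_π f a := E.smul_π f a
  add_natural g a b h h' := by
    apply E.ext
    · simp [E.add_π]
    · intro i T' t hl
      rw [E.cc_add, ← Category.assoc, E.cc_add]; simp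
  smul_natural g f a := by
    apply E.ext
    · simp [E.smul_π]
    · intro i T' t hl
      rw [E.cc_smul, ← Category.assoc, E.cc_smul, appTop_comp]; simp
  add_comm a b h h' := by
    apply E.ext
    · simp [E.add_π, h]
    · intro i T' t hl
      rw [E.cc_add, E.cc_add, add_comm]
  add_assoc a b c h₁ h₂ h₃ h₄ := by
    apply E.ext
    · simp [E.add_π]
    · intro i T' t hl
      rw [E.cc_add, E.cc_add, E.cc_add, E.cc_add, add_assoc]
  zero_add a h := by
    apply E.ext
    · simp [E.add_π, E.zero_π]
    · intro i T' t hl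
      rw [E.cc_add, ← Category.assoc, E.cc_zero, zero_add]
  one_smul a := by
    apply E.ext
    · simp [E.smul_π]
    · intro i T' t hl
      rw [E.cc_smul, map_one, one_mul]
  mul_smul f g a := by
    apply E.ext
    · simp [E.smul_π]
    · intro i T' t hl
      rw [E.cc_smul, E.cc_smul, E.cc_smul, map_mul, mul_assoc]
  smul_add f a b h h' := by
    apply E.ext
    · simp [E.smul_π, E.add_π]
    · intro i T' t hl
      rw [E.cc_smul, E.cc_add, E.cc_add, E.cc_smul, E.cc_smul, mul_add]
  add_smul f g a h := by
    apply E.ext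
    · simp [E.smul_π, E.add_π]
    · intro i T' t hl
      rw [E.cc_smul, E.cc_add, E.cc_smul, E.cc_smul, map_add, add_mul]
  zero_smul a := by
    apply E.ext
    · simp [E.smul_π, E.zero_π]
    · intro i T' t hl
      rw [E.cc_smul, ← Category.assoc, E.cc_zero, map_zero, zero_mul]
  smul_zero f x := by
    apply E.ext
    · simp [E.smul_π, E.zero_π]
    · intro i T' t hl
      rw [E.cc_smul, ← Category.assoc, E.cc_zero, mul_zero]

/-- frame -/
def e (i : C.J) : (C.V i).toScheme ⟶ E.tot := (E.exu i (C.V i).ι (Land.ι _) 1).choose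
theorem e_π (i : C.J) : E.e i ≫ E.π = (C.V i).ι := (E.exu i (C.V i).ι (Land.ι _) 1).choose_spec.1
theorem cc_e (i : C.J) : E.cc i (E.e i) = 1 := (E.exu i (C.V i).ι (Land.ι _) 1).choose_spec.2

theorem secAt_e_π (i : C.J) (x : T ⟶ X) (h : Land x (C.V i)) : secAt (E.e i) x h ≫ E.π = x := by
  obtain ⟨y, rfl⟩ := exists_lift x h
  rw [secAt_lift, Category.assoc, E.e_π]

theorem cc_secAt_e (i : C.J) (x : T ⟶ X) (h : Land x (C.V i)) : E.cc i (secAt (E.e i) x h) = 1 := by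
  obtain ⟨y, rfl⟩ := exists_lift x h
  rw [secAt_lift, E.cc_nat i _ _ ((Land.ι _).congr (E.e_π i).symm), E.cc_e, map_one]

theorem cc_smul' (i : C.J) (f : Γ(T, ⊤)) (a : T ⟶ E.tot) : E.cc i (E.smul f a) = f * E.cc i a := by
  have := E.cc_smul f a i (𝟙 T)
  simpa using this

theorem fr1_e (i : C.J) : E.vbd.Fr1 (C.V i) (E.e i) := by
  refine ⟨E.e_π i, fun {T} x h a ha => ⟨E.cc i a, ?_, ?_⟩⟩
  · change a ≫ E.π = x at ha
    change a = E.smul _ _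
    apply E.ext1 i
    · rw [E.smul_π, E.secAt_e_π, ha]
    · rwa [ha]
    · rw [E.cc_smul', E.cc_secAt_e, mul_one]
  · intro f hf
    change a = E.smul _ _ at hf
    rw [hf, E.cc_smul', E.cc_secAt_e, mul_one]

/-- The line bundle. -/
abbrev lb : LineBundle X where
  toVecBundleData := E.vbd
  locTriv x := by
    obtain ⟨i, hi⟩ := C.cov x
    exact ⟨C.V i, fun _ => E.e i, hi, (E.vbd.fr1_iff _).mpr (E.fr1_e i)⟩

end Cocyc.Tot

/-! ### Tensor powers of the bundle of a cocycle -/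
namespace Cocyc.Tot
section
variable {X : Scheme.{u}} {C : Cocyc X} (E : C.Tot) {T T' : Scheme.{u}}

theorem fr1_unit {U : X.Opens} {ℓ : U.toScheme ⟶ E.tot} (hℓ : E.vbd.Fr1 U ℓ) (i : C.J) (x : T ⟶ X)
    (h : Land x U) (hi : Land x (C.V i)) : IsUnit (E.cc i (secAt ℓ x h)) := by
  obtain ⟨f, hf, -⟩ := hℓ.2 x h (secAt (E.e i) x hi) (E.secAt_e_π _ _ _)
  have := E.cc_secAt_e i x hi
  have hf : secAt (E.e i) x hi = E.smul f (secAt ℓ x h) := hf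
  rw [hf, E.cc_smul'] at this
  exact IsUnit.of_mul_eq_one_right f this

theorem fr1_of_unit {U : X.Opens} {ℓ : U.toScheme ⟶ E.tot} (hℓ : ℓ ≫ E.π = U.ι)
    (hu : ∀ (i : C.J) {T : Scheme.{u}} (x : T ⟶ X)
      (h : Land x U) (hi : Land x (C.V i)), IsUnit (E.cc i (secAt ℓ x h))) : E.vbd.Fr1 U ℓ := by
  refine ⟨hℓ, fun {T} x h a ha => ?_⟩
  have hπ : ∀ {T : Scheme.{u}} (x : T ⟶ X) (h : Land x U), secAt ℓ x h ≫ E.π = x := by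
    intro T x h
    obtain ⟨y, rfl⟩ := exists_lift x h
    rw [secAt_lift, Category.assoc, hℓ]
  change a ≫ E.π = x at ha
  have uniq : ∀ {T' : Scheme.{u}} (t : T' ⟶ T) (f f' : Γ(T', ⊤)),
      t ≫ a = E.smul f (t ≫ secAt ℓ x h) → t ≫ a = E.smul f' (t ≫ secAt ℓ x h) → f = f' := by
    intro T' t f f' h1 h2
    apply fun_ext_local
    intro z
    obtain ⟨i, O, hz, hl⟩ := covT (C := C) (t ≫ x) z
    refine ⟨O, hz, ?_⟩
    have h3 := congrArg (fun b => E.cc i (O.ι ≫ b)) (h1.symm.trans h2)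
    have hl' : Land ((O.ι ≫ t) ≫ x) (C.V i) := hl.congr (Category.assoc _ _ _).symm
    rw [E.cc_smul, E.cc_smul, ← Category.assoc, secAt_comp _ _ _ _ (h.comp _)] at h3
    exact (hu i _ (h.comp _) hl').mul_right_cancel h3
  refine Exists.elim (locfun (T := T) (fun {T'} t f => t ≫ a = E.smul f (t ≫ secAt ℓ x h)) ?_ 
    (fun t f f' h1 h2 => uniq t f f' h1 h2) ?_) fun f hf => ?_
  · intro T' T'' s t f hf
    rw [Category.assoc, hf]
    exact (E.vbd.smul_natural _ _ _).trans (by rw [Category.assoc])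
  · intro z
    obtain ⟨i, O, hz, hl⟩ := covT (C := C) x z
    obtain ⟨v, hv⟩ := (hu i (O.ι ≫ x) (h.comp _) hl).exists_left_inv
    refine ⟨O, hz, E.cc i (O.ι ≫ a) * v, ?_⟩
    apply E.ext1 i
    · rw [E.smul_π]; simp [hπ, ha]
    · exact hl.congr (by simp [ha])
    · rw [E.cc_smul', secAt_comp _ _ _ _ (h.comp _), mul_assoc, hv, mul_one]
  · have key : a = E.smul f (secAt ℓ x h) := by
      apply hom_ext_local
      intro z
      obtain ⟨i, O, hz, hl⟩ := covT (C := C) x z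
      obtain ⟨v, hv⟩ := (hu i (O.ι ≫ x) (h.comp _) hl).exists_left_inv
      refine ⟨O, hz, ?_⟩
      have h1 : O.ι ≫ a = E.smul (E.cc i (O.ι ≫ a) * v) (O.ι ≫ secAt ℓ x h) := by
        apply E.ext1 i
        · rw [E.smul_π]; simp [hπ, ha]
        · exact hl.congr (by simp [ha])
        · rw [E.cc_smul', secAt_comp _ _ _ _ (h.comp _), mul_assoc, hv, mul_one]
      refine Eq.trans ?_ (E.vbd.smul_natural _ _ _).symm
      rw [hf _ _ h1]; exact h1
    refine ⟨f, key, fun f' hf' => ?_⟩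
    refine uniq (𝟙 T) _ _ ?_ ?_
    · rw [Category.id_comp, Category.id_comp]; exact hf'
    · rw [Category.id_comp, Category.id_comp]; exact key

end
end Cocyc.Tot

namespace Cocyc
variable {X : Scheme.{u}} (C : Cocyc X)

/-- Powers of a cocycle. -/
abbrev powC (m : ℕ) : Cocyc X where
  J := C.J
  fin := C.fin
  V := C.V
  cov := C.cov
  g i j := C.g i j ^ m
  g_self i T x h := by rw [ev_pow, C.g_self, one_pow]
  g_mul i j l T x h h' h'' := by rw [ev_pow, ev_pow, ev_pow, ← mul_pow, C.g_mul]

/-- Total space of the power. -/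
def tp (m : ℕ) : (C.powC m).Tot := (C.powC m).exists_tot.some

theorem exists_β (m : ℕ) {T : Scheme.{u}} (a : T ⟶ (C.tp m).tot) (b : T ⟶ (C.tp 1).tot)
    (h : a ≫ (C.tp m).π = b ≫ (C.tp 1).π) : 
    ∃ c : T ⟶ (C.tp (m + 1)).tot, c ≫ (C.tp (m + 1)).π = a ≫ (C.tp m).π ∧
      ∀ (i : C.J) {T' : Scheme.{u}} (t : T' ⟶ T),
      (C.tp (m + 1)).cc i (t ≫ c) = (C.tp m).cc i (t ≫ a) * (C.tp 1).cc i (t ≫ b) := by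
  refine Exists.elim ((C.tp (m + 1)).exists_pt (a ≫ (C.tp m).π)
    (fun i T' t => (C.tp m).cc i (t ≫ a) * (C.tp 1).cc i (t ≫ b)) ?_ ?_) fun c hc => ?_
  · intro i T' T'' s t hl
    rw [map_mul, Category.assoc, Category.assoc, (C.tp m).cc_nat i s (t ≫ a),
      (C.tp 1).cc_nat i s (t ≫ b)]
    · simpa [← h] using hl
    · simpa using hl
  · intro i j T' t hl
    rw [(C.tp m).cc_hom i j (t ≫ a) (hl.congr (Category.assoc _ _ _).symm), 
      (C.tp 1).cc_hom i j (t ≫ b) (hl.congr (by simp [h])), ev_pow, ev_pow, ev_pow, pow_one, pow_succ,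
      mul_mul_mul_comm]
    congr 2
    exact ev_congr rfl (by simp [h]) _ _
  · obtain ⟨h1, h2⟩ := hc
    refine ⟨c, h1, fun i T' t => ?_⟩
    by_cases hl : Land (t ≫ a ≫ (C.tp m).π) (C.V i)
    · exact h2 i t hl
    · rw [(C.tp (m + 1)).cc_neg, (C.tp m).cc_neg, zero_mul]
      · simpa using hl
      · simpa [h1] using hl

/-- The pairing. -/
def β (m : ℕ) {T : Scheme.{u}} (a : T ⟶ (C.tp m).tot) (b : T ⟶ (C.tp 1).tot)
    (h : a ≫ (C.tp m).π = b ≫ (C.tp 1).π) : T ⟶ (C.tp (m + 1)).tot := (C.exists_β m a b h).choose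
theorem β_π (m : ℕ) {T : Scheme.{u}} (a : T ⟶ (C.tp m).tot) (b : T ⟶ (C.tp 1).tot)
    (h : a ≫ (C.tp m).π = b ≫ (C.tp 1).π) : C.β m a b h ≫ (C.tp (m + 1)).π = a ≫ (C.tp m).π :=
  (C.exists_β m a b h).choose_spec.1
theorem cc_β (m : ℕ) {T : Scheme.{u}} (a : T ⟶ (C.tp m).tot) (b : T ⟶ (C.tp 1).tot)
    (h : a ≫ (C.tp m).π = b ≫ (C.tp 1).π) (i : C.J) {T' : Scheme.{u}} (t : T' ⟶ T) :
    (C.tp (m + 1)).cc i (t ≫ C.β m a b h) = (C.tp m).cc i (t ≫ a) * (C.tp 1).cc i (t ≫ b) :=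
  (C.exists_β m a b h).choose_spec.2 i t

theorem isTensor (m : ℕ) : IsTensor (C.tp m).lb (C.tp 1).lb (C.tp (m + 1)).lb := by
  refine ⟨fun {T} a b h => C.β m a b h, fun a b h => C.β_π m a b h, ?_, ?_, ?_, ?_, ?_, ?_⟩
  · intro T' T g a b h h'
    apply (C.tp (m + 1)).ext
    · rw [Category.assoc, β_π, β_π, Category.assoc]
    · intro i T'' t hl
      rw [cc_β, ← Category.assoc, cc_β, Category.assoc, Category.assoc]
  · intro T a a' b h₁ h₂ h₃ h₄ h₅
    apply (C.tp (m + 1)).ext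
    · exact (C.β_π _ _ _ h₂).trans (((C.tp m).add_π _ _ h₁).trans 
        (((C.tp (m + 1)).add_π _ _ h₅).trans (C.β_π _ _ _ h₃)).symm)
    · intro i T'' t hl
      rw [cc_β, Tot.cc_add, Tot.cc_add, cc_β, cc_β, add_mul]
  · intro T a b b' h₁ h₂ h₃ h₄ h₅
    apply (C.tp (m + 1)).ext
    · exact (C.β_π _ _ _ h₂).trans 
        (((C.tp (m + 1)).add_π _ _ h₅).trans (C.β_π _ _ _ h₃)).symm
    · intro i T'' t hl
      rw [cc_β, Tot.cc_add, Tot.cc_add, cc_β, cc_β, mul_add]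
  · intro T f a b h₁ h₂
    apply (C.tp (m + 1)).ext
    · exact (C.β_π _ _ _ _).trans (((C.tp m).smul_π _ _).trans 
        (((C.tp (m + 1)).smul_π _ _).trans (C.β_π _ _ _ _)).symm)
    · intro i T'' t hl
      rw [cc_β, Tot.cc_smul, Tot.cc_smul, cc_β, mul_assoc]
  · intro T f a b h₁ h₂
    apply (C.tp (m + 1)).ext
    · exact (C.β_π _ _ _ _).trans
        (((C.tp (m + 1)).smul_π _ _).trans (C.β_π _ _ _ _)).symm
    · intro i T'' t hl
      rw [cc_β, Tot.cc_smul, Tot.cc_smul, cc_β, mul_left_comm]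
  · intro U sL sM hL hM h
    have hL := (VecBundleData.fr1_iff _ _).mp hL
    have hM := (VecBundleData.fr1_iff _ _).mp hM
    refine (VecBundleData.fr1_iff _ _).mpr ((C.tp (m + 1)).fr1_of_unit ?_ ?_)
    · exact (C.β_π _ _ _ _).trans hL.1
    · intro i T x h hi
      have h1 := (C.tp m).fr1_unit hL i x h hi
      have h2 := (C.tp 1).fr1_unit hM i x h hi
      obtain ⟨y, rfl⟩ := exists_lift x h
      rw [secAt_lift, cc_β]
      rw [secAt_lift] at h1 h2
      exact h1.mul h2

theorem isTrivial : IsTrivialBundle (C.tp 0).lb := by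
  obtain ⟨s, h1, h2⟩ := (C.tp 0).exists_sec (m := 0) (fun i => 1) (by
    intro i j T x hi hj hij; simp)
  have hone : ∀ {T : Scheme.{u}} (x : T ⟶ X) (i : C.J), Land x (C.V i) → (C.tp 0).cc i (x ≫ s) = 1 := by
    intro T x i h
    rw [h2 i x h, ev_one]
  have hfr : (C.tp 0).vbd.Fr1 ⊤ ((⊤ : X.Opens).ι ≫ s) := by
    apply (C.tp 0).fr1_of_unit
    · rw [Category.assoc, h1, Category.comp_id]
    · intro i T x h hi
      obtain ⟨y, rfl⟩ := exists_lift x h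
      rw [secAt_lift, ← Category.assoc, hone _ _ hi]
      exact isUnit_one
  obtain ⟨hs, H⟩ := (VecBundleData.fr1_iff (C.tp 0).vbd (fun _ => (⊤ : X.Opens).ι ≫ s)).mpr hfr
  refine ⟨fun _ => s, fun _ => h1, fun {T} x => ?_⟩
  obtain ⟨y, rfl⟩ := exists_lift (U := ⊤) x (fun _ _ => trivial)
  have := H y
  simp only [Category.assoc] 
  exact this

theorem isTensorPow (m : ℕ) : IsTensorPow (C.tp 1).lb m (C.tp m).lb := by
  induction m with
  | zero => exact C.isTrivial
  | succ m ih => exact ⟨_, ih, C.isTensor m⟩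

theorem Ample.lb {C : Cocyc X} (h : C.Ample) : IsAmple (C.tp 1).lb := by
  obtain ⟨h1, h2, h3⟩ := h
  refine ⟨h1, h2, fun x => ?_⟩
  obtain ⟨m, hm, s, U, hU, hx, hs⟩ := h3 x
  obtain ⟨c, hc, hc'⟩ := (C.tp m).exists_sec (m := m) s.σ (by
    intro i j T x hi hj hij
    rw [s.hom i j x hi hj hij, ev_pow])
  refine ⟨m, hm, (C.tp m).lb, C.isTensorPow m, c, hc, U, hU, hx, ?_⟩
  ext y
  obtain ⟨i, hi⟩ := C.cov y
  have key := VecBundleData.mem_basicOpen_iff_ne ((C.tp m).fr1_e i) c hc (s.σ i) (by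
    intro T x h h'
    symm
    apply ((C.tp m).fr1_e i).coord_uniq x h
    change _ = (C.tp m).smul _ _
    apply (C.tp m).ext1 i
    · rw [(C.tp m).smul_π, (C.tp m).secAt_e_π, Category.assoc, hc, Category.comp_id]
    · exact h.congr (by rw [Category.assoc, hc, Category.comp_id])
    · rw [(C.tp m).cc_smul', (C.tp m).cc_secAt_e, hc' i x h, mul_one]) y hi
  refine Iff.trans ?_ key
  rw [← hs i]
  exact ⟨fun h => ⟨hi, h⟩, fun h => h.2⟩

end Cocyc

/-! ### Linearization of the bundle of a cocycle -/
section lin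
variable {G : GroupSchemeOver k} {X : SchemeOver k} {α : ActionOver G X} {C : Cocyc X.carrier}

theorem Lin.left (l : Lin α C) (i j m : C.J) {T : Scheme.{u}} (g : T ⟶ G.carrier)
    (x : T ⟶ X.carrier) (h hi hj hm hij) :
    l.u i m g x h hi hm = ev (C.g i j) x hij * l.u j m g x h hj hm := by
  have e1 : g ≫ G.str = (x ≫ X.str ≫ G.one) ≫ G.str := by simp [G.one_str, h]
  have e2 : (x ≫ X.str ≫ G.one) ≫ G.str = x ≫ X.str := by simp [G.one_str]
  have e3 : α.act (x ≫ X.str ≫ G.one) x e2 = x := α.one_act x e2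
  have e4 : g ≫ G.str = α.act (x ≫ X.str ≫ G.one) x e2 ≫ X.str := by rw [e3, h]
  have e5 : G.mul g (x ≫ X.str ≫ G.one) e1 = g := by
    refine (G.mul_congr rfl ?_ _ ?_).trans (G.mul_one g ?_)
    · rw [← Category.assoc, ← h, Category.assoc]
    · simp [G.one_str]
    · simp [G.one_str]
  have e6 : (G.mul g (x ≫ X.str ≫ G.one) e1) ≫ G.str = x ≫ X.str := by rw [e5, h]
  have e7 : α.act g x h = α.act (G.mul g (x ≫ X.str ≫ G.one) e1) x e6 := α.act_congr e5.symm rfl _ _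
  have e8 : α.act g x h = α.act g (α.act (x ≫ X.str ≫ G.one) x e2) e4 := α.act_congr rfl e3.symm _ _
  have := l.u_mul i j m g (x ≫ X.str ≫ G.one) x e1 e6 e2 e4 hi (hj.congr e3.symm) (hm.congr e7)
    (hm.congr e8)
  rw [l.u_one i j x e2 hi (hj.congr e3.symm) hij] at this
  refine (l.u_congr i m e5.symm rfl _ _ _ _ _ _).trans (this.trans ?_)
  congr 1
  exact l.u_congr _ _ rfl e3 _ _ _ _ _ _

theorem Lin.right (l : Lin α C) (i j m : C.J) {T : Scheme.{u}} (g : T ⟶ G.carrier)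
    (x : T ⟶ X.carrier) (h hi hj hm hjm) :
    l.u i m g x h hi hm = ev (C.g j m) (α.act g x h) hjm * l.u i j g x h hi hj := by
  let y := α.act g x h
  have hy : y ≫ X.str = x ≫ X.str := α.act_str _ _ _
  have e1 : (y ≫ X.str ≫ G.one) ≫ G.str = g ≫ G.str := by simp [G.one_str, h, hy]
  have e2 : (y ≫ X.str ≫ G.one) ≫ G.str = y ≫ X.str := by simp [G.one_str]
  have e3 : α.act (y ≫ X.str ≫ G.one) y e2 = y := α.one_act y e2
  have e5 : G.mul (y ≫ X.str ≫ G.one) g e1 = g := by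
    have : y ≫ X.str ≫ G.one = g ≫ G.str ≫ G.one := by
      rw [← Category.assoc, hy, ← h, Category.assoc]
    exact (G.mul_congr this rfl _ (by simp [G.one_str])).trans (G.one_mul g _)
  have e6 : (G.mul (y ≫ X.str ≫ G.one) g e1) ≫ G.str = x ≫ X.str := by rw [e5, h]
  have e7 : α.act g x h = α.act (G.mul (y ≫ X.str ≫ G.one) g e1) x e6 := α.act_congr e5.symm rfl _ _
  have := l.u_mul i j m (y ≫ X.str ≫ G.one) g x e1 e6 h e2 hi hj (hm.congr e7)
    (hm.congr e3.symm)
  rw [l.u_one j m y e2 hj (hm.congr e3.symm) hjm] at this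
  rw [mul_comm]
  exact (l.u_congr i m e5.symm rfl _ _ _ _ _ _).trans this

/-- cond on lact -/
def LactP (l : Lin α C) {T : Scheme.{u}} (g : T ⟶ G.carrier) (a b : T ⟶ (C.tp 1).tot) : Prop :=
  ∃ h : g ≫ G.str = (a ≫ (C.tp 1).π) ≫ X.str, b ≫ (C.tp 1).π = α.act g (a ≫ (C.tp 1).π) h ∧
   ∀ (i j : C.J) {T' : Scheme.{u}} (t : T' ⟶ T) (h' : (t ≫ g) ≫ G.str = ((t ≫ a) ≫ (C.tp 1).π) ≫ X.str)
    (hi : Land ((t ≫ a) ≫ (C.tp 1).π) (C.V i))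
    (hj : Land (α.act (t ≫ g) ((t ≫ a) ≫ (C.tp 1).π) h') (C.V j)),
    (C.tp 1).cc j (t ≫ b) = l.u i j (t ≫ g) ((t ≫ a) ≫ (C.tp 1).π) h' hi hj * (C.tp 1).cc i (t ≫ a)

theorem LactP.comp {l : Lin α C} {T T' : Scheme.{u}} {g : T ⟶ G.carrier} {a b : T ⟶ (C.tp 1).tot}
    (H : LactP l g a b) (s : T' ⟶ T) : LactP l (s ≫ g) (s ≫ a) (s ≫ b) := by
  obtain ⟨h, h1, h2⟩ := H
  have h' : (s ≫ g) ≫ G.str = ((s ≫ a) ≫ (C.tp 1).π) ≫ X.str := by simp [h]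
  refine ⟨h', ?_, ?_⟩
  · rw [Category.assoc, h1]
    exact (α.act_natural s _ _ _ (by simp [h])).trans (α.act_congr rfl (by simp) _ _)
  · intro i j T'' t h3 hi hj
    have e1 : ∀ {Y : Scheme.{u}} (q : T ⟶ Y), t ≫ s ≫ q = (t ≫ s) ≫ q := 
      fun q => (Category.assoc _ _ _).symm
    have h4 : ((t ≫ s) ≫ g) ≫ G.str = (((t ≫ s) ≫ a) ≫ (C.tp 1).π) ≫ X.str := by simp [h]
    have := h2 i j (t ≫ s) h4 (hi.congr (by simp)) (hj.congr (α.act_congr (by simp) (by simp) _ _))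
    refine (congrArg _ (e1 b)).trans (this.trans ?_)
    congr 1

theorem LactP.uniq {l : Lin α C} {T : Scheme.{u}} {g : T ⟶ G.carrier} {a b b' : T ⟶ (C.tp 1).tot}
    (H : LactP l g a b) (H' : LactP l g a b') : b = b' := by
  obtain ⟨h, h1, h2⟩ := H
  obtain ⟨h, h3, h4⟩ := H'
  apply hom_ext_local
  intro z
  obtain ⟨i, O, hz, hi⟩ := Cocyc.Tot.covT (C := C) (a ≫ (C.tp 1).π) z
  obtain ⟨j, O', hz', hj⟩ := Cocyc.Tot.covT (C := C) (α.act g (a ≫ (C.tp 1).π) h) z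
  refine ⟨O ⊓ O', ⟨hz, hz'⟩, ?_⟩
  obtain ⟨o, ho⟩ := exists_lift (O ⊓ O').ι ((Land.ι _).left)
  obtain ⟨o', ho'⟩ := exists_lift (O ⊓ O').ι ((Land.ι _).right)
  have hi' : Land (((O ⊓ O').ι ≫ a) ≫ (C.tp 1).π) (C.V i) := (hi.comp o).congr (by
    rw [← Category.assoc, ho, Category.assoc])
  have hj' : Land ((O ⊓ O').ι ≫ α.act g (a ≫ (C.tp 1).π) h) (C.V j) := (hj.comp o').congr (by
    rw [← Category.assoc, ho'])
  have h' : ((O ⊓ O').ι ≫ g) ≫ G.str = (((O ⊓ O').ι ≫ a) ≫ (C.tp 1).π) ≫ X.str := by simp [h]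
  have hj2 : Land (α.act ((O ⊓ O').ι ≫ g) (((O ⊓ O').ι ≫ a) ≫ (C.tp 1).π) h') (C.V j) :=
    hj'.congr ((α.act_natural _ _ _ _ (by simp [h])).trans (α.act_congr rfl (by simp) _ _))
  apply (C.tp 1).ext1 j
  · simp [h1, h3]
  · rw [Category.assoc, h1]; exact hj'
  · rw [h2 i j _ h' hi' hj2, h4 i j _ h' hi' hj2]

theorem Lin.exists_lact (l : Lin α C) {T : Scheme.{u}} (g : T ⟶ G.carrier) (a : T ⟶ (C.tp 1).tot)
    (h : g ≫ G.str = (a ≫ (C.tp 1).π) ≫ X.str) : ∃ b, LactP l g a b := by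
  refine Exists.elim (lochom (T := T) (fun {T'} t b => LactP l (t ≫ g) (t ≫ a) b) ?_ ?_ ?_) fun b hb => ?_
  · intro T' T'' s t b H
    have := H.comp s
    rwa [← Category.assoc, ← Category.assoc] at this
  · intro T' t b b' H H'
    exact H.uniq H'
  · intro z
    obtain ⟨i, O₁, hz, hi⟩ := Cocyc.Tot.covT (C := C) (a ≫ (C.tp 1).π) z
    obtain ⟨j, O', hz', hj⟩ := Cocyc.Tot.covT (C := C) (α.act g (a ≫ (C.tp 1).π) h) z
    let O := O₁ ⊓ O'
    obtain ⟨o, ho⟩ := exists_lift O.ι (show Land O.ι O₁ from (Land.ι _).left)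
    obtain ⟨o', ho'⟩ := exists_lift O.ι (show Land O.ι O' from (Land.ι _).right)
    have hi' : Land ((O.ι ≫ a) ≫ (C.tp 1).π) (C.V i) := (hi.comp o).congr (by
      rw [← Category.assoc, ho, Category.assoc])
    have hj' : Land (O.ι ≫ α.act g (a ≫ (C.tp 1).π) h) (C.V j) := (hj.comp o').congr (by
      rw [← Category.assoc, ho'])
    have h' : (O.ι ≫ g) ≫ G.str = ((O.ι ≫ a) ≫ (C.tp 1).π) ≫ X.str := by simp [h]
    have hj2 : Land (α.act (O.ι ≫ g) ((O.ι ≫ a) ≫ (C.tp 1).π) h') (C.V j) :=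
      hj'.congr ((α.act_natural _ _ _ _ (by simp [h])).trans (α.act_congr rfl (by simp) _ _))
    obtain ⟨b, hb, hb'⟩ := (C.tp 1).exu j _ hj2 (l.u i j _ _ h' hi' hj2 * (C.tp 1).cc i (O.ι ≫ a))
    refine ⟨O, ⟨hz, hz'⟩, b, h', hb, fun i' j' T' t h4 hi4 hj4 => ?_⟩
    have hi5 : Land ((t ≫ O.ι ≫ a) ≫ (C.tp 1).π) (C.V i) := (hi'.comp t).congr (by simp)
    have eact : t ≫ α.act (O.ι ≫ g) ((O.ι ≫ a) ≫ (C.tp 1).π) h' = 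
        α.act (t ≫ O.ι ≫ g) ((t ≫ O.ι ≫ a) ≫ (C.tp 1).π) h4 := 
      (α.act_natural t _ _ h' (by simp [h])).trans (α.act_congr rfl (by simp) _ _)
    have hj5 : Land (α.act (t ≫ O.ι ≫ g) ((t ≫ O.ι ≫ a) ≫ (C.tp 1).π) h4) (C.V j) :=
      (hj2.comp t).congr eact
    have eb : (t ≫ b) ≫ (C.tp 1).π = α.act (t ≫ O.ι ≫ g) ((t ≫ O.ι ≫ a) ≫ (C.tp 1).π) h4 := by
      rw [Category.assoc, hb, eact]
    have q1 := (C.tp 1).cc_hom j j' (t ≫ b) ((hj5.inf hj4).congr eb.symm)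
    have q2 := (C.tp 1).cc_hom i' i (t ≫ O.ι ≫ a) (hi4.inf hi5)
    rw [q1, (C.tp 1).cc_nat j t b (hj2.congr hb.symm), hb', map_mul, 
      ← (C.tp 1).cc_nat i t _ hi', q2, ev_pow, ev_pow, pow_one, pow_one,
      l.right i' j j' _ _ h4 hi4 hj5 hj4 (hj5.inf hj4), l.left i' i j _ _ h4 hi4 hi5 hj5 (hi4.inf hi5),
      ← l.u_nat i j t _ _ h' hi' hj2 (by simp [h]) (hi5.congr (by simp))
        (hj5.congr (α.act_congr rfl (by simp) _ _)),
      ev_congr (f := C.g j j') rfl eb _ (hj5.inf hj4),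
      l.u_congr i j (g' := t ≫ O.ι ≫ g) (x' := (t ≫ O.ι ≫ a) ≫ (C.tp 1).π) rfl (by simp) _ _ _ h4 hi5 hj5]
    ring
  · have hbπ : b ≫ (C.tp 1).π = α.act g (a ≫ (C.tp 1).π) h := by
      apply hom_ext_local
      intro z
      obtain ⟨O, hz, h1, h2, h3⟩ := hb z
      refine ⟨O, hz, ?_⟩
      rw [← Category.assoc, h2]
      exact ((α.act_natural _ _ _ _ (by simp [h])).trans (α.act_congr rfl (by simp) _ _)).symm
    refine ⟨b, h, hbπ, fun i j T' t h' hi hj => ?_⟩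
    apply fun_ext_local
    intro z
    obtain ⟨O, hz, h1, h2, h3⟩ := hb (t z)
    refine ⟨t ⁻¹ᵁ O, hz, ?_⟩
    let s := t ∣_ O
    have hs : s ≫ O.ι = (t ⁻¹ᵁ O).ι ≫ t := morphismRestrict_ι _ _
    have hs' : ∀ {Y : Scheme.{u}} (q : T ⟶ Y), s ≫ O.ι ≫ q = (t ⁻¹ᵁ O).ι ≫ t ≫ q := fun q => by
      rw [← Category.assoc, hs, Category.assoc]
    have eb : (t ≫ b) ≫ (C.tp 1).π = α.act (t ≫ g) ((t ≫ a) ≫ (C.tp 1).π) h' := by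
      rw [Category.assoc, hbπ]
      exact (α.act_natural _ _ _ _ (by simp [h])).trans (α.act_congr rfl (by simp) _ _)
    have hi5 := hi.comp (t ⁻¹ᵁ O).ι
    have hj5 := hj.comp (t ⁻¹ᵁ O).ι
    have h6 : ((t ⁻¹ᵁ O).ι ≫ (t ≫ g)) ≫ G.str = ((t ⁻¹ᵁ O).ι ≫ ((t ≫ a) ≫ (C.tp 1).π)) ≫ X.str := by
      simp [h]
    have eact : (t ⁻¹ᵁ O).ι ≫ α.act (t ≫ g) ((t ≫ a) ≫ (C.tp 1).π) h' = 
      α.act ((t ⁻¹ᵁ O).ι ≫ (t ≫ g)) ((t ⁻¹ᵁ O).ι ≫ ((t ≫ a) ≫ (C.tp 1).π)) h6 := α.act_natural _ _ _ _ _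
    have ea : (t ⁻¹ᵁ O).ι ≫ ((t ≫ a) ≫ (C.tp 1).π) = (s ≫ O.ι ≫ a) ≫ (C.tp 1).π := by
      rw [hs']; simp
    have h7 : (s ≫ O.ι ≫ g) ≫ G.str = ((s ≫ O.ι ≫ a) ≫ (C.tp 1).π) ≫ X.str := by
      rw [hs', hs']; simp [h]
    have := h3 i j s h7 (hi5.congr ea) (hj5.congr (eact.trans (α.act_congr (hs' _).symm ea _ _)))
    rw [hs', (C.tp 1).cc_nat j _ (t ≫ b) (hj.congr eb.symm)] at this
    rw [this, map_mul, ← l.u_nat i j (t ⁻¹ᵁ O).ι _ _ h' hi hj h6 hi5 (hj5.congr eact), 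
      ← (C.tp 1).cc_nat i _ (t ≫ a) hi]
    congr 1
    · exact l.u_congr _ _ (hs' _) ea.symm _ _ _ _ _ _
    · rw [hs']

/-- the linearized action on the total space -/
def Lin.lact (l : Lin α C) {T : Scheme.{u}} (g : T ⟶ G.carrier) (a : T ⟶ (C.tp 1).tot)
    (h : g ≫ G.str = (a ≫ (C.tp 1).π) ≫ X.str) : T ⟶ (C.tp 1).tot := (l.exists_lact g a h).choose

theorem Lin.lactP (l : Lin α C) {T : Scheme.{u}} (g : T ⟶ G.carrier) (a : T ⟶ (C.tp 1).tot)
    (h : g ≫ G.str = (a ≫ (C.tp 1).π) ≫ X.str) : LactP l g a (l.lact g a h) :=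
  (l.exists_lact g a h).choose_spec

set_option maxHeartbeats 1000000 in
theorem Lin.linearized (l : Lin α C) : α.IsLinearized (C.tp 1).lb := by
  refine ⟨{
    lact := fun g e h => l.lact g e h, lact_π := ?_, lact_natural := ?_, one_lact := ?_,
    mul_lact := ?_, lact_add := ?_, lact_smul := ?_}⟩
  · intro T g e h h'
    exact (l.lactP g e h).2.1
  · intro T' T f g e h h'
    exact ((l.lactP g e h).comp f).uniq (l.lactP _ _ h')
  · intro T e h
    refine (l.lactP _ e h).uniq ⟨h, ?_, ?_⟩
    · symm
      refine (α.act_congr (by simp) rfl _ ?_).trans (α.one_act _ ?_) <;> simp [G.one_str]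
    · intro i j T' t h' hi hj
      have e1 : t ≫ (((e ≫ (C.tp 1).π) ≫ X.str) ≫ G.one) = ((t ≫ e) ≫ (C.tp 1).π) ≫ X.str ≫ G.one := by
        simp
      have h2 : (((t ≫ e) ≫ (C.tp 1).π) ≫ X.str ≫ G.one) ≫ G.str = ((t ≫ e) ≫ (C.tp 1).π) ≫ X.str := by
        simp [G.one_str]
      have e2 := α.one_act ((t ≫ e) ≫ (C.tp 1).π) h2
      have e3 := α.act_congr e1 rfl h' h2
      have hj' : Land ((t ≫ e) ≫ (C.tp 1).π) (C.V j) := hj.congr (e3.trans e2)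
      rw [(C.tp 1).cc_hom i j (t ≫ e) (hi.inf hj'), ev_pow, pow_one]
      congr 1
      symm
      exact (l.u_congr i j e1 rfl _ _ _ h2 hi (hj.congr e3)).trans 
        (l.u_one i j _ h2 hi (hj.congr e3) (hi.inf hj'))
  · intro T g g' e h₁ h₂ h₃ h₄
    have H1 := l.lactP g' e h₃
    have H2 := l.lactP g (l.lact g' e h₃) h₄
    refine (l.lactP _ e h₂).uniq ⟨h₂, ?_, ?_⟩
    · rw [H2.2.1]
      have h5 : g ≫ G.str = α.act g' (e ≫ (C.tp 1).π) h₃ ≫ X.str := by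
        rw [← H1.2.1]; exact h₄
      exact (α.act_congr rfl H1.2.1 _ h5).trans (α.mul_act g g' _ h₁ h₂ h₃ h5).symm
    · have main : ∀ (i j m : C.J) {T' : Scheme.{u}} (t : T' ⟶ T) (h' : (t ≫ G.mul g g' h₁) ≫ G.str = ((t ≫ e) ≫ (C.tp 1).π) ≫ X.str)
        (hi : Land ((t ≫ e) ≫ (C.tp 1).π) (C.V i)) 
        (hj : Land (t ≫ α.act g' (e ≫ (C.tp 1).π) h₃) (C.V j))
        (hm : Land (α.act (t ≫ G.mul g g' h₁) ((t ≫ e) ≫ (C.tp 1).π) h') (C.V m)),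
        (C.tp 1).cc m (t ≫ l.lact g (l.lact g' e h₃) h₄) = 
          l.u i m (t ≫ G.mul g g' h₁) ((t ≫ e) ≫ (C.tp 1).π) h' hi hm * (C.tp 1).cc i (t ≫ e) := by
        intro i j m T' t h' hi hj hm
        have q3 : (t ≫ g') ≫ G.str = ((t ≫ e) ≫ (C.tp 1).π) ≫ X.str := by
          have h₃ : g' ≫ G.str = (e ≫ (C.tp 1).π) ≫ X.str := h₃
          simp [h₃]
        have q1 : (t ≫ g) ≫ G.str = (t ≫ g') ≫ G.str := by simp [h₁]
        have q0 : t ≫ G.mul g g' h₁ = G.mul (t ≫ g) (t ≫ g') q1 := G.mul_natural _ _ _ _ _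
        have q2 : G.mul (t ≫ g) (t ≫ g') q1 ≫ G.str = ((t ≫ e) ≫ (C.tp 1).π) ≫ X.str := by rw [← q0, h']
        have w1 : t ≫ α.act g' (e ≫ (C.tp 1).π) h₃ = α.act (t ≫ g') ((t ≫ e) ≫ (C.tp 1).π) q3 :=
          (α.act_natural _ _ _ _ (by rw [← Category.assoc t e]; exact q3)).trans (α.act_congr rfl (by simp) _ _)
        have w2 : (t ≫ l.lact g' e h₃) ≫ (C.tp 1).π = α.act (t ≫ g') ((t ≫ e) ≫ (C.tp 1).π) q3 := by
          rw [Category.assoc, H1.2.1]; exact w1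
        have q4 : (t ≫ g) ≫ G.str = α.act (t ≫ g') ((t ≫ e) ≫ (C.tp 1).π) q3 ≫ X.str := by
          rw [α.act_str, ← q3, q1]
        have q5 : (t ≫ g) ≫ G.str = ((t ≫ l.lact g' e h₃) ≫ (C.tp 1).π) ≫ X.str := by
          rw [w2, q4]
        have w3 : α.act (t ≫ G.mul g g' h₁) ((t ≫ e) ≫ (C.tp 1).π) h' = 
            α.act (t ≫ g) (α.act (t ≫ g') ((t ≫ e) ≫ (C.tp 1).π) q3) q4 :=
          (α.act_congr q0 rfl _ q2).trans (α.mul_act _ _ _ _ _ _ _)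
        have w4 : α.act (t ≫ g) (α.act (t ≫ g') ((t ≫ e) ≫ (C.tp 1).π) q3) q4 = 
            α.act (t ≫ g) ((t ≫ l.lact g' e h₃) ≫ (C.tp 1).π) q5 := α.act_congr rfl w2.symm _ _
        rw [H2.2.2 j m t q5 (hj.congr (w1.trans w2.symm)) (hm.congr (w3.trans w4)),
          H1.2.2 i j t q3 hi (hj.congr w1), 
          l.u_congr i m q0 rfl h' hi hm q2 hi (hm.congr (α.act_congr q0 rfl _ _)),
          l.u_mul i j m _ _ _ q1 q2 q3 q4 hi (hj.congr w1) _ (hm.congr w3),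
          l.u_congr j m rfl w2 q5 _ _ q4 (hj.congr w1) (hm.congr w3)]
        ring
      intro i m T' t h' hi hm
      apply fun_ext_local
      intro z
      obtain ⟨j, O, hz, hj⟩ := Cocyc.Tot.covT (C := C) (t ≫ α.act g' (e ≫ (C.tp 1).π) h₃) z
      refine ⟨O, hz, ?_⟩
      have a1 : (O.ι ≫ t) ≫ G.mul g g' h₁ = O.ι ≫ (t ≫ G.mul g g' h₁) := Category.assoc _ _ _
      have a2 : ((O.ι ≫ t) ≫ e) ≫ (C.tp 1).π = O.ι ≫ ((t ≫ e) ≫ (C.tp 1).π) := by simp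
      have h5 : ((O.ι ≫ t) ≫ G.mul g g' h₁) ≫ G.str = (((O.ι ≫ t) ≫ e) ≫ (C.tp 1).π) ≫ X.str := by
        rw [a1, a2, Category.assoc, h']; simp
      have h6 : (O.ι ≫ (t ≫ G.mul g g' h₁)) ≫ G.str = (O.ι ≫ ((t ≫ e) ≫ (C.tp 1).π)) ≫ X.str := by
        rw [← a1, ← a2, h5]
      have w5 : O.ι ≫ α.act (t ≫ G.mul g g' h₁) ((t ≫ e) ≫ (C.tp 1).π) h' =
        α.act (O.ι ≫ (t ≫ G.mul g g' h₁)) (O.ι ≫ ((t ≫ e) ≫ (C.tp 1).π)) h6 := α.act_natural _ _ _ _ _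
      have hm6 := (hm.comp O.ι).congr w5
      have := main i j m (O.ι ≫ t) h5 ((hi.comp O.ι).congr a2.symm) (hj.congr (Category.assoc _ _ _).symm)
        (hm6.congr (α.act_congr a1.symm a2.symm _ _))
      have e2 : (t ≫ l.lact g (l.lact g' e h₃) h₄) ≫ (C.tp 1).π = 
          α.act (t ≫ G.mul g g' h₁) ((t ≫ e) ≫ (C.tp 1).π) h' := by
        have h5 : g ≫ G.str = α.act g' (e ≫ (C.tp 1).π) h₃ ≫ X.str := by
          rw [← H1.2.1]; exact h₄
        rw [Category.assoc, H2.2.1, α.act_congr rfl H1.2.1 _ h5, ← α.mul_act g g' _ h₁ h₂ h₃ h5]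
        exact (α.act_natural _ _ _ _ (by rw [← Category.assoc t e]; exact h')).trans (α.act_congr rfl (by simp) _ _)
      rw [map_mul, ← (C.tp 1).cc_nat m _ _ (hm.congr e2.symm), ← (C.tp 1).cc_nat i _ _ hi,
        ← l.u_nat i m O.ι _ _ h' hi hm h6 (hi.comp _) hm6, ← Category.assoc O.ι t, 
        ← Category.assoc O.ι t e]
      refine this.trans ?_
      congr 1
  · intro T g a b h₁ h₂ h₃ h₄ h₅
    refine (l.lactP _ _ h₂).uniq ⟨h₂, ?_, ?_⟩
    · refine ((C.tp 1).add_π _ _ h₅).trans ((l.lactP g a h₃).2.1.trans ?_)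
      exact α.act_congr rfl ((C.tp 1).add_π _ _ h₁).symm _ _
    · intro i j T' t h' hi hj
      have ea : (t ≫ (C.tp 1).lb.add a b h₁) ≫ (C.tp 1).π = (t ≫ a) ≫ (C.tp 1).π := by
        rw [Category.assoc, Category.assoc]; congr 1; exact (C.tp 1).add_π _ _ h₁
      have eb : (t ≫ (C.tp 1).lb.add a b h₁) ≫ (C.tp 1).π = (t ≫ b) ≫ (C.tp 1).π := by
        rw [ea, Category.assoc, Category.assoc]; congr 1
      have ha' : (t ≫ g) ≫ G.str = ((t ≫ a) ≫ (C.tp 1).π) ≫ X.str := by rw [← ea, h']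
      have hb' : (t ≫ g) ≫ G.str = ((t ≫ b) ≫ (C.tp 1).π) ≫ X.str := by rw [← eb, h']
      refine ((C.tp 1).cc_add _ _ h₅ j t).trans ?_
      refine Eq.trans ?_ (congrArg _ ((C.tp 1).cc_add _ _ h₁ i t)).symm
      rw [mul_add]
      congr 1
      · rw [(l.lactP g a h₃).2.2 i j t ha' (hi.congr ea) (hj.congr (α.act_congr rfl ea _ _))]
        congr 1
        exact l.u_congr _ _ rfl ea.symm _ _ _ _ _ _
      · rw [(l.lactP g b h₄).2.2 i j t hb' (hi.congr eb) (hj.congr (α.act_congr rfl eb _ _))]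
        congr 1
        exact l.u_congr _ _ rfl eb.symm _ _ _ _ _ _
  · intro T g f a h₁ h₂
    refine (l.lactP _ _ h₁).uniq ⟨h₁, ?_, ?_⟩
    · refine ((C.tp 1).smul_π _ _).trans ((l.lactP g a h₂).2.1.trans ?_)
      exact α.act_congr rfl ((C.tp 1).smul_π _ _).symm _ _
    · intro i j T' t h' hi hj
      have ea : (t ≫ (C.tp 1).lb.smul f a) ≫ (C.tp 1).π = (t ≫ a) ≫ (C.tp 1).π := by
        rw [Category.assoc, Category.assoc]; congr 1; exact (C.tp 1).smul_π _ _
      have ha' : (t ≫ g) ≫ G.str = ((t ≫ a) ≫ (C.tp 1).π) ≫ X.str := by rw [← ea, h']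
      refine ((C.tp 1).cc_smul _ _ j t).trans ?_
      refine Eq.trans ?_ (congrArg _ ((C.tp 1).cc_smul _ _ i t)).symm
      rw [mul_left_comm]
      congr 1
      rw [(l.lactP g a h₂).2.2 i j t ha' (hi.congr ea) (hj.congr (α.act_congr rfl ea _ _))]
      congr 1
      exact l.u_congr _ _ rfl ea.symm _ _ _ _ _ _

theorem partB (hC : C.Ample) (l : Lin α C) : 
    ∃ L : LineBundle X.carrier, IsAmple L ∧ α.IsLinearized L :=
  ⟨(C.tp 1).lb, hC.lb, l.linearized⟩

end lin

/-! ### Base change of schemes with action -/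
section bc
variable {S S' S'' : Scheme.{u}}

/-- base change, seen over `k`. -/
def SchemeOver.bc (X : SchemeOver k) (r : S ⟶ Spk k) : SchemeOver k :=
  ⟨pullback X.str r, pullback.fst _ _ ≫ X.str⟩

namespace SchemeOver
variable (X : SchemeOver k) (r : S ⟶ Spk k)

/-- first projection -/
def p1 : (X.bc r).carrier ⟶ X.carrier := pullback.fst _ _
/-- second projection -/
def p2 : (X.bc r).carrier ⟶ S := pullback.snd _ _

theorem bc_str : (X.bc r).str = X.p1 r ≫ X.str := rfl
theorem bc_w : X.p1 r ≫ X.str = X.p2 r ≫ r := pullback.condition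
theorem bc_pb : IsPullback (X.p1 r) (X.p2 r) X.str r := IsPullback.of_hasPullback _ _

variable {X r} in
theorem bc_ext {T : Scheme.{u}} {a b : T ⟶ (X.bc r).carrier} (h : a ≫ X.p1 r = b ≫ X.p1 r)
    (h' : a ≫ X.p2 r = b ≫ X.p2 r) : a = b := pullback.hom_ext h h'

/-- points -/
def bl {T : Scheme.{u}} (x : T ⟶ X.carrier) (s : T ⟶ S) (h : x ≫ X.str = s ≫ r) :
    T ⟶ (X.bc r).carrier := pullback.lift x s h

@[simp] theorem bl_p1 {T : Scheme.{u}} (x : T ⟶ X.carrier) (s : T ⟶ S) (h : x ≫ X.str = s ≫ r) :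
    X.bl r x s h ≫ X.p1 r = x := pullback.lift_fst _ _ _
@[simp] theorem bl_p2 {T : Scheme.{u}} (x : T ⟶ X.carrier) (s : T ⟶ S) (h : x ≫ X.str = s ≫ r) :
    X.bl r x s h ≫ X.p2 r = s := pullback.lift_snd _ _ _

theorem comp_bl {T T' : Scheme.{u}} (t : T' ⟶ T) (x : T ⟶ X.carrier) (s : T ⟶ S) (h h') :
    t ≫ X.bl r x s h = X.bl r (t ≫ x) (t ≫ s) h' := by
  apply bc_ext <;> simp

/-- transition -/
def bm {r : S ⟶ Spk k} {r' : S' ⟶ Spk k} (t : S ⟶ S') (ht : t ≫ r' = r) :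
    (X.bc r).carrier ⟶ (X.bc r').carrier :=
  X.bl r' (X.p1 r) (X.p2 r ≫ t) (by rw [Category.assoc, ht, bc_w])

section
variable {r : S ⟶ Spk k} {r' : S' ⟶ Spk k} (t : S ⟶ S') (ht : t ≫ r' = r)
@[simp] theorem bm_p1 : X.bm t ht ≫ X.p1 r' = X.p1 r := bl_p1 _ _ _ _ _
@[simp] theorem bm_p2 : X.bm t ht ≫ X.p2 r' = X.p2 r ≫ t := bl_p2 _ _ _ _ _
theorem bm_str : X.bm t ht ≫ (X.bc r').str = (X.bc r).str := by
  rw [bc_str, bc_str, ← Category.assoc, bm_p1]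
theorem bm_pb : IsPullback (X.bm t ht) (X.p2 r) (X.p2 r') t := by
  refine IsPullback.of_right (t := X.bc_pb r') ?_ (X.bm_p2 t ht)
  rw [bm_p1, ht]; exact X.bc_pb r

theorem bm_affine [IsAffineHom t] : IsAffineHom (X.bm t ht) :=
  MorphismProperty.of_isPullback (P := @IsAffineHom) (X.bm_pb t ht).flip inferInstance

instance flat_str : Flat X.str := inferInstance

instance flat_p2 : Flat (X.p2 r') :=
  MorphismProperty.of_isPullback (P := @Flat) (X.bc_pb r') inferInstance

theorem bm_inj [IsSchemeTheoreticallyDominant t] [QuasiCompact t] (W : (X.bc r').carrier.Opens) :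
    Function.Injective ((X.bm t ht).app W) := by
  have : IsSchemeTheoreticallyDominant (X.bm t ht) :=
    IsSchemeTheoreticallyDominant.of_isPullback (X.bm_pb t ht).flip
  have : QuasiCompact (X.bm t ht) :=
    MorphismProperty.of_isPullback (P := @QuasiCompact) (X.bm_pb t ht).flip inferInstance
  exact (X.bm t ht).app_injective W

/-- Identities may be checked after a dominant base change. -/
theorem INJ [IsSchemeTheoreticallyDominant t] [QuasiCompact t] (W : (X.bc r').carrier.Opens)
    (φ ψ : ∀ {T : Scheme.{u}} (y : T ⟶ (X.bc r').carrier), Land y W → Γ(T, ⊤))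
    (hφ : ∀ {T T' : Scheme.{u}} (t : T' ⟶ T) (x : T ⟶ _) (h h'), φ (t ≫ x) h' = t.appTop (φ x h))
    (hψ : ∀ {T T' : Scheme.{u}} (t : T' ⟶ T) (x : T ⟶ _) (h h'), ψ (t ≫ x) h' = t.appTop (ψ x h))
    (H : ∀ {T : Scheme.{u}} (y : T ⟶ (X.bc r).carrier) (h), φ (y ≫ X.bm t ht) h = ψ (y ≫ X.bm t ht) h)
    {T : Scheme.{u}} (y : T ⟶ (X.bc r').carrier) (h) : φ y h = ψ y h := by
  obtain ⟨f, hf⟩ := exists_ev φ hφ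
  obtain ⟨g, hg⟩ := exists_ev ψ hψ
  have : f = g := by
    apply X.bm_inj t ht W
    apply ev_ext
    have e : ∀ f : Γ((X.bc r').carrier, W), ev ((X.bm t ht).app W f) (X.bm t ht ⁻¹ᵁ W).ι (Land.ι _) =
        ev f ((X.bm t ht ⁻¹ᵁ W).ι ≫ X.bm t ht) (Cocyc.land_pre (Land.ι _)) := by
      intro f
      rw [Scheme.Hom.app_eq_appLE]
      exact Cocyc.ev_appLE _ _ _ _ _ _
    exact (e f).trans ((hf _ _).trans ((H _ _).trans ((hg _ _).symm.trans (e g).symm)))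
  rw [← hf, ← hg, this]
end
end SchemeOver

open SchemeOver
/-- base change of actions -/
def ActionOver.bc {G : GroupSchemeOver k} {X : SchemeOver k} (α : ActionOver G X) (r : S ⟶ Spk k) :
    ActionOver G (X.bc r) where
  act g x h := X.bl r (α.act g (x ≫ X.p1 r) (by rw [h, bc_str, Category.assoc])) (x ≫ X.p2 r) (by
    rw [α.act_str, Category.assoc, Category.assoc, bc_w])
  act_str g x h := by
    show X.bl r _ _ _ ≫ (X.p1 r ≫ X.str) = x ≫ X.p1 r ≫ X.str
    rw [← Category.assoc, bl_p1, α.act_str, Category.assoc]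
  act_natural f g x h h' := by
    apply bc_ext
    · simp only [Category.assoc, bl_p1]
      refine (α.act_natural f g _ _ (by rw [h', bc_str]; simp)).trans (α.act_congr rfl (by simp) _ _)
    · simp
  one_act x h := by
    apply bc_ext
    · rw [bl_p1]
      exact (α.act_congr (by rw [bc_str]; simp) rfl _ (by simp [G.one_str])).trans 
        (α.one_act _ (by simp [G.one_str]))
    · simp
  mul_act g g' x h₁ h₂ h₃ h₄ := by
    have e3 : g' ≫ G.str = (x ≫ X.p1 r) ≫ X.str := by rw [h₃, bc_str]; simp
    apply bc_ext
    · simp only [bl_p1]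
      exact α.mul_act g g' _ h₁ (by rw [h₂, bc_str]; simp) e3 (by rw [α.act_str, ← e3, h₁])
    · simp

theorem ActionOver.bc_p1 {G : GroupSchemeOver k} {X : SchemeOver k} (α : ActionOver G X) (r : S ⟶ Spk k)
    {T : Scheme.{u}} (g : T ⟶ G.carrier) (x : T ⟶ (X.bc r).carrier) (h h') :
    (α.bc r).act g x h ≫ X.p1 r = α.act g (x ≫ X.p1 r) h' := bl_p1 _ _ _ _ _
theorem ActionOver.bc_p2 {G : GroupSchemeOver k} {X : SchemeOver k} (α : ActionOver G X) (r : S ⟶ Spk k)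
    {T : Scheme.{u}} (g : T ⟶ G.carrier) (x : T ⟶ (X.bc r).carrier) (h) :
    (α.bc r).act g x h ≫ X.p2 r = x ≫ X.p2 r := bl_p2 _ _ _ _ _

theorem ActionOver.bc_bm {G : GroupSchemeOver k} {X : SchemeOver k} (α : ActionOver G X) 
    {r : S ⟶ Spk k} {r' : S' ⟶ Spk k} (t : S ⟶ S') (ht : t ≫ r' = r) 
    {T : Scheme.{u}} (g : T ⟶ G.carrier) (x : T ⟶ (X.bc r).carrier) (h h') :
    (α.bc r).act g x h ≫ X.bm t ht = (α.bc r').act g (x ≫ X.bm t ht) h' := by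
  have e : g ≫ G.str = (x ≫ X.p1 r) ≫ X.str := by rw [h, bc_str]; simp
  apply bc_ext
  · rw [Category.assoc, bm_p1, α.bc_p1 r g x h e, α.bc_p1 r' g _ h' (by simp [e])]
    exact α.act_congr rfl (by simp) _ _
  · rw [Category.assoc, bm_p2, ← Category.assoc, α.bc_p2, α.bc_p2]; simp

/-- pull back linearization along a transition -/
def Lin.bm {G : GroupSchemeOver k} {X : SchemeOver k} {α : ActionOver G X}
    {r : S ⟶ Spk k} {r' : S' ⟶ Spk k} {C : Cocyc (X.bc r').carrier} (l : Lin (α.bc r') C)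
    (t : S ⟶ S') (ht : t ≫ r' = r) : Lin (α.bc r) (C.pull (X.bm t ht)) :=
  l.pull (α.bc r) (𝟙 _) (X.bm t ht) (𝟙 _) (by simp) (by rw [bm_str]; simp)
    (fun a b h h' => by simp) (by simp)
    (fun g x h h' => (α.bc_bm t ht g x h (by rw [h]; rw [Category.assoc, bm_str])).trans
      ((α.bc r').act_congr (by simp) rfl _ _))

end bc

/-! ### Refinement -/
namespace Cocyc
section
variable {X : Scheme.{u}} (C : Cocyc X) {J : Type u} (hJ : Finite J) (V : J → X.Opens)
  (cov : ∀ x : X, ∃ i, x ∈ V i) (ρ : J → C.J) (hρ : ∀ j, V j ≤ C.V (ρ j))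

/-- Refinement of a cocycle. -/
abbrev refine : Cocyc X where
  J := J
  fin := hJ
  V := V
  cov := cov
  g i j := X.presheaf.map (homOfLE (inf_le_inf (hρ i) (hρ j))).op (C.g (ρ i) (ρ j))
  g_self i T x h := by
    rw [ev_res _ _ _ (h.mono (inf_le_inf (hρ i) (hρ i)))]; exact C.g_self _ _ _
  g_mul i j l T x h h' h'' := by
    rw [ev_res _ _ _ (h.mono (inf_le_inf (hρ i) (hρ j))), ev_res _ _ _ (h'.mono (inf_le_inf (hρ j) (hρ l))),
      ev_res _ _ _ (h''.mono (inf_le_inf (hρ i) (hρ l)))]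
    exact C.g_mul _ _ _ _ _ _ _

theorem refine_g (i j : J) {T : Scheme.{u}} (x : T ⟶ X) (h h') :
    ev ((C.refine hJ V cov ρ hρ).g i j) x h = ev (C.g (ρ i) (ρ j)) x h' := ev_res _ _ _ _

variable {C} in
theorem Ample.refine (h : C.Ample) : (C.refine hJ V cov ρ hρ).Ample := by
  obtain ⟨h1, h2, h3⟩ := h
  refine ⟨h1, h2, fun x => ?_⟩
  obtain ⟨m, hm, s, U, hU, hx, hs⟩ := h3 x
  refine ⟨m, hm, ⟨fun i => X.presheaf.map (homOfLE (hρ i)).op (s.σ (ρ i)), ?_⟩, U, hU, hx, ?_⟩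
  · intro i j T x hi hj hij
    rw [ev_res _ _ _ (hi.mono (hρ i)), ev_res _ _ _ (hj.mono (hρ j)), C.refine_g hJ V cov ρ hρ i j x hij
      (hij.mono (inf_le_inf (hρ i) (hρ j)))]
    exact s.hom _ _ _ _ _ _
  · intro i
    change V i ⊓ U = X.basicOpen (X.presheaf.map (homOfLE (hρ i)).op (s.σ (ρ i)))
    rw [Scheme.basicOpen_res, ← hs (ρ i), ← inf_assoc, inf_eq_left.mpr (hρ i)]
end
end Cocyc

/-- Refinement of a linearization. -/
def Lin.refine {G : GroupSchemeOver k} {X : SchemeOver k} {α : ActionOver G X}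
    {C : Cocyc X.carrier} (l : Lin α C) {J : Type u} (hJ : Finite J) (V : J → X.carrier.Opens)
    (cov : ∀ x : X.carrier, ∃ i, x ∈ V i) (ρ : J → C.J) (hρ : ∀ j, V j ≤ C.V (ρ j)) :
    Lin α (C.refine hJ V cov ρ hρ) where
  u i j T g x h hi hj := l.u (ρ i) (ρ j) g x h (hi.mono (hρ i)) (hj.mono (hρ j))
  u_nat i j T T' t g x h hi hj h' hi' hj' := l.u_nat _ _ _ _ _ _ _ _ _ _ _
  u_one i j T x h hi hj hij := by
    rw [C.refine_g hJ V cov ρ hρ i j x hij (hij.mono (inf_le_inf (hρ i) (hρ j)))]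
    exact l.u_one _ _ _ _ _ _ _
  u_mul i j m T g g' x h₁ h₂ h₃ h₄ hi hj hl hl' := l.u_mul _ _ _ _ _ _ _ _ _ _ _ _ _ _

/-- We may assume that the opens of the cover are affine. -/
theorem exists_refine {G : GroupSchemeOver k} {X : SchemeOver k} {α : ActionOver G X}
    {C : Cocyc X.carrier} (hC : C.Ample) (l : Lin α C) :
    ∃ C' : Cocyc X.carrier, C'.Ample ∧ Nonempty (Lin α C') ∧ ∀ i, IsAffineOpen (C'.V i) := by
  have := hC.1
  have h1 : ∀ x : X.carrier, ∃ (i : C.J) (V : X.carrier.Opens), IsAffineOpen V ∧ x ∈ V ∧ V ≤ C.V i := by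
    intro x
    obtain ⟨i, hi⟩ := C.cov x
    obtain ⟨_, ⟨V, hV, rfl⟩, hx, hle⟩ := X.carrier.isBasis_affineOpens.exists_subset_of_mem_open hi (C.V i).2
    exact ⟨i, V, hV, hx, hle⟩
  choose i V hV hx hle using h1
  obtain ⟨t, ht⟩ := isCompact_univ.elim_finite_subcover (fun x => (V x : Set X.carrier))
    (fun x => (V x).2) (fun x _ => Set.mem_iUnion.mpr ⟨x, hx x⟩)
  have cov : ∀ x : X.carrier, ∃ j : t, x ∈ V j := by
    intro x
    have := ht (Set.mem_univ x)
    simp only [Set.mem_iUnion] at this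
    obtain ⟨j, hj, hx⟩ := this
    exact ⟨⟨j, hj⟩, hx⟩
  exact ⟨_, hC.refine (J := t) inferInstance (fun j => V j) cov (fun j => i j) (fun j => hle j), 
    ⟨l.refine (J := t) inferInstance (fun j => V j) cov (fun j => i j) (fun j => hle j)⟩, fun j => hV _⟩

/-! ### The tower of finitely generated subalgebras -/
section tower
variable (k) (k' : Type u) [Field k'] [Algebra k k']

/-- finitely generated subalgebra -/
abbrev TwA (s : Finset k') : Type u := Algebra.adjoin k (s : Set k')
/-- its spectrum -/
abbrev TwS (s : Finset k') : Scheme.{u} := Spec (CommRingCat.of (TwA k k' s))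
/-- structure morphism -/
def twr (s : Finset k') : TwS k k' s ⟶ Spk k := Spec.map (CommRingCat.ofHom (algebraMap k (TwA k k' s)))
/-- structure morphism -/
def twri : Spk k' ⟶ Spk k := Spec.map (CommRingCat.ofHom (algebraMap k k'))
/-- projection -/
def twπ (s : Finset k') : Spk k' ⟶ TwS k k' s :=
  Spec.map (CommRingCat.ofHom (algebraMap (TwA k k' s) k'))
variable {k'} in
/-- transition on rings -/
def twi {s t : Finset k'} (h : s ≤ t) : TwA k k' s →+* TwA k k' t :=
  (Subalgebra.inclusion (Algebra.adjoin_mono (Finset.coe_subset.mpr h))).toRingHom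
variable {k'} in
/-- transition -/
def twt {s t : Finset k'} (h : s ≤ t) : TwS k k' t ⟶ TwS k k' s :=
  Spec.map (CommRingCat.ofHom (twi k h))

theorem twπ_r (s : Finset k') : twπ k k' s ≫ twr k k' s = twri k k' := by
  unfold twπ twr twri
  rw [← Spec.map_comp, ← CommRingCat.ofHom_comp]; rfl
theorem twt_r {s t : Finset k'} (h : s ≤ t) : twt k h ≫ twr k k' s = twr k k' t := by
  unfold twt twr
  rw [← Spec.map_comp, ← CommRingCat.ofHom_comp]; rfl
theorem twπ_t {s t : Finset k'} (h : s ≤ t) : twπ k k' t ≫ twt k h = twπ k k' s := by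
  unfold twπ twt
  rw [← Spec.map_comp, ← CommRingCat.ofHom_comp]; rfl
theorem twt_refl (s : Finset k') : twt k (le_refl s) = 𝟙 _ := by
  unfold twt
  exact Spec.map_id _
theorem twt_trans {s t v : Finset k'} (h : s ≤ t) (h' : t ≤ v) :
    twt k h' ≫ twt k h = twt k (h.trans h') := by
  unfold twt
  rw [← Spec.map_comp, ← CommRingCat.ofHom_comp]; rfl

instance {s t : Finset k'} (h : s ≤ t) : IsAffineHom (twt k h) := by unfold twt; infer_instance
instance (s : Finset k') : IsAffineHom (twπ k k' s) := by unfold twπ; infer_instance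
instance (s : Finset k') : IsAffineHom (twr k k' s) := by unfold twr; infer_instance
instance : IsAffineHom (twri k k') := by unfold twri; infer_instance

instance (s : Finset k') : IsDominant (twπ k k' s) := by
  refine ⟨?_⟩
  unfold twπ
  apply (PrimeSpectrum.denseRange_comap_iff_ker_le_nilRadical (algebraMap (TwA k k' s) k')).mpr
  rw [(RingHom.injective_iff_ker_eq_bot _).mp (FaithfulSMul.algebraMap_injective (TwA k k' s) k')]
  exact bot_le
instance (s : Finset k') : IsSchemeTheoreticallyDominant (twπ k k' s) := .of_isDominant _

/-- the ring system -/
def twRing : Finset k' ⥤ CommRingCat.{u} where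
  obj s := CommRingCat.of (TwA k k' s)
  map f := CommRingCat.ofHom (twi k (leOfHom f))
  map_id _ := rfl
  map_comp _ _ := rfl

/-- its cocone -/
def twCocone : Cocone (twRing k k') where
  pt := CommRingCat.of k'
  ι := { app := fun s => CommRingCat.ofHom (algebraMap (TwA k k' s) k'), naturality := fun _ _ _ => rfl }

theorem mem_tw {s : Finset k'} {x : k'} (h : x ∈ s) : x ∈ Algebra.adjoin k (s : Set k') :=
  Algebra.subset_adjoin h

open Classical in
/-- it is a colimit -/
def twColim : IsColimit (twCocone k k') where
  desc c :=
    have key : ∀ (s : Finset k') (x : k') (h : x ∈ Algebra.adjoin k (s : Set k')),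
      (c.ι.app {x} ⟨x, mem_tw k k' (Finset.mem_singleton_self x)⟩ : c.pt) = c.ι.app s ⟨x, h⟩ := by
      intro s x h
      have e1 := c.w (homOfLE (Finset.subset_union_left : s ⊆ s ∪ {x}))
      have e2 := c.w (homOfLE (Finset.subset_union_right : {x} ⊆ s ∪ {x}))
      rw [← e1, ← e2]
      rfl
    CommRingCat.ofHom
    { toFun := fun x => c.ι.app {x} ⟨x, mem_tw k k' (Finset.mem_singleton_self x)⟩
      map_one' := by rw [key {1}]; exact map_one (c.ι.app {1}).hom
      map_zero' := by rw [key {0}]; exact map_zero (c.ι.app {0}).hom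
      map_add' := fun x y => by
        have hx := mem_tw k k' (by simp : x ∈ ({x, y} : Finset k'))
        have hy := mem_tw k k' (by simp : y ∈ ({x, y} : Finset k'))
        rw [key {x, y} _ hx, key {x, y} _ hy, key {x, y} _ (add_mem hx hy)]
        exact map_add (c.ι.app {x, y}).hom ⟨x, hx⟩ ⟨y, hy⟩
      map_mul' := fun x y => by
        have hx := mem_tw k k' (by simp : x ∈ ({x, y} : Finset k'))
        have hy := mem_tw k k' (by simp : y ∈ ({x, y} : Finset k'))
        rw [key {x, y} _ hx, key {x, y} _ hy, key {x, y} _ (mul_mem hx hy)]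
        exact map_mul (c.ι.app {x, y}).hom ⟨x, hx⟩ ⟨y, hy⟩ }
  fac c s := by
    ext x
    have e1 := c.w (homOfLE (Finset.subset_union_left : s ⊆ s ∪ {x.1}))
    have e2 := c.w (homOfLE (Finset.subset_union_right : {x.1} ⊆ s ∪ {x.1}))
    rw [← e1]
    change c.ι.app {x.1} ⟨x.1, _⟩ = _
    rw [← e2]
    rfl
  uniq c m hm := by
    ext x
    change _ = c.ι.app {x} ⟨x, _⟩
    rw [← hm]
    rfl

/-- base diagram -/
def twD : (Finset k')ᵒᵖ ⥤ Scheme.{u} where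
  obj s := TwS k k' s.unop
  map f := twt k (leOfHom f.unop)
  map_id _ := twt_refl _ _ _
  map_comp _ _ := (twt_trans _ _ _ _).symm

/-- base cone -/
def twC : Cone (twD k k') where
  pt := Spk k'
  π := { app := fun s => twπ k k' s.unop, naturality := fun s t f => by
          exact (Category.id_comp _).trans (twπ_t k k' (leOfHom f.unop)).symm }

/-- base cone is a limit -/
def twL : IsLimit (twC k k') :=
  isLimitOfPreserves Scheme.Spec (twColim k k').op

variable {k} (Y : SchemeOver k)
/-- members of the tower -/
abbrev SchemeOver.tw (s : Finset k') : Scheme.{u} := (Y.bc (twr k k' s)).carrier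
/-- limit of the tower -/
abbrev SchemeOver.twi : Scheme.{u} := (Y.bc (twri k k')).carrier
variable {k'} in
/-- transition -/
abbrev SchemeOver.tt {s t : Finset k'} (h : s ≤ t) : Y.tw k' t ⟶ Y.tw k' s := Y.bm (twt k h) (twt_r k k' h)
variable {k'} in
/-- projection -/
abbrev SchemeOver.tp (s : Finset k') : Y.twi k' ⟶ Y.tw k' s := Y.bm (twπ k k' s) (twπ_r k k' s)

theorem SchemeOver.bm_bm {S S' S'' : Scheme.{u}} {r : S ⟶ Spk k} {r' : S' ⟶ Spk k} {r'' : S'' ⟶ Spk k}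
    (t : S ⟶ S') (ht : t ≫ r' = r) (t' : S' ⟶ S'') (ht' : t' ≫ r'' = r') (t'' : S ⟶ S'')
    (ht'' : t'' ≫ r'' = r) (e : t ≫ t' = t'') :
    Y.bm t ht ≫ Y.bm t' ht' = Y.bm t'' ht'' := by
  apply SchemeOver.bc_ext
  · simp
  · rw [Category.assoc, bm_p2, ← Category.assoc, bm_p2, bm_p2, ← e, Category.assoc]

variable {k'} in
theorem SchemeOver.tp_tt {s t : Finset k'} (h : s ≤ t) : Y.tp t ≫ Y.tt h = Y.tp s :=
  Y.bm_bm _ _ _ _ _ _ (twπ_t k k' h)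
variable {k'} in
theorem SchemeOver.tt_tt {s t v : Finset k'} (h : s ≤ t) (h' : t ≤ v) :
    Y.tt h' ≫ Y.tt h = Y.tt (h.trans h') :=
  Y.bm_bm _ _ _ _ _ _ (twt_trans k k' h h')
variable {k'} in
theorem SchemeOver.tt_refl (s : Finset k') : Y.tt (le_refl s) = 𝟙 _ := by
  apply SchemeOver.bc_ext
  · simp
  · rw [bm_p2, twt_refl]; simp

/-- diagram -/
def SchemeOver.twD : (Finset k')ᵒᵖ ⥤ Scheme.{u} where
  obj s := Y.tw k' s.unop
  map f := Y.tt (leOfHom f.unop)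
  map_id _ := Y.tt_refl _
  map_comp _ _ := (Y.tt_tt _ _).symm

/-- cone -/
def SchemeOver.twC : Cone (Y.twD k') where
  pt := Y.twi k'
  π := { app := fun s => Y.tp s.unop, naturality := fun s t f => by
          exact (Category.id_comp _).trans (Y.tp_tt (leOfHom f.unop)).symm }

variable (k) in
theorem tw_exists {T : Scheme.{u}} (x : ∀ s, T ⟶ TwS k k' s)
    (hx : ∀ s t (h : s ≤ t), x t ≫ twt k h = x s) : ∃ y : T ⟶ Spk k', ∀ s, y ≫ twπ k k' s = x s :=
  ⟨(_root_.twL k k').lift ⟨T, { app := fun s => x s.unop, naturality := fun s t f => 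
      (Category.id_comp _).trans (hx _ _ (leOfHom f.unop)).symm }⟩, fun s => (_root_.twL k k').fac _ (op s)⟩
variable (k) in
theorem tw_uniq {T : Scheme.{u}} (x y : T ⟶ Spk k') (h : ∀ s, x ≫ twπ k k' s = y ≫ twπ k k' s) : x = y :=
  (_root_.twL k k').hom_ext fun s => h s.unop

theorem SchemeOver.tw_exists {T : Scheme.{u}} (x : ∀ s, T ⟶ Y.tw k' s)
    (hx : ∀ s t (h : s ≤ t), x t ≫ Y.tt h = x s) : ∃ y : T ⟶ Y.twi k', ∀ s, y ≫ Y.tp s = x s := by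
  obtain ⟨y, hy⟩ := _root_.tw_exists k k' (fun s => x s ≫ Y.p2 _) (fun s t h => by
    rw [← hx s t h, Category.assoc, Category.assoc, bm_p2])
  refine ⟨Y.bl _ (x ∅ ≫ Y.p1 _) y ?_, fun s => SchemeOver.bc_ext ?_ ?_⟩
  · rw [Category.assoc, bc_w, ← Category.assoc, ← hy, Category.assoc, twπ_r]
  · rw [Category.assoc, bm_p1, bl_p1, ← hx ∅ s (Finset.empty_subset s), Category.assoc, bm_p1]
  · rw [Category.assoc, bm_p2, ← Category.assoc, bl_p2, hy]
theorem SchemeOver.tw_uniq {T : Scheme.{u}} (x y : T ⟶ Y.twi k') (h : ∀ s, x ≫ Y.tp s = y ≫ Y.tp s) :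
    x = y := by
  apply SchemeOver.bc_ext
  · have := congrArg (· ≫ Y.p1 _) (h ∅)
    simpa using this
  · apply _root_.tw_uniq k k'
    intro s
    have := congrArg (· ≫ Y.p2 _) (h s)
    simpa using this

/-- limit -/
def SchemeOver.twL : IsLimit (Y.twC k') :=
  have key : ∀ c : Cone (Y.twD k'), ∃ y : c.pt ⟶ Y.twi k', ∀ s : Finset k', y ≫ Y.tp s = c.π.app (op s) :=
    fun c => Y.tw_exists k' (fun s => c.π.app (op s)) fun s t h => c.w (homOfLE h).op
  { lift := fun c => (key c).choose
    fac := fun c s => (key c).choose_spec s.unop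
    uniq := fun c m hm => Y.tw_uniq k' _ _ fun s => (hm (op s)).trans ((key c).choose_spec s).symm }
end tower

/-! ### Limit arguments -/
theorem Land.fac {X T : Scheme.{u}} {U : X.Opens} {x : T ⟶ X} (h : Land x U) :
    ∃ y : T ⟶ U.toScheme, y ≫ U.ι = x :=
  ⟨IsOpenImmersion.lift U.ι x (by
    rw [Scheme.Opens.range_ι]; rintro _ ⟨t, rfl⟩; exact h trivial), IsOpenImmersion.lift_fac _ _ _⟩

theorem Land.of_comp {X Y T : Scheme.{u}} {f : Y ⟶ X} {U : X.Opens} {x : T ⟶ Y} (h : Land (x ≫ f) U) :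
    Land x (f ⁻¹ᵁ U) := h

section limits
open Filter
variable {k' : Type u} [Field k'] [Algebra k k'] (Y : SchemeOver k)

theorem SchemeOver.p1_affine {S : Scheme.{u}} (r : S ⟶ Spk k) [IsAffineHom r] : IsAffineHom (Y.p1 r) :=
  MorphismProperty.of_isPullback (P := @IsAffineHom) (Y.bc_pb r).flip inferInstance

instance SchemeOver.twD_affine {i j : (Finset k')ᵒᵖ} (f : i ⟶ j) : IsAffineHom ((Y.twD k').map f) :=
  Y.bm_affine _ (twt_r k k' (leOfHom f.unop))

theorem SchemeOver.bc_compact {S : Scheme.{u}} (r : S ⟶ Spk k) [IsAffineHom r] [CompactSpace Y.carrier] : 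
    CompactSpace (Y.bc r).carrier :=
  have := Y.p1_affine r
  QuasiCompact.compactSpace_of_compactSpace (Y.p1 r)
theorem SchemeOver.bc_qs {S : Scheme.{u}} (r : S ⟶ Spk k) [IsAffineHom r] [QuasiSeparatedSpace Y.carrier] : 
    QuasiSeparatedSpace (Y.bc r).carrier :=
  have := Y.p1_affine r
  quasiSeparatedSpace_of_quasiSeparated (Y.p1 r)

instance [CompactSpace Y.carrier] (s : (Finset k')ᵒᵖ) : CompactSpace ((Y.twD k').obj s) :=
  Y.bc_compact _
instance [QuasiSeparatedSpace Y.carrier] (s : (Finset k')ᵒᵖ) : QuasiSeparatedSpace ((Y.twD k').obj s) :=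
  Y.bc_qs _
instance SchemeOver.tt_affine {s t : Finset k'} (h : s ≤ t) : IsAffineHom (Y.tt h) := Y.bm_affine _ _

open Classical in
theorem SchemeOver.tw_open {J : Type*} [Finite J] (U : J → (Y.twi k').Opens)
    (hU : ∀ j, IsCompact (U j : Set (Y.twi k'))) :
    ∃ s : Finset k', ∃ V : J → (Y.tw k' s).Opens, (∀ j, IsCompact (V j : Set (Y.tw k' s))) ∧
      ∀ j, Y.tp s ⁻¹ᵁ V j = U j := by
  have h1 : ∀ j, ∃ (i : Finset k') (V : (Y.tw k' i).Opens), IsCompact (V : Set (Y.tw k' i)) ∧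
      Y.tp i ⁻¹ᵁ V = U j := fun j => by
    obtain ⟨i, V, h⟩ := exists_preimage_eq (Y.twD k') (Y.twC k') (Y.twL k') (U j) (hU j)
    exact ⟨i.unop, V, h⟩
  choose i V hV hVU using h1
  have := Fintype.ofFinite J
  let s : Finset k' := Finset.univ.sup fun j => i j
  have hs : ∀ j, i j ≤ s := fun j => Finset.le_sup (f := fun j => i j) (Finset.mem_univ j)
  refine ⟨s, fun j => Y.tt (hs j) ⁻¹ᵁ V j, fun j => ?_, fun j => ?_⟩
  · exact QuasiCompact.isCompact_preimage _ (V j).2 (hV j)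
  · change Y.tp s ⁻¹ᵁ Y.tt (hs j) ⁻¹ᵁ V j = U j
    rw [← Scheme.Hom.comp_preimage, tp_tt]; exact hVU j

theorem SchemeOver.tw_top [CompactSpace Y.carrier] {s : Finset k'} (W : (Y.tw k' s).Opens) (h : Y.tp s ⁻¹ᵁ W = ⊤) :
    ∀ᶠ t in atTop, ∀ h : s ≤ t, Y.tt h ⁻¹ᵁ W = ⊤ := by
  obtain ⟨j, f, hj⟩ := exists_map_eq_top (Y.twD k') (Y.twC k') (Y.twL k') (i := op s) W h
  filter_upwards [eventually_ge_atTop j.unop] with t ht h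
  have : Y.tt h = Y.tt ht ≫ Y.tt (leOfHom f.unop) := (Y.tt_tt _ _).symm
  rw [this, Scheme.Hom.comp_preimage]
  exact congrArg (Y.tt ht ⁻¹ᵁ ·) hj

theorem opensD_aff {s : Finset k'} (W : ((Y.twD k').obj (op s)).Opens) {i j : Over (op s)} (f : i ⟶ j) :
    IsAffineHom ((opensDiagram (Y.twD k') (op s) W).map f) := inferInstance
theorem opensD_compact {s : Finset k'} {W : (Y.tw k' s).Opens} 
    (hW : IsCompact (W : Set (Y.tw k' s))) (j : Over (op s)) :
    CompactSpace ((opensDiagram (Y.twD k') (op s) W).obj j) :=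
  isCompact_iff_compactSpace.mp (QuasiCompact.isCompact_preimage (f := Y.tt (leOfHom j.hom.unop)) _ W.2 hW)
theorem opensD_qs [QuasiSeparatedSpace Y.carrier] {s : Finset k'} {W : (Y.tw k' s).Opens} (j : Over (op s)) :
    QuasiSeparatedSpace ((opensDiagram (Y.twD k') (op s) W).obj j) :=
  (isQuasiSeparated_iff_quasiSeparatedSpace _ ((Y.twD k').map j.hom ⁻¹ᵁ W).2).mp (.of_quasiSeparatedSpace _)

theorem SchemeOver.tw_aff [QuasiSeparatedSpace Y.carrier] {s : Finset k'} (W : (Y.tw k' s).Opens) 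
    (hW : IsCompact (W : Set (Y.tw k' s))) (h : IsAffineOpen (Y.tp s ⁻¹ᵁ W)) :
    ∀ᶠ t in atTop, ∀ h : s ≤ t, IsAffineOpen (Y.tt h ⁻¹ᵁ W) := by
  have h1 := opensD_compact Y hW
  have h2 := opensD_qs Y (W := W)
  have h3 : ∀ {i j : Over (op s)} (f : i ⟶ j), IsAffineHom ((opensDiagram (Y.twD k') (op s) W).map f) :=
    opensD_aff Y W
  have : IsAffine (opensCone (Y.twD k') (Y.twC k') (op s) W).pt := h
  obtain ⟨j, hj⟩ := Scheme.exists_isAffine_of_isLimit _ _ (isLimitOpensCone _ _ (Y.twL k') (op s) W)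
  replace hj : IsAffineOpen (Y.tt (leOfHom j.hom.unop) ⁻¹ᵁ W) := hj
  filter_upwards [eventually_ge_atTop j.left.unop] with t ht h
  have : Y.tt h = Y.tt ht ≫ Y.tt (leOfHom j.hom.unop) := (Y.tt_tt _ _).symm
  rw [this, Scheme.Hom.comp_preimage]
  exact hj.preimage _

theorem lim_fun {I : Type u} [Category.{u} I] [IsCofiltered I] (D : I ⥤ Scheme.{u}) (c : Cone D)
    (hc : IsLimit c) [∀ {i j} (f : i ⟶ j), IsAffineHom (D.map f)] [∀ i, QuasiSeparatedSpace (D.obj i)]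
    (i : I) (W : (D.obj i).Opens) (hW : IsCompact (W : Set (D.obj i))) (f : Γ(c.pt, c.π.app i ⁻¹ᵁ W)) :
    ∃ (j : I) (a : j ⟶ i) (f' : Γ(D.obj j, D.map a ⁻¹ᵁ W)),
      ∀ {T : Scheme.{u}} (y : T ⟶ c.pt) (h h'), ev f y h = ev f' (y ≫ c.π.app j) h' := by
  have h1 (j : Over i) : CompactSpace ((opensDiagram D i W).obj j) :=
    isCompact_iff_compactSpace.mp (QuasiCompact.isCompact_preimage _ W.2 hW)
  have h2 (j : Over i) : QuasiSeparatedSpace ((opensDiagram D i W).obj j) :=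
    (isQuasiSeparated_iff_quasiSeparatedSpace _ (D.map _ ⁻¹ᵁ _).2).mp (.of_quasiSeparatedSpace _)
  obtain ⟨j, a, ha⟩ := exists_appTop_π_eq_of_isLimit _ _ (isLimitOpensCone D c hc i W)
    ((c.π.app i ⁻¹ᵁ W).topIso.inv f)
  have le : c.π.app i ⁻¹ᵁ W ≤ c.π.app j.left ⁻¹ᵁ D.map j.hom ⁻¹ᵁ W := by
    rw [← Scheme.Hom.comp_preimage, c.w]
  change Γ((D.map j.hom ⁻¹ᵁ W).toScheme, ⊤) at a
  replace ha : (c.π.app i ⁻¹ᵁ W).topIso.inv f = ((c.π.app j.left).resLE _ _ le).appTop a := ha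
  refine ⟨j.left, j.hom, (D.map j.hom ⁻¹ᵁ W).topIso.hom a, ?_⟩
  intro T y h h'
  obtain ⟨y, rfl⟩ := Land.fac h
  rw [ev_comp _ _ (Land.ι _), ev_ι, ha, ← appTop_comp]
  have e : (y ≫ (c.π.app i ⁻¹ᵁ W).ι) ≫ c.π.app j.left = 
    (y ≫ (c.π.app j.left).resLE _ _ le) ≫ (D.map j.hom ⁻¹ᵁ W).ι := by
    rw [Category.assoc, Category.assoc, Scheme.Hom.resLE_comp_ι]
  rw [ev_congr rfl e h' (Land.comp (Land.ι _) _), ev_comp _ _ (Land.ι _), ev_ι, Iso.hom_inv_id_apply]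

theorem SchemeOver.tw_fun [QuasiSeparatedSpace Y.carrier] {s : Finset k'} (W : (Y.tw k' s).Opens) 
    (hW : IsCompact (W : Set (Y.tw k' s))) (f : Γ(Y.twi k', Y.tp s ⁻¹ᵁ W)) :
    ∀ᶠ t in atTop, ∀ h : s ≤ t, ∃ f' : Γ(Y.tw k' t, Y.tt h ⁻¹ᵁ W), 
      ∀ {T : Scheme.{u}} (y : T ⟶ Y.twi k') (h h'), ev f y h = ev f' (y ≫ Y.tp t) h' := by
  obtain ⟨v, hle, a, key⟩ : ∃ (v : Finset k') (hle : s ≤ v) (f' : Γ(Y.tw k' v, Y.tt hle ⁻¹ᵁ W)), 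
      ∀ {T : Scheme.{u}} (y : T ⟶ Y.twi k') (h h'), ev f y h = ev f' (y ≫ Y.tp v) h' := by
    obtain ⟨j, b, f', hf'⟩ := lim_fun (Y.twD k') (Y.twC k') (Y.twL k') (op s) W hW f
    exact ⟨j.unop, leOfHom b.unop, f', hf'⟩
  filter_upwards [eventually_ge_atTop v] with t ht h
  have e : Y.tt h = Y.tt ht ≫ Y.tt hle := (Y.tt_tt _ _).symm
  refine ⟨(Y.tt ht).appLE _ _ (by rw [e, Scheme.Hom.comp_preimage]) a, ?_⟩
  intro T y hy hy'
  have e2 : (y ≫ Y.tp t) ≫ Y.tt ht = y ≫ Y.tp v := by rw [Category.assoc, tp_tt]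
  have e3 : y ≫ Y.tp s = (y ≫ Y.tp v) ≫ Y.tt hle := by rw [Category.assoc, tp_tt]
  have l1 : Land (y ≫ Y.tp v) (Y.tt hle ⁻¹ᵁ W) :=
    Land.of_comp ((Cocyc.land_pre hy).congr e3)
  rw [key y hy l1, Cocyc.ev_appLE _ _ _ _ _ (Land.congr l1 e2.symm)]
  exact ev_congr rfl e2.symm _ _
end limits

/-! ### Products with the group -/
section gx
open SchemeOver
/-- product over `k` -/
def SchemeOver.gx (G X : SchemeOver k) : SchemeOver k :=
  ⟨pullback G.str X.str, pullback.snd _ _ ≫ X.str⟩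

variable {G X : SchemeOver k} {S S' : Scheme.{u}}

variable (G X) in
/-- projection -/
def gx1 : (gx G X).carrier ⟶ G.carrier := pullback.fst _ _
variable (G X) in
/-- projection -/
def gx2 : (gx G X).carrier ⟶ X.carrier := pullback.snd _ _
/-- points -/
def gxl {T : Scheme.{u}} (g : T ⟶ G.carrier) (x : T ⟶ X.carrier) (h : g ≫ G.str = x ≫ X.str) :
    T ⟶ (gx G X).carrier := pullback.lift g x h
theorem gx_str : (gx G X).str = gx2 G X ≫ X.str := rfl
theorem gx_w : gx1 G X ≫ G.str = gx2 G X ≫ X.str := pullback.condition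
theorem gx_pb : IsPullback (gx1 G X) (gx2 G X) G.str X.str := IsPullback.of_hasPullback _ _
@[simp] theorem gxl_1 {T : Scheme.{u}} (g : T ⟶ G.carrier) (x : T ⟶ X.carrier) (h) :
    gxl g x h ≫ gx1 G X = g := pullback.lift_fst _ _ _
@[simp] theorem gxl_2 {T : Scheme.{u}} (g : T ⟶ G.carrier) (x : T ⟶ X.carrier) (h) :
    gxl g x h ≫ gx2 G X = x := pullback.lift_snd _ _ _
theorem gx_ext {T : Scheme.{u}} {a b : T ⟶ (gx G X).carrier} (h : a ≫ gx1 G X = b ≫ gx1 G X)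
    (h' : a ≫ gx2 G X = b ≫ gx2 G X) : a = b := pullback.hom_ext h h'

variable (G X) in
/-- projection -/
def qg (r : S ⟶ Spk k) : ((gx G X).bc r).carrier ⟶ G.carrier := (gx G X).p1 r ≫ gx1 G X
variable (G X) in
/-- projection -/
def qx (r : S ⟶ Spk k) : ((gx G X).bc r).carrier ⟶ (X.bc r).carrier :=
  X.bl r ((gx G X).p1 r ≫ gx2 G X) ((gx G X).p2 r) (by
    rw [← bc_w, Category.assoc]; rfl)

theorem qgx_str (r : S ⟶ Spk k) : qg G X r ≫ G.str = qx G X r ≫ (X.bc r).str := by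
  unfold qg qx
  rw [bc_str, ← Category.assoc, bl_p1, Category.assoc, Category.assoc, gx_w]

/-- points -/
def pt (r : S ⟶ Spk k) {T : Scheme.{u}} (g : T ⟶ G.carrier) (x : T ⟶ (X.bc r).carrier)
    (h : g ≫ G.str = x ≫ (X.bc r).str) : T ⟶ ((gx G X).bc r).carrier :=
  (gx G X).bl r (gxl g (x ≫ X.p1 r) (by rw [h, bc_str, Category.assoc])) (x ≫ X.p2 r) (by
    rw [gx_str, ← Category.assoc, gxl_2, Category.assoc, Category.assoc, bc_w])

@[simp] theorem pt_qg (r : S ⟶ Spk k) {T : Scheme.{u}} (g : T ⟶ G.carrier) (x : T ⟶ (X.bc r).carrier) (h) :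
    pt r g x h ≫ qg G X r = g := by
  unfold pt qg
  rw [← Category.assoc, bl_p1, gxl_1]
@[simp] theorem pt_qx (r : S ⟶ Spk k) {T : Scheme.{u}} (g : T ⟶ G.carrier) (x : T ⟶ (X.bc r).carrier) (h) :
    pt r g x h ≫ qx G X r = x := by
  apply bc_ext
  · unfold pt qx
    rw [Category.assoc, bl_p1, ← Category.assoc, bl_p1, gxl_2]
  · unfold pt qx
    rw [Category.assoc, bl_p2, bl_p2]

theorem pt_ext {r : S ⟶ Spk k} {T : Scheme.{u}} {a b : T ⟶ ((gx G X).bc r).carrier}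
    (h : a ≫ qg G X r = b ≫ qg G X r) (h' : a ≫ qx G X r = b ≫ qx G X r) : a = b := by
  apply bc_ext
  · apply gx_ext
    · simpa [qg] using h
    · have := congrArg (· ≫ X.p1 r) h'
      simpa [qx] using this
  · have := congrArg (· ≫ X.p2 r) h'
    simpa [qx] using this

section
variable {r : S ⟶ Spk k} {r' : S' ⟶ Spk k} (t : S ⟶ S') (ht : t ≫ r' = r)
theorem bm_qg : (gx G X).bm t ht ≫ qg G X r' = qg G X r := by
  unfold qg; rw [← Category.assoc, bm_p1]
theorem bm_qx : (gx G X).bm t ht ≫ qx G X r' = qx G X r ≫ X.bm t ht := by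
  apply bc_ext
  · unfold qx
    rw [Category.assoc, bl_p1, ← Category.assoc, bm_p1, Category.assoc, bm_p1, bl_p1]
  · unfold qx
    rw [Category.assoc, bl_p2, bm_p2, Category.assoc, bm_p2, ← Category.assoc, bl_p2]
theorem pt_bm {T : Scheme.{u}} (g : T ⟶ G.carrier) (x : T ⟶ (X.bc r).carrier) (h h') :
    pt r g x h ≫ (gx G X).bm t ht = pt r' g (x ≫ X.bm t ht) h' := by
  apply pt_ext
  · rw [Category.assoc, bm_qg, pt_qg, pt_qg]
  · rw [Category.assoc, bm_qx, ← Category.assoc, pt_qx, pt_qx]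
end
theorem comp_pt (r : S ⟶ Spk k) {T T' : Scheme.{u}} (t : T' ⟶ T) (g : T ⟶ G.carrier) (x : T ⟶ (X.bc r).carrier) (h h') :
    t ≫ pt r g x h = pt r (t ≫ g) (t ≫ x) h' := by
  apply pt_ext <;> rw [Category.assoc] <;> simp
end gx

section qa
open SchemeOver
variable {G : GroupSchemeOver k} {X : SchemeOver k} (α : ActionOver G X) {S S' : Scheme.{u}}
/-- the action morphism -/
def qa (r : S ⟶ Spk k) : ((gx G.toSchemeOver X).bc r).carrier ⟶ (X.bc r).carrier :=
  (α.bc r).act (qg _ _ r) (qx _ _ r) (qgx_str r)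

theorem comp_qa (r : S ⟶ Spk k) {T : Scheme.{u}} (y : T ⟶ ((gx G.toSchemeOver X).bc r).carrier) (h) :
    y ≫ qa α r = (α.bc r).act (y ≫ qg _ _ r) (y ≫ qx _ _ r) h := (α.bc r).act_natural _ _ _ _ _

theorem pt_qa (r : S ⟶ Spk k) {T : Scheme.{u}} (g : T ⟶ G.carrier) (x : T ⟶ (X.bc r).carrier) (h) :
    pt r g x h ≫ qa α r = (α.bc r).act g x h := by
  rw [comp_qa α r _ (by rw [pt_qg, pt_qx, h])]
  exact (α.bc r).act_congr (pt_qg _ _ _ _) (pt_qx _ _ _ _) _ _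

theorem bm_qa {r : S ⟶ Spk k} {r' : S' ⟶ Spk k} (t : S ⟶ S') (ht : t ≫ r' = r) :
    (gx G.toSchemeOver X).bm t ht ≫ qa α r' = qa α r ≫ X.bm t ht := by
  have h0 : qg G.toSchemeOver X r ≫ G.str = (qx G.toSchemeOver X r ≫ X.bm t ht) ≫ (X.bc r').str := by
    rw [qgx_str, Category.assoc, bm_str]
  unfold qa
  rw [α.bc_bm t ht _ _ _ h0]
  refine ((α.bc r').act_natural _ _ _ _ ?_).trans ((α.bc r').act_congr (bm_qg _ _) (bm_qx _ _) _ _)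
  rw [bm_qx, bm_qg, h0]
end qa

/-! ### Descent of cocycles along a dominant base change -/
section desc
open SchemeOver
variable {X : SchemeOver k} {S S' : Scheme.{u}} {r : S ⟶ Spk k} {r' : S' ⟶ Spk k} (t : S ⟶ S')
  (ht : t ≫ r' = r) [IsSchemeTheoreticallyDominant t] [QuasiCompact t]

section
variable (C : Cocyc (X.bc r).carrier) (V' : C.J → (X.bc r').carrier.Opens)
  (cov' : ∀ x, ∃ i, x ∈ V' i)
  (hV : ∀ i {T : Scheme.{u}} (y : T ⟶ (X.bc r).carrier), Land (y ≫ X.bm t ht) (V' i) → Land y (C.V i))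
  (g' : ∀ i j, Γ((X.bc r').carrier, V' i ⊓ V' j))
  (hg : ∀ i j {T : Scheme.{u}} (y : T ⟶ (X.bc r).carrier) (h h'),
    ev (C.g i j) y h = ev (g' i j) (y ≫ X.bm t ht) h')

/-- Descent of a cocycle. -/
abbrev Cocyc.desc : Cocyc (X.bc r').carrier where
  J := C.J
  fin := C.fin
  V := V'
  cov := cov'
  g := g'
  g_self i T x h := by
    refine X.INJ t ht (V' i ⊓ V' i) (fun y h => ev (g' i i) y h) (fun y h => 1) ?_ ?_ ?_ x h
    · intro T T' t x h h'; exact ev_comp _ _ _ _ _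
    · intro T T' t x h h'; exact (map_one _).symm
    · intro T y h
      exact (hg i i y ((hV i y h.left).inf (hV i y h.left)) _).symm.trans (C.g_self _ _ _)
  g_mul i j l T x h h' h'' := by
    refine X.INJ t ht (V' i ⊓ V' j ⊓ V' l) (fun y h => ev (g' i j) y h.left * ev (g' j l) y (h.left.right.inf h.right))
      (fun y h => ev (g' i l) y (h.left.left.inf h.right)) ?_ ?_ ?_ x (h.inf h'.right)
    · intro T T' t x h h'
      rw [map_mul, ← ev_comp, ← ev_comp]
    · intro T T' t x h h'; exact ev_comp _ _ _ _ _
    · intro T y h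
      have hi := hV i y h.left.left
      have hj := hV j y h.left.right
      have hl := hV l y h.right
      have := C.g_mul i j l y (hi.inf hj) (hj.inf hl) (hi.inf hl)
      rw [hg i j y _ h.left, hg j l y _ (h.left.right.inf h.right), hg i l y _ (h.left.left.inf h.right)] at this
      exact this

/-- Descent of sections. -/
abbrev Cocyc.HS.desc {m : ℕ} (s : C.HS m) (σ' : ∀ i, Γ((X.bc r').carrier, V' i))
    (hσ : ∀ i {T : Scheme.{u}} (y : T ⟶ (X.bc r).carrier) (h h'),
      ev (s.σ i) y h = ev (σ' i) (y ≫ X.bm t ht) h') : (C.desc t ht V' cov' hV g' hg).HS m where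
  σ := σ'
  hom i j T x hi hj hij := by
    refine X.INJ t ht (V' i ⊓ V' j) (fun y h => ev (σ' j) y h.right)
      (fun y h => ev (g' i j) y h ^ m * ev (σ' i) y h.left) ?_ ?_ ?_ x hij
    · intro T T' t x h h'; exact ev_comp _ _ _ _ _
    · intro T T' t x h h'
      rw [map_mul, map_pow, ← ev_comp, ← ev_comp]
    · intro T y h
      have hi := hV i y h.left
      have hj := hV j y h.right
      have := s.hom i j y hi hj (hi.inf hj)
      rw [hg i j y _ h, hσ i y _ h.left, hσ j y _ h.right] at this
      exact this
end
theorem land_post {X Y : Scheme.{u}} {f : Y ⟶ X} {U : X.Opens} {T : Scheme.{u}} {x : T ⟶ Y}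
    (h : Land (x ≫ f) U) : Land x (f ⁻¹ᵁ U) := h
section
variable {G : GroupSchemeOver k} (α : ActionOver G X)
variable {C : Cocyc (X.bc r).carrier} (l : Lin (α.bc r) C) (V' : C.J → (X.bc r').carrier.Opens)
  (cov' : ∀ x, ∃ i, x ∈ V' i)
  (hV : ∀ i {T : Scheme.{u}} (y : T ⟶ (X.bc r).carrier), Land (y ≫ X.bm t ht) (V' i) → Land y (C.V i))
  (g' : ∀ i j, Γ((X.bc r').carrier, V' i ⊓ V' j))
  (hg : ∀ i j {T : Scheme.{u}} (y : T ⟶ (X.bc r).carrier) (h h'),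
    ev (C.g i j) y h = ev (g' i j) (y ≫ X.bm t ht) h')
  (u' : ∀ i j, Γ(((gx G.toSchemeOver X).bc r').carrier, qx _ _ r' ⁻¹ᵁ V' i ⊓ qa α r' ⁻¹ᵁ V' j))
  (hu : ∀ i j {T : Scheme.{u}} (g : T ⟶ G.carrier) (x : T ⟶ (X.bc r).carrier) (h hi hj h' hl),
    l.u i j g x h hi hj = ev (u' i j) (pt r' g (x ≫ X.bm t ht) h') hl)

theorem land_pt {V W : (X.bc r').carrier.Opens} {T : Scheme.{u}} {g : T ⟶ G.carrier} {x : T ⟶ (X.bc r').carrier} {h}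
    (hi : Land x V) (hj : Land ((α.bc r').act g x h) W) : 
    Land (pt r' g x h) (qx _ _ r' ⁻¹ᵁ V ⊓ qa α r' ⁻¹ᵁ W) :=
  Land.inf (hi.congr (pt_qx _ _ _ _).symm) (hj.congr (pt_qa _ _ _ _ _).symm)

theorem pt_congr {G : SchemeOver k} {T : Scheme.{u}} {g g' : T ⟶ G.carrier} {x x' : T ⟶ (X.bc r').carrier} (hg : g = g')
    (hx : x = x') (h h') : pt r' g x h = pt r' g' x' h' := by subst hg hx; rfl


theorem qx_str {G X : SchemeOver k} (r : S ⟶ Spk k) :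
    qx G X r ≫ (X.bc r).str = ((gx G X).bc r).str := by
  rw [qx, bc_str, ← Category.assoc, bl_p1, bc_str, gx_str, Category.assoc]

/-- Identities on triples may be checked after a dominant base change. -/
theorem INJ3 (W : ((gx G.toSchemeOver (gx G.toSchemeOver X)).bc r').carrier.Opens)
    (P : ∀ {T : Scheme.{u}} (g g' : T ⟶ G.carrier) (x : T ⟶ (X.bc r').carrier), Prop)
    (φ ψ : ∀ {T : Scheme.{u}} (g g' : T ⟶ G.carrier) (x : T ⟶ (X.bc r').carrier)
      (h₁ : g ≫ G.str = g' ≫ G.str) (h₂ : g' ≫ G.str = x ≫ (X.bc r').str), P g g' x → Γ(T, ⊤))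
    (hP : ∀ {T : Scheme.{u}} (q : T ⟶ ((gx G.toSchemeOver (gx G.toSchemeOver X)).bc r').carrier),
      Land q W ↔ P (q ≫ qg _ _ r') (q ≫ qx _ _ r' ≫ qg _ _ r') (q ≫ qx _ _ r' ≫ qx _ _ r'))
    (hφ : ∀ {T T' : Scheme.{u}} (s : T' ⟶ T) (g g' x h₁ h₂ h h₁' h₂' h'),
      φ (s ≫ g) (s ≫ g') (s ≫ x) h₁' h₂' h' = s.appTop (φ g g' x h₁ h₂ h))
    (hψ : ∀ {T T' : Scheme.{u}} (s : T' ⟶ T) (g g' x h₁ h₂ h h₁' h₂' h'),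
      ψ (s ≫ g) (s ≫ g') (s ≫ x) h₁' h₂' h' = s.appTop (ψ g g' x h₁ h₂ h))
    (H : ∀ {T : Scheme.{u}} (g g' : T ⟶ G.carrier) (x : T ⟶ (X.bc r).carrier)
      (h₁ : g ≫ G.str = g' ≫ G.str) (h₂ : g' ≫ G.str = x ≫ (X.bc r).str) (h₂' h),
      φ g g' (x ≫ X.bm t ht) h₁ h₂' h = ψ g g' (x ≫ X.bm t ht) h₁ h₂' h)
    {T : Scheme.{u}} (g g' : T ⟶ G.carrier) (x : T ⟶ (X.bc r').carrier) (h₁ h₂ h) :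
    φ g g' x h₁ h₂ h = ψ g g' x h₁ h₂ h := by
  have φc : ∀ {T : Scheme.{u}} {g g' : T ⟶ G.carrier} {x : T ⟶ (X.bc r').carrier}
      {g1 g1' : T ⟶ G.carrier} {x1 : T ⟶ (X.bc r').carrier} (e1 : g = g1) (e2 : g' = g1') (e3 : x = x1)
      (h₁ h₂ h h₁' h₂' h'), φ g g' x h₁ h₂ h = φ g1 g1' x1 h₁' h₂' h' := by
    intro _ _ _ _ _ _ _ e1 e2 e3; intros; subst e1 e2 e3; rfl
  have ψc : ∀ {T : Scheme.{u}} {g g' : T ⟶ G.carrier} {x : T ⟶ (X.bc r').carrier}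
      {g1 g1' : T ⟶ G.carrier} {x1 : T ⟶ (X.bc r').carrier} (e1 : g = g1) (e2 : g' = g1') (e3 : x = x1)
      (h₁ h₂ h h₁' h₂' h'), ψ g g' x h₁ h₂ h = ψ g1 g1' x1 h₁' h₂' h' := by
    intro _ _ _ _ _ _ _ e1 e2 e3; intros; subst e1 e2 e3; rfl
  have Pc : ∀ {T : Scheme.{u}} {g g' : T ⟶ G.carrier} {x : T ⟶ (X.bc r').carrier}
      {g1 g1' : T ⟶ G.carrier} {x1 : T ⟶ (X.bc r').carrier} (e1 : g = g1) (e2 : g' = g1') (e3 : x = x1),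
      P g g' x → P g1 g1' x1 := by
    intro _ _ _ _ _ _ _ e1 e2 e3; intros; subst e1 e2 e3; assumption
  have A1 : ∀ {S : Scheme.{u}} {r : S ⟶ Spk k} {T : Scheme.{u}} (q : T ⟶ ((gx G.toSchemeOver (gx G.toSchemeOver X)).bc r).carrier),
      (q ≫ qg _ _ r) ≫ G.str = (q ≫ qx _ _ r ≫ qg _ _ r) ≫ G.str := by
    intro S r T q
    simp only [Category.assoc, qgx_str]
    simp only [qx_str]
  have A2 : ∀ {S : Scheme.{u}} {r : S ⟶ Spk k} {T : Scheme.{u}} (q : T ⟶ ((gx G.toSchemeOver (gx G.toSchemeOver X)).bc r).carrier),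
      (q ≫ qx _ _ r ≫ qg _ _ r) ≫ G.str = (q ≫ qx _ _ r ≫ qx _ _ r) ≫ (X.bc r).str := by
    intro S r T q
    simp only [Category.assoc, qgx_str]
  have h0 : g' ≫ G.str = x ≫ (X.bc r').str := h₂
  have hq0 : g ≫ G.str = pt r' g' x h0 ≫ ((gx G.toSchemeOver X).bc r').str := by
    rw [← qx_str, ← Category.assoc, pt_qx, h₁, h0]
  let q := pt r' g (pt r' g' x h0) hq0
  have e1 : q ≫ qg _ _ r' = g := pt_qg _ _ _ _
  have e2 : q ≫ qx _ _ r' ≫ qg _ _ r' = g' := by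
    rw [← Category.assoc, pt_qx, pt_qg]
  have e3 : q ≫ qx _ _ r' ≫ qx _ _ r' = x := by
    rw [← Category.assoc, pt_qx, pt_qx]
  have hW : Land q W := (hP q).2 (Pc e1.symm e2.symm e3.symm h)
  have := (gx G.toSchemeOver (gx G.toSchemeOver X)).INJ t ht W
    (fun q h => φ _ _ _ (A1 q) (A2 q) ((hP q).1 h)) (fun q h => ψ _ _ _ (A1 q) (A2 q) ((hP q).1 h)) ?_ ?_ ?_ q hW
  · exact (φc e1.symm e2.symm e3.symm _ _ _ _ _ _).trans (this.trans (ψc e1 e2 e3 _ _ _ _ _ _))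
  · intro T T' s q h h'
    rw [← hφ s _ _ _ _ _ _ (by simpa using congrArg (s ≫ ·) (A1 q)) (by simpa using congrArg (s ≫ ·) (A2 q))
      (Pc (by simp) (by simp) (by simp) ((hP _).1 h'))]
    exact φc (by simp) (by simp) (by simp) _ _ _ _ _ _
  · intro T T' s q h h'
    rw [← hψ s _ _ _ _ _ _ (by simpa using congrArg (s ≫ ·) (A1 q)) (by simpa using congrArg (s ≫ ·) (A2 q))
      (Pc (by simp) (by simp) (by simp) ((hP _).1 h'))]
    exact ψc (by simp) (by simp) (by simp) _ _ _ _ _ _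
  · intro T y h
    have f1 : (y ≫ (gx G.toSchemeOver (gx G.toSchemeOver X)).bm t ht) ≫ qg _ _ r' = y ≫ qg _ _ r := by
      rw [Category.assoc, bm_qg]
    have f2 : (y ≫ (gx G.toSchemeOver (gx G.toSchemeOver X)).bm t ht) ≫ qx _ _ r' ≫ qg _ _ r' = y ≫ qx _ _ r ≫ qg _ _ r := by
      rw [Category.assoc, ← Category.assoc (SchemeOver.bm _ _ _), bm_qx, Category.assoc, bm_qg]
    have f3 : (y ≫ (gx G.toSchemeOver (gx G.toSchemeOver X)).bm t ht) ≫ qx _ _ r' ≫ qx _ _ r' = (y ≫ qx _ _ r ≫ qx _ _ r) ≫ X.bm t ht := by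
      rw [Category.assoc, ← Category.assoc (SchemeOver.bm _ _ _), bm_qx, Category.assoc, bm_qx]; simp
    have f4 : (y ≫ qx _ _ r ≫ qg _ _ r) ≫ G.str = ((y ≫ qx _ _ r ≫ qx _ _ r) ≫ X.bm t ht) ≫ (X.bc r').str := by
      rw [A2, Category.assoc _ (X.bm t ht), bm_str]
    have f5 := Pc f1 f2 f3 ((hP _).1 h)
    exact (φc f1 f2 f3 _ _ _ (A1 y) f4 f5).trans ((H _ _ _ _ (A2 y) f4 f5).trans (ψc f1 f2 f3 _ _ _ _ _ _).symm)

set_option maxHeartbeats 1600000 in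
/-- Descent of linearizations. -/
def Lin.desc : Lin (α.bc r') (C.desc t ht V' cov' hV g' hg) where
  u i j T g x h hi hj := ev (u' i j) (pt r' g x h) (land_pt α hi hj)
  u_nat i j T T' t g x h hi hj h' hi' hj' := by
    rw [← ev_comp _ _ _ _ (Land.comp (land_pt α hi hj) t)]
    exact ev_congr rfl (comp_pt _ _ _ _ _ _).symm _ _
  u_one i j T x h hi hj hij := by
    have e : ∀ {T : Scheme.{u}} (x : T ⟶ (X.bc r').carrier), (x ≫ (X.bc r').str ≫ G.one) ≫ G.str = x ≫ (X.bc r').str := by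
      intro T x; simp [G.one_str]
    have ld : ∀ {T : Scheme.{u}} (x : T ⟶ (X.bc r').carrier), Land x (V' i ⊓ V' j) →
      Land (pt r' (x ≫ (X.bc r').str ≫ G.one) x (e x)) (qx _ _ r' ⁻¹ᵁ V' i ⊓ qa α r' ⁻¹ᵁ V' j) := by
      intro T x h
      exact land_pt α h.left (h.right.congr ((α.bc r').one_act x _).symm)
    refine X.INJ t ht (V' i ⊓ V' j) (fun y h => ev (u' i j) (pt r' _ y (e y)) (ld y h))
      (fun y h => ev (g' i j) y h) ?_ ?_ ?_ x hij
    · intro T T' t x h h'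
      rw [← ev_comp _ _ _ _ (Land.comp (ld x h) t)]
      refine ev_congr rfl ?_ _ _
      exact (pt_congr (by simp) rfl _ (by simp [G.one_str])).trans (comp_pt _ _ _ _ _ (by simp [G.one_str])).symm
    · intro T T' t x h h'; exact ev_comp _ _ _ _ _
    · intro T y h
      have hi := hV i y h.left
      have hj := hV j y h.right
      have e' : (y ≫ (X.bc r).str ≫ G.one) ≫ G.str = y ≫ (X.bc r).str := by simp [G.one_str]
      have := l.u_one i j y e' hi (hj.congr ((α.bc r).one_act y _).symm) (hi.inf hj)
      have e2 : (y ≫ (X.bc r).str ≫ G.one) ≫ G.str = (y ≫ X.bm t ht) ≫ (X.bc r').str := by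
        rw [e', Category.assoc, bm_str]
      have e3 : pt r' ((y ≫ X.bm t ht) ≫ (X.bc r').str ≫ G.one) (y ≫ X.bm t ht) (e _) =
        pt r' (y ≫ (X.bc r).str ≫ G.one) (y ≫ X.bm t ht) e2 := 
        pt_congr (by rw [Category.assoc, ← Category.assoc (X.bm t ht), bm_str]) rfl _ _
      rw [hg i j y _ h, hu i j _ y _ _ _ e2 ((ld _ h).congr e3)] at this
      exact (ev_congr rfl e3 _ _).trans this
  u_mul i j m T g g' x h₁ h₂ h₃ h₄ hi hj hl hl' := by
    have hmul : ∀ {S : Scheme.{u}} {r : S ⟶ Spk k} {T : Scheme.{u}} (g g' : T ⟶ G.carrier) (x : T ⟶ (X.bc r).carrier)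
      (h₁ : g ≫ G.str = g' ≫ G.str) (h₂ : g' ≫ G.str = x ≫ (X.bc r).str),
      G.mul g g' h₁ ≫ G.str = x ≫ (X.bc r).str := by
      intro S r T g g' x h₁ h₂; rw [G.mul_str, h₁, h₂]
    have hact : ∀ {S : Scheme.{u}} {r : S ⟶ Spk k} {T : Scheme.{u}} (g g' : T ⟶ G.carrier) (x : T ⟶ (X.bc r).carrier)
      (h₁ : g ≫ G.str = g' ≫ G.str) (h₂ : g' ≫ G.str = x ≫ (X.bc r).str),
      g ≫ G.str = (α.bc r).act g' x h₂ ≫ (X.bc r).str := by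
      intro S r T g g' x h₁ h₂; rw [(α.bc r).act_str, h₁, h₂]
    have hd : qg _ _ r' ≫ G.str = (qx G.toSchemeOver (gx G.toSchemeOver X) r' ≫ qa α r') ≫ (X.bc r').str := by
      rw [qgx_str, Category.assoc, qa, (α.bc r').act_str]; simp only [qx_str]
    have hb : ∀ {T : Scheme.{u}} (q : T ⟶ ((gx G.toSchemeOver (gx G.toSchemeOver X)).bc r').carrier) h,
        q ≫ qx _ _ r' ≫ qa α r' = (α.bc r').act (q ≫ qx _ _ r' ≫ qg _ _ r') (q ≫ qx _ _ r' ≫ qx _ _ r') h := by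
      intro T q h
      rw [← Category.assoc, comp_qa _ _ _ (by simp only [Category.assoc, qgx_str])]
      exact (α.bc r').act_congr (by simp) (by simp) _ _
    refine INJ3 t ht ((qx _ _ r' ≫ qx _ _ r') ⁻¹ᵁ V' i ⊓ (qx _ _ r' ≫ qa α r') ⁻¹ᵁ V' j ⊓
        ((α.bc r').act (qg _ _ r') (qx _ _ r' ≫ qa α r') hd) ⁻¹ᵁ V' m)
      (fun g g' x => Land x (V' i) ∧ (∀ h₂, Land ((α.bc r').act g' x h₂) (V' j)) ∧
        ∀ h₂ h₃, Land ((α.bc r').act g ((α.bc r').act g' x h₂) h₃) (V' m))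
      (fun g g' x h₁ h₂ h => ev (u' i m) (pt r' (G.mul g g' h₁) x (hmul g g' x h₁ h₂))
        (land_pt α h.1 ((h.2.2 h₂ (hact g g' x h₁ h₂)).congr ((α.bc r').mul_act _ _ _ _ _ _ _).symm)))
      (fun g g' x h₁ h₂ h => ev (u' i j) (pt r' g' x h₂) (land_pt α h.1 (h.2.1 h₂)) *
        ev (u' j m) (pt r' g ((α.bc r').act g' x h₂) (hact g g' x h₁ h₂))
          (land_pt α (h.2.1 h₂) (h.2.2 h₂ (hact g g' x h₁ h₂)))) ?_ ?_ ?_ ?_ g g' x h₁ h₃ 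
        ⟨hi, fun _ => hj, fun _ _ => hl'⟩
    · intro T q
      have h0 : (q ≫ qx _ _ r' ≫ qg _ _ r') ≫ G.str = (q ≫ qx _ _ r' ≫ qx _ _ r') ≫ (X.bc r').str := by
        simp only [Category.assoc, qgx_str]
      have h1 := hb q h0
      have h2 : (q ≫ qg _ _ r') ≫ G.str = (q ≫ qx _ _ r' ≫ qa α r') ≫ (X.bc r').str := by
        rw [Category.assoc, hd, Category.assoc]; simp
      have h3 : (q ≫ qg _ _ r') ≫ G.str = (α.bc r').act (q ≫ qx _ _ r' ≫ qg _ _ r') (q ≫ qx _ _ r' ≫ qx _ _ r') h0 ≫ (X.bc r').str := by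
        rw [← h1, h2]
      have h4 : q ≫ (α.bc r').act (qg _ _ r') (qx _ _ r' ≫ qa α r') hd = 
          (α.bc r').act (q ≫ qg _ _ r') ((α.bc r').act (q ≫ qx _ _ r' ≫ qg _ _ r') (q ≫ qx _ _ r' ≫ qx _ _ r') h0) h3 :=
        ((α.bc r').act_natural _ _ _ _ h2).trans ((α.bc r').act_congr rfl h1 _ _)
      constructor
      · intro h
        exact ⟨Land.congr (Cocyc.land_pre h.left.left) (by simp), 
          fun _ => Land.congr (Cocyc.land_pre h.left.right) h1, fun _ _ => Land.congr (Cocyc.land_pre h.right) h4⟩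
      · rintro ⟨a, b, c⟩
        exact Land.inf (Land.inf (land_post (Land.congr a (by simp))) (land_post (Land.congr (b h0) h1.symm)))
          (land_post (Land.congr (c h0 h3) h4.symm))
    · intro T T' s g g' x h₁ h₂ h h₁' h₂' h'
      rw [ev_comp']
      refine ev_congr rfl ?_ _ _
      rw [comp_pt _ _ _ _ _ (by simpa using congrArg (s ≫ ·) (hmul g g' x h₁ h₂))]
      exact pt_congr (G.mul_natural _ _ _ _ _).symm rfl _ _
    · intro T T' s g g' x h₁ h₂ h h₁' h₂' h'
      rw [map_mul, ev_comp', ev_comp']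
      congr 1
      · exact ev_congr rfl (comp_pt _ _ _ _ _ _).symm _ _
      · refine ev_congr rfl ?_ _ _
        have w := (α.bc r').act_natural s g' x h₂ h₂'
        have w' : (s ≫ g) ≫ G.str = (s ≫ (α.bc r').act g' x h₂) ≫ (X.bc r').str := by
          rw [w]; exact hact _ _ _ h₁' h₂'
        exact (pt_congr rfl w.symm _ w').trans (comp_pt _ _ _ _ _ w').symm
    · intro T g g' x h₁ h₂ h₂' h
      have e1 := α.bc_bm t ht g' x h₂ h₂'
      have k0 := hact g g' _ h₁ h₂'
      have k1 : g ≫ G.str = ((α.bc r).act g' x h₂ ≫ X.bm t ht) ≫ (X.bc r').str := by rw [e1, k0]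
      have e2 := (α.bc_bm t ht g ((α.bc r).act g' x h₂) (hact g g' x h₁ h₂) k1).trans 
        ((α.bc r').act_congr rfl e1 _ k0)
      have li := hV i x h.1
      have lj := hV j _ (Land.congr (h.2.1 h₂') e1.symm)
      have lm := hV m _ (Land.congr (h.2.2 h₂' k0) e2.symm)
      have := l.u_mul i j m g g' x h₁ (hmul g g' x h₁ h₂) h₂ (hact g g' x h₁ h₂) li lj
        (lm.congr ((α.bc r).mul_act _ _ _ _ _ _ _).symm) lm
      have k2 : pt r' g ((α.bc r').act g' (x ≫ X.bm t ht) h₂') k0 = 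
        pt r' g ((α.bc r).act g' x h₂ ≫ X.bm t ht) k1 := pt_congr rfl e1.symm _ _
      rw [hu i m _ _ _ _ _ (hmul g g' _ h₁ h₂')
          (land_pt α h.1 ((h.2.2 h₂' k0).congr ((α.bc r').mul_act _ _ _ _ _ _ _).symm)),
        hu i j _ _ _ _ _ h₂' (land_pt α h.1 (h.2.1 h₂')), hu j m _ _ _ _ _ k1 
          (Land.congr (land_pt α (h.2.1 h₂') (h.2.2 h₂' k0)) k2)] at this
      exact this.trans (congrArg _ (ev_congr rfl k2.symm _ _))
end
end desc

/-! ### Descent to a finitely generated subalgebra -/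
section towerdesc
open SchemeOver Filter

theorem Cocyc.HS.nv {X : Scheme.{u}} {C : Cocyc X} {m : ℕ} (s : C.HS m) :
    s.NV (⨆ i, X.basicOpen (s.σ i)) := by
  intro i
  apply le_antisymm
  · rintro x ⟨hx, hx'⟩
    obtain ⟨j, hj⟩ := TopologicalSpace.Opens.mem_iSup.mp hx'
    let O := C.V j ⊓ C.V i
    have hxO : x ∈ O := ⟨X.basicOpen_le _ hj, hx⟩
    have e := s.hom i j O.ι (Land.right (Land.ι O)) (Land.left (Land.ι O)) ((Land.right (Land.ι O)).inf (Land.left (Land.ι O)))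
    have h1 : (⟨x, hxO⟩ : O.toScheme) ∈ O.toScheme.basicOpen (ev (s.σ j) O.ι (Land.left (Land.ι O))) := by
      rw [ev_basicOpen]; exact hj
    rw [e, Scheme.basicOpen_mul] at h1
    have := h1.2
    rw [ev_basicOpen] at this
    exact this
  · exact le_inf (X.basicOpen_le _) (le_iSup (fun i => X.basicOpen (s.σ i)) i)

theorem Cocyc.HS.NV.eq {X : Scheme.{u}} {C : Cocyc X} {m : ℕ} {s : C.HS m} {U : X.Opens} (h : s.NV U) :
    U = ⨆ i, X.basicOpen (s.σ i) := by
  have : U = ⨆ i, C.V i ⊓ U := by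
    ext x
    simp only [TopologicalSpace.Opens.coe_iSup, Set.mem_iUnion]
    constructor
    · intro hx
      obtain ⟨i, hi⟩ := C.cov x
      exact ⟨i, hi, hx⟩
    · rintro ⟨i, hi, hx⟩; exact hx
  rw [this]
  exact iSup_congr h

theorem basicOpen_eq_of_ev {X Y : Scheme.{u}} (p : Y ⟶ X) {U : X.Opens} {V : Y.Opens} (f : Γ(X, U)) (g : Γ(Y, V))
    (hV : p ⁻¹ᵁ U = V)
    (H : ∀ {T : Scheme.{u}} (y : T ⟶ Y) (h h'), ev g y h = ev f (y ≫ p) h') :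
    p ⁻¹ᵁ X.basicOpen f = Y.basicOpen g := by
  subst hV
  have key := ev_basicOpen g (p ⁻¹ᵁ U).ι (Land.ι _)
  rw [H _ _ (Cocyc.land_pre (Land.ι _)), ev_basicOpen] at key
  have h2 : p ⁻¹ᵁ X.basicOpen f ≤ p ⁻¹ᵁ U := fun x hx => X.basicOpen_le _ hx
  have h3 : Y.basicOpen g ≤ p ⁻¹ᵁ U := Y.basicOpen_le _
  ext y
  constructor
  · intro h
    have : (⟨y, h2 h⟩ : (p ⁻¹ᵁ U).toScheme) ∈ ((p ⁻¹ᵁ U).ι ≫ p) ⁻¹ᵁ X.basicOpen f := h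
    rw [key] at this
    exact this
  · intro h
    have : (⟨y, h3 h⟩ : (p ⁻¹ᵁ U).toScheme) ∈ (p ⁻¹ᵁ U).ι ⁻¹ᵁ Y.basicOpen g := h
    rw [← key] at this
    exact this

theorem pre_comp_eq {X Y Z : Scheme.{u}} {f : X ⟶ Y} {g : Y ⟶ Z} {h : X ⟶ Z} (e : f ≫ g = h) (V : Z.Opens) :
    f ⁻¹ᵁ g ⁻¹ᵁ V = h ⁻¹ᵁ V := by
  subst e; rfl

theorem cov_of_top {X Y : Scheme.{u}} {J : Type*} (f : X ⟶ Y) (V : J → Y.Opens) (h : f ⁻¹ᵁ (⨆ i, V i) = ⊤) (x : X) :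
    ∃ i, x ∈ f ⁻¹ᵁ V i := by
  rw [Scheme.Hom.preimage_iSup] at h
  exact TopologicalSpace.Opens.mem_iSup.mp (h.ge trivial : x ∈ _)

theorem Lin.exists_u {G : GroupSchemeOver k} {X : SchemeOver k} {α : ActionOver G X} {S : Scheme.{u}} {r : S ⟶ Spk k}
    {C : Cocyc (X.bc r).carrier} (l : Lin (α.bc r) C) (i j : C.J) :
    ∃ f : Γ(((gx G.toSchemeOver X).bc r).carrier, qx _ _ r ⁻¹ᵁ C.V i ⊓ qa α r ⁻¹ᵁ C.V j),
      ∀ {T : Scheme.{u}} (g : T ⟶ G.carrier) (x : T ⟶ (X.bc r).carrier) (h hi hj hl),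
        l.u i j g x h hi hj = ev f (pt r g x h) hl := by
  have e : ∀ {T : Scheme.{u}} (q : T ⟶ ((gx G.toSchemeOver X).bc r).carrier), 
      (q ≫ qg _ _ r) ≫ G.str = (q ≫ qx _ _ r) ≫ (X.bc r).str := by
    intro T q; simp only [Category.assoc, qgx_str]
  have e2 : ∀ {T : Scheme.{u}} (q : T ⟶ ((gx G.toSchemeOver X).bc r).carrier),
     Land q (qx _ _ r ⁻¹ᵁ C.V i ⊓ qa α r ⁻¹ᵁ C.V j) → Land ((α.bc r).act _ _ (e q)) (C.V j) := by
    intro T q h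
    exact (Cocyc.land_pre h.right).congr (comp_qa _ _ _ _)
  obtain ⟨f, hf⟩ := exists_ev (U := qx _ _ r ⁻¹ᵁ C.V i ⊓ qa α r ⁻¹ᵁ C.V j)
    (fun q h => l.u i j _ _ (e q) (Cocyc.land_pre h.left) (e2 q h)) (by
      intro T T' t q h h'
      have k1 : (t ≫ q ≫ qg _ _ r) ≫ G.str = (t ≫ q ≫ qx _ _ r) ≫ (X.bc r).str := by
        simp only [Category.assoc, qgx_str]
      rw [← l.u_nat i j t _ _ _ _ _ k1 ((Cocyc.land_pre h.left).comp t)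
        (((e2 q h).comp t).congr ((α.bc r).act_natural _ _ _ _ _))]
      exact l.u_congr _ _ (by simp) (by simp) _ _ _ _ _ _)
  refine ⟨f, ?_⟩
  intro T g x h hi hj hl
  rw [hf]
  exact l.u_congr _ _ (pt_qg _ _ _ _).symm (pt_qx _ _ _ _).symm _ _ _ _ _ _

variable {k' : Type u} [Field k'] [Algebra k k']

theorem SchemeOver.tw_fun' (Y : SchemeOver k) [QuasiSeparatedSpace Y.carrier] {s : Finset k'} (W : (Y.tw k' s).Opens) 
    (hW : IsCompact (W : Set (Y.tw k' s))) {O : (Y.twi k').Opens} (f : Γ(Y.twi k', O)) (hO : Y.tp s ⁻¹ᵁ W ≤ O) :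
    ∀ᶠ t in atTop, ∀ h : s ≤ t, ∀ W' : (Y.tw k' t).Opens, W' ≤ Y.tt h ⁻¹ᵁ W → ∃ f' : Γ(Y.tw k' t, W'), 
      ∀ {T : Scheme.{u}} (y : T ⟶ Y.twi k') (h h'), ev f y h = ev f' (y ≫ Y.tp t) h' := by
  filter_upwards [Y.tw_fun W hW ((Y.twi k').presheaf.map (homOfLE hO).op f)] with t ht h W' hW'
  obtain ⟨f', hf'⟩ := ht h
  refine ⟨(Y.tw k' t).presheaf.map (homOfLE hW').op f', ?_⟩
  intro T y hy hy'
  have h1 := hy'.mono hW'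
  have h2 : Land y (Y.tp s ⁻¹ᵁ W) := by
    apply land_post
    exact Land.congr (Cocyc.land_pre h1) (by rw [Category.assoc, tp_tt])
  rw [ev_res _ _ _ h1, ← hf' y h2, ev_res _ _ _ hy]

theorem SchemeOver.tw_desc {G : GroupSchemeOver k} {X : SchemeOver k} {α : ActionOver G X}
    [CompactSpace X.carrier] [QuasiSeparatedSpace X.carrier]
    [CompactSpace (gx G.toSchemeOver X).carrier] [QuasiSeparatedSpace (gx G.toSchemeOver X).carrier]
    {C : Cocyc (X.twi k')} (hC : C.Ample) (hV : ∀ i, IsAffineOpen (C.V i)) (l : Lin (α.bc (twri k k')) C) :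
    ∃ (t : Finset k') (C' : Cocyc (X.tw k' t)), C'.Ample ∧ Nonempty (Lin (α.bc (twr k k' t)) C') := by
  have := C.fin
  have := hC.1
  choose m hm s U hU hxU hsU using hC.2.2
  obtain ⟨A, hA⟩ := isCompact_univ.elim_finite_subcover (fun x => (U x : Set (X.twi k')))
    (fun x => (U x).2) (fun x _ => Set.mem_iUnion.mpr ⟨x, hxU x⟩)
  obtain ⟨s₀, V, hVc, hVp⟩ := X.tw_open C.V (fun i => (hV i).isCompact)
  have q1 : QuasiSeparatedSpace (X.tw k' s₀) := X.bc_qs _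
  have q2 : QuasiSeparatedSpace ((gx G.toSchemeOver X).tw k' s₀) := (gx G.toSchemeOver X).bc_qs _
  have q3 : CompactSpace ((gx G.toSchemeOver X).tw k' s₀) := (gx G.toSchemeOver X).bc_compact _
  have q4 : ∀ (f : (gx G.toSchemeOver X).tw k' s₀ ⟶ X.tw k' s₀) i, IsCompact ((f ⁻¹ᵁ V i : ((gx G.toSchemeOver X).tw k' s₀).Opens) : Set ((gx G.toSchemeOver X).tw k' s₀)) := by
    intro f i
    have : QuasiCompact f := inferInstance
    exact QuasiCompact.isCompact_preimage _ (V i).2 (hVc i)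
  have q5 : ∀ i j, IsCompact ((V i ⊓ V j : (X.tw k' s₀).Opens) : Set (X.tw k' s₀)) := fun i j =>
    QuasiSeparatedSpace.inter_isCompact _ _ (V i).2 (hVc i) (V j).2 (hVc j)
  let W (i j : C.J) : ((gx G.toSchemeOver X).tw k' s₀).Opens := qx _ _ _ ⁻¹ᵁ V i ⊓ qa α _ ⁻¹ᵁ V j
  have q6 : ∀ i j, IsCompact (W i j : Set ((gx G.toSchemeOver X).tw k' s₀)) := fun i j =>
    QuasiSeparatedSpace.inter_isCompact _ _ (qx _ _ _ ⁻¹ᵁ V i).2 (q4 _ i) (qa α _ ⁻¹ᵁ V j).2 (q4 _ j)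
  have E0 := X.tw_top (⨆ i, V i) (by
    rw [Scheme.Hom.preimage_iSup]
    simp only [hVp]
    exact eq_top_iff.mpr fun x _ => TopologicalSpace.Opens.mem_iSup.mpr (C.cov x))
  have E1 := eventually_all.mpr fun i => eventually_all.mpr fun j => X.tw_fun' (V i ⊓ V j) (q5 i j) (C.g i j) 
    (by rw [← hVp i, ← hVp j]; exact le_rfl)
  have E2 := eventually_all.mpr fun a : A => eventually_all.mpr fun i => X.tw_fun' (V i) (hVc i) ((s a).σ i) (hVp i).le
  choose fu hfu using fun i j => l.exists_u i j
  have E3 := eventually_all.mpr fun i => eventually_all.mpr fun j => (gx G.toSchemeOver X).tw_fun' (W i j) (q6 i j) (fu i j) (by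
    rw [← hVp i, ← hVp j, ← Scheme.Hom.comp_preimage (qx _ _ _), ← Scheme.Hom.comp_preimage (qa _ _)]
    rw [← bm_qa, ← bm_qx]
    exact le_rfl)
  obtain ⟨t, h0t, e0, e1, e2, e3⟩ := ((eventually_ge_atTop s₀).and (E0.and (E1.and (E2.and E3)))).exists
  replace e0 := e0 h0t
  let V' (i : C.J) : (X.tw k' t).Opens := X.tt h0t ⁻¹ᵁ V i
  choose g' hg' using fun i j => e1 i j h0t (V' i ⊓ V' j) le_rfl
  choose σ' hσ' using fun a i => e2 a i h0t (V' i) le_rfl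
  choose u' hu' using fun i j => e3 i j h0t (qx _ _ _ ⁻¹ᵁ V' i ⊓ qa α _ ⁻¹ᵁ V' j) (by
    rw [← Scheme.Hom.comp_preimage (qx _ _ _), ← Scheme.Hom.comp_preimage (qa _ _)]
    rw [← bm_qa, ← bm_qx]
    exact le_rfl)
  have hV' : ∀ i, X.tp t ⁻¹ᵁ V' i = C.V i := by
    intro i
    exact (pre_comp_eq (X.tp_tt h0t) (V i)).trans (hVp i)
  have hVL : ∀ i {T : Scheme.{u}} (y : T ⟶ X.twi k'), Land (y ≫ X.tp t) (V' i) → Land y (C.V i) := by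
    intro i T y h
    exact (land_post h).mono (hV' i).le
  have cov' : ∀ x, ∃ i, x ∈ V' i := by
    intro x
    exact cov_of_top _ _ e0 x
  let C₁ := C.desc (twπ k k' t) (twπ_r k k' t) V' cov' hVL g' hg'
  have l₁ : Lin (α.bc (twr k k' t)) C₁ := l.desc (twπ k k' t) (twπ_r k k' t) α V' cov' hVL g' hg' u' (by
    intro i j T g x h hi hj h' hl
    have k1 := pt_bm (twπ k k' t) (twπ_r k k' t) g x h h'
    rw [hfu i j g x h hi hj (land_pt α hi hj), hu' i j _ _ (Land.congr hl k1.symm)]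
    exact ev_congr rfl k1 _ _)
  let s₁ (a : A) : C₁.HS (m a) := Cocyc.HS.desc (twπ k k' t) (twπ_r k k' t) C V' cov' hVL g' hg' (s a) (σ' a) (hσ' a)
  let U₁ (a : A) : (X.tw k' t).Opens := ⨆ i, (X.tw k' t).basicOpen (σ' a i)
  have hU₁ : ∀ a : A, X.tp t ⁻¹ᵁ U₁ a = U a := by
    intro a
    rw [Scheme.Hom.preimage_iSup, (hsU a).eq]
    exact iSup_congr fun i => basicOpen_eq_of_ev _ _ _ (hV' i) (hσ' a i)
  have hU₁c : ∀ a : A, IsCompact (U₁ a : Set (X.tw k' t)) := by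
    intro a
    rw [TopologicalSpace.Opens.coe_iSup]
    refine isCompact_iUnion fun i => isCompact_basicOpen _ ?_ _
    exact QuasiCompact.isCompact_preimage _ (V i).2 (hVc i)
  have F1 := eventually_all.mpr fun a : A => X.tw_aff (U₁ a) (hU₁c a) (by rw [hU₁ a]; exact hU a)
  have F2 := X.tw_top (⨆ a, U₁ a) (by
    rw [Scheme.Hom.preimage_iSup]
    simp only [hU₁]
    refine eq_top_iff.mpr fun x _ => TopologicalSpace.Opens.mem_iSup.mpr ?_
    have := hA (Set.mem_univ x)
    simp only [Set.mem_iUnion] at this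
    obtain ⟨a, ha, hx⟩ := this
    exact ⟨⟨a, ha⟩, hx⟩)
  obtain ⟨t', htt, f1, f2⟩ := ((eventually_ge_atTop t).and (F1.and F2)).exists
  refine ⟨t', C₁.pull (X.tt htt), ⟨X.bc_compact _, X.bc_qs _, fun x => ?_⟩, ⟨l₁.bm _ _⟩⟩
  replace f2 := f2 htt
  rw [Scheme.Hom.preimage_iSup] at f2
  obtain ⟨a, ha⟩ := TopologicalSpace.Opens.mem_iSup.mp (f2.ge trivial : x ∈ _)
  exact ⟨m a, hm a, (s₁ a).pull _, X.tt htt ⁻¹ᵁ U₁ a, f1 a htt, ha, (s₁ a).nv.pull _⟩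
end towerdesc

/-! ### Descent to a finite extension -/
section startconv
open SchemeOver

theorem GroupSchemeOver.idem (G : GroupSchemeOver k) {T : Scheme.{u}} (a : T ⟶ G.carrier) (h) (e : G.mul a a h = a) :
    a = a ≫ G.str ≫ G.one := by
  have h1 : (a ≫ G.str ≫ G.one) ≫ G.str = a ≫ G.str := by simp [G.one_str]
  have h2 : G.inv a ≫ G.str = a ≫ G.str := G.inv_str a
  have h3 := G.inv_mul a h2
  have h4 := G.one_mul a h1
  have h5 : G.mul (G.inv a) a h2 ≫ G.str = a ≫ G.str := by rw [G.mul_str, h2]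
  have h6 : G.inv a ≫ G.str = G.mul a a h ≫ G.str := by rw [e, h2]
  have h7 := G.mul_assoc (G.inv a) a a h2 h5 h h6
  rw [G.mul_congr h3 rfl h5 h1, h4, G.mul_congr rfl e h6 h2, h3] at h7
  exact h7

variable {k' : Type u} [Field k'] {r : Spk k' ⟶ Spk k}
    {G : GroupSchemeOver k} {X : SchemeOver k} {α : ActionOver G X}
    {G' : GroupSchemeOver k'} {prG : G'.carrier ⟶ G.carrier}
    (hGpb : IsPullback prG G'.str G.str r)
    (hGmul : ∀ {T : Scheme.{u}} (a b : T ⟶ G'.carrier) (h h'),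
      G'.mul a b h ≫ prG = G.mul (a ≫ prG) (b ≫ prG) h')
    {X' : SchemeOver k'} {prX : X'.carrier ⟶ X.carrier}
    (hXpb : IsPullback prX X'.str X.str r)
    {α' : ActionOver G' X'}
    (hα : ∀ {T : Scheme.{u}} (g : T ⟶ G'.carrier) (x : T ⟶ X'.carrier) (h h'),
      α'.act g x h ≫ prX = α.act (g ≫ prG) (x ≫ prX) h')

theorem one_bc (w : prG ≫ G.str = G'.str ≫ r)
    (hGmul : ∀ {T : Scheme.{u}} (a b : T ⟶ G'.carrier) (h h'),
      G'.mul a b h ≫ prG = G.mul (a ≫ prG) (b ≫ prG) h') :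
    G'.one ≫ prG = r ≫ G.one := by
  have h1 : (G'.one ≫ G'.str ≫ G'.one) ≫ G'.str = G'.one ≫ G'.str := by simp [G'.one_str]
  have h2 := G'.one_mul G'.one h1
  have h3 : G'.mul G'.one G'.one rfl = G'.one := by
    refine (G'.mul_congr ?_ rfl _ _).trans h2
    rw [← Category.assoc, G'.one_str, Category.id_comp]
  have h4 := hGmul G'.one G'.one rfl rfl
  rw [h3] at h4
  have h5 := G.idem _ _ h4.symm
  rw [h5]
  simp only [Category.assoc]
  rw [reasc2 w, ← Category.assoc, G'.one_str, Category.id_comp]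

/-- comparison -/
def stE : (X.bc r).carrier ⟶ X'.carrier := hXpb.lift (X.p1 r) (X.p2 r) (X.bc_w r)
theorem stE_1 : stE hXpb ≫ prX = X.p1 r := hXpb.lift_fst _ _ _
theorem stE_2 : stE hXpb ≫ X'.str = X.p2 r := hXpb.lift_snd _ _ _
theorem stE_iso : IsIso (stE hXpb) := by
  refine ⟨X.bl r prX X'.str hXpb.w, ?_, ?_⟩
  · apply bc_ext
    · simp [stE_1]
    · simp [stE_2]
  · apply hXpb.hom_ext
    · simp [stE_1]
    · simp [stE_2]

/-- group points -/
def stG {T : Scheme.{u}} (g : T ⟶ G.carrier) (x : T ⟶ (X.bc r).carrier) (h : g ≫ G.str = x ≫ (X.bc r).str) :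
    T ⟶ G'.carrier := hGpb.lift g (x ≫ X.p2 r) (by rw [h, bc_str, bc_w, Category.assoc])

section
variable {T : Scheme.{u}} (g : T ⟶ G.carrier) (x : T ⟶ (X.bc r).carrier) (h : g ≫ G.str = x ≫ (X.bc r).str)
theorem stG_1 : stG hGpb g x h ≫ prG = g := hGpb.lift_fst _ _ _
theorem stG_2 : stG hGpb g x h ≫ G'.str = x ≫ X.p2 r := hGpb.lift_snd _ _ _
theorem stG_e : stG hGpb g x h ≫ G'.str = (x ≫ stE hXpb) ≫ X'.str := by
  rw [stG_2, Category.assoc, stE_2]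
theorem st_act (hα : ∀ {T : Scheme.{u}} (g : T ⟶ G'.carrier) (x : T ⟶ X'.carrier) (h h'),
      α'.act g x h ≫ prX = α.act (g ≫ prG) (x ≫ prX) h') : (α.bc r).act g x h ≫ stE hXpb = α'.act (stG hGpb g x h) (x ≫ stE hXpb) (stG_e hGpb hXpb g x h) := by
  have h1 : (stG hGpb g x h ≫ prG) ≫ G.str = ((x ≫ stE hXpb) ≫ prX) ≫ X.str := by
    rw [stG_1, h, Category.assoc _ _ prX, stE_1, Category.assoc, bc_str]
  have h2 : g ≫ G.str = (x ≫ X.p1 r) ≫ X.str := by rw [h, Category.assoc, bc_str]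
  apply hXpb.hom_ext
  · rw [hα _ _ _ h1, Category.assoc, stE_1, α.bc_p1 r g x h h2]
    exact α.act_congr (stG_1 _ _ _ _).symm (by rw [Category.assoc, stE_1]) _ _
  · rw [Category.assoc, stE_2, α'.act_str, α.bc_p2, Category.assoc, stE_2]
end

/-- start -/
theorem Lin.start (hGpb : IsPullback prG G'.str G.str r) {C : Cocyc X'.carrier} (l : Lin α' C) (hGmul : ∀ {T : Scheme.{u}} (a b : T ⟶ G'.carrier) (h h'),
      G'.mul a b h ≫ prG = G.mul (a ≫ prG) (b ≫ prG) h') (hα : ∀ {T : Scheme.{u}} (g : T ⟶ G'.carrier) (x : T ⟶ X'.carrier) (h h'),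
      α'.act g x h ≫ prX = α.act (g ≫ prG) (x ≫ prX) h') : Nonempty (Lin (α.bc r) (C.pull (stE hXpb))) := by
  have hGone := one_bc hGpb.w hGmul
  have land : ∀ {j : C.J} {T : Scheme.{u}} {g : T ⟶ G.carrier} {x : T ⟶ (X.bc r).carrier} 
    {h : g ≫ G.str = x ≫ (X.bc r).str}, Land ((α.bc r).act g x h) (stE hXpb ⁻¹ᵁ C.V j) →
      Land (α'.act (stG hGpb g x h) (x ≫ stE hXpb) (stG_e hGpb hXpb g x h)) (C.V j) := by
    intro j T g x h hj
    exact (Cocyc.land_pre hj).congr (st_act hGpb hXpb g x h hα)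
  have gc : ∀ {T : Scheme.{u}} {g g' : T ⟶ G.carrier} {x x' : T ⟶ (X.bc r).carrier} (h h') (e : g = g') (e' : x ≫ X.p2 r = x' ≫ X.p2 r),
      stG hGpb g x h = stG hGpb g' x' h' := by
    intro T g g' x x' h h' e e'
    apply hGpb.hom_ext
    · rw [stG_1, stG_1, e]
    · rw [stG_2, stG_2, e']
  refine ⟨⟨fun i j T g x h hi hj => l.u i j (stG hGpb g x h) (x ≫ stE hXpb) (stG_e hGpb hXpb g x h) (Cocyc.land_pre hi) (land hj), ?_, ?_, ?_⟩⟩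
  · intro i j T T' t g x h hi hj h' hi' hj'
    have k1 : t ≫ stG hGpb g x h = stG hGpb (t ≫ g) (t ≫ x) h' := by
      apply hGpb.hom_ext
      · simp only [Category.assoc, stG_1]
      · simp only [Category.assoc, stG_2]
    have k2 : (t ≫ stG hGpb g x h) ≫ G'.str = (t ≫ x ≫ stE hXpb) ≫ X'.str := by
      rw [Category.assoc, stG_e hGpb hXpb]; simp only [Category.assoc]
    rw [← l.u_nat i j t _ _ _ _ _ k2 ((Cocyc.land_pre hi).comp t) (((land hj).comp t).congr (α'.act_natural _ _ _ _ _))]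
    exact l.u_congr _ _ k1.symm (Category.assoc _ _ _) _ _ _ _ _ _
  · intro i j T x h hi hj hij
    have k1 : ((x ≫ stE hXpb) ≫ X'.str ≫ G'.one) ≫ G'.str = (x ≫ stE hXpb) ≫ X'.str := by simp [G'.one_str]
    have k3 : stG hGpb (x ≫ (X.bc r).str ≫ G.one) x h = (x ≫ stE hXpb) ≫ X'.str ≫ G'.one := by
      apply hGpb.hom_ext
      · rw [stG_1]; simp only [Category.assoc, hGone]; rw [reasc (stE_2 hXpb), bc_str, bc_w, Category.assoc]
      · rw [stG_2]; simp only [Category.assoc, G'.one_str, Category.comp_id, stE_2]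
    rw [C.pull_g (stE hXpb) i j x hij (Cocyc.land_pre2 hij), ← l.u_one i j (x ≫ stE hXpb) k1 (Cocyc.land_pre hi)
      ((Cocyc.land_pre2 hij).right.congr (α'.one_act _ _).symm)]
    exact l.u_congr _ _ k3 rfl _ _ _ _ _ _
  · intro i j m T g g' x h₁ h₂ h₃ h₄ hi hj hl hl'
    have e0 := st_act hGpb hXpb g' x h₃ hα
    have e2 := stG_e hGpb hXpb g' x h₃
    have h₅ : g ≫ G.str = x ≫ (X.bc r).str := by rw [h₁, h₃]
    have e1 : stG hGpb g x h₅ ≫ G'.str = stG hGpb g' x h₃ ≫ G'.str := by rw [stG_2, stG_2]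
    have e3 : stG hGpb g x h₅ ≫ G'.str = α'.act (stG hGpb g' x h₃) (x ≫ stE hXpb) e2 ≫ X'.str := by
      rw [α'.act_str, e1, e2]
    have e4 : G'.mul (stG hGpb g x h₅) (stG hGpb g' x h₃) e1 ≫ G'.str = (x ≫ stE hXpb) ≫ X'.str := by
      rw [G'.mul_str, e1, e2]
    have e5 : stG hGpb g _ h₄ = stG hGpb g x h₅ := gc _ _ rfl (α.bc_p2 _ _ _ _)
    have e6 : stG hGpb (G.mul g g' h₁) x h₂ = G'.mul (stG hGpb g x h₅) (stG hGpb g' x h₃) e1 := by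
      apply hGpb.hom_ext
      · rw [hGmul _ _ _ (by rw [stG_1, stG_1, h₁]), stG_1]
        exact G.mul_congr (stG_1 _ _ _ _).symm (stG_1 _ _ _ _).symm _ _
      · rw [G'.mul_str, stG_2, stG_2]
    have e7 : α'.act (stG hGpb g _ h₄) ((α.bc r).act g' x h₃ ≫ stE hXpb) (stG_e hGpb hXpb _ _ h₄) =
      α'.act (stG hGpb g x h₅) (α'.act (stG hGpb g' x h₃) (x ≫ stE hXpb) e2) e3 := α'.act_congr e5 e0 _ _
    have := l.u_mul i j m (stG hGpb g x h₅) (stG hGpb g' x h₃) (x ≫ stE hXpb) e1 e4 e2 e3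
        (Cocyc.land_pre hi) (land hj) (((land hl').congr e7).congr (α'.mul_act _ _ _ _ _ _ _).symm) ((land hl').congr e7)
    refine Eq.trans ?_ (this.trans ?_)
    · exact l.u_congr _ _ e6 rfl _ _ _ _ _ _
    · congr 1
      exact l.u_congr _ _ e5.symm e0.symm _ _ _ _ _ _
end startconv

section partDsec
open SchemeOver

theorem qcqs_of_surj {X Y : Scheme.{u}} (p : Y ⟶ X) [Surjective p] [QuasiCompact p] [CompactSpace Y] [QuasiSeparatedSpace Y] :
    CompactSpace X ∧ QuasiSeparatedSpace X := by
  have hs : Function.Surjective p := p.surjective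
  refine ⟨hs.compactSpace p.continuous, ⟨?_⟩⟩
  intro U V hU hU' hV hV'
  have h1 := QuasiSeparatedSpace.inter_isCompact _ _ (hU.preimage p.continuous) (p.isCompact_preimage (U := ⟨U, hU⟩) hU')
    (hV.preimage p.continuous) (p.isCompact_preimage (U := ⟨V, hV⟩) hV')
  have h2 := h1.image p.continuous
  rwa [← Set.preimage_inter, Set.image_preimage_eq _ hs] at h2

theorem gx_qcqs {G : GroupSchemeOver k} (hG : G.IsAlgebraic) (X : SchemeOver k) [CompactSpace X.carrier] [QuasiSeparatedSpace X.carrier] :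
    CompactSpace (gx G.toSchemeOver X).carrier ∧ QuasiSeparatedSpace (gx G.toSchemeOver X).carrier := by
  obtain ⟨h1, h2⟩ := hG
  have : IsLocallyNoetherian G.carrier := LocallyOfFiniteType.isLocallyNoetherian G.str
  have : QuasiSeparatedSpace G.carrier := inferInstance
  have : QuasiSeparated G.str := inferInstance
  have a1 : QuasiCompact (gx2 G.toSchemeOver X) := MorphismProperty.of_isPullback (P := @QuasiCompact) gx_pb inferInstance
  have a2 : QuasiSeparated (gx2 G.toSchemeOver X) := MorphismProperty.of_isPullback (P := @QuasiSeparated) gx_pb inferInstance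
  exact ⟨QuasiCompact.compactSpace_of_compactSpace (gx2 G.toSchemeOver X), quasiSeparatedSpace_of_quasiSeparated (gx2 G.toSchemeOver X)⟩

theorem surj_spk {k' : Type u} [Field k'] (r : Spk k' ⟶ Spk k) : Surjective r := by
  refine ⟨fun x => ⟨Classical.arbitrary _, Subsingleton.elim (α := PrimeSpectrum k) _ _⟩⟩

theorem SchemeOver.p1_surj {k' : Type u} [Field k'] (r : Spk k' ⟶ Spk k) (X : SchemeOver k) : Surjective (X.p1 r) :=
  MorphismProperty.of_isPullback (P := @Surjective) (X.bc_pb r).flip (surj_spk r)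

theorem isAffineHom_spec_map {A B : CommRingCat.{u}} (f : A ⟶ B) : IsAffineHom (Spec.map f) := inferInstance

theorem partD {k' : Type u} [Field k'] [Algebra k k']
    {G : GroupSchemeOver k} (hG : G.IsAlgebraic) {X : SchemeOver k} {α : ActionOver G X}
    {C : Cocyc (X.twi k')} (hC : C.Ample) (l : Lin (α.bc (twri k k')) C) :
    ∃ (K : Type u) (_ : Field K) (_ : Algebra k K) (_ : Module.Finite k K) (C' : Cocyc (X.twi K)),
      C'.Ample ∧ Nonempty (Lin (α.bc (twri k K)) C') := by
  have a1 := hC.1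
  have a2 := hC.2.1
  have := X.p1_surj (twri k k')
  have := X.p1_affine (twri k k')
  obtain ⟨b1, b2⟩ := qcqs_of_surj (X.p1 (twri k k'))
  obtain ⟨b3, b4⟩ := gx_qcqs hG X
  obtain ⟨C₁, hC₁, ⟨l₁⟩, hV⟩ := exists_refine hC l
  obtain ⟨t, C₂, hC₂, ⟨l₂⟩⟩ := SchemeOver.tw_desc hC₁ hV l₁
  obtain ⟨M, hM⟩ := Ideal.exists_maximal (TwA k k' t)
  let K := TwA k k' t ⧸ M
  let _ : Field K := Ideal.Quotient.field M
  have f1 : Algebra.FiniteType k (TwA k k' t) := Subalgebra.fg_iff_finiteType _ |>.mp ⟨t, rfl⟩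
  have f2 : Algebra.FiniteType k K := inferInstance
  have f3 : Module.Finite k K := finite_of_finite_type_of_isJacobsonRing k K
  let τ : Spk K ⟶ TwS k k' t := Spec.map (CommRingCat.ofHom (Ideal.Quotient.mk M))
  have hτ : τ ≫ twr k k' t = twri k K := by
    show Spec.map _ ≫ Spec.map _ = Spec.map _
    rw [← Spec.map_comp, ← CommRingCat.ofHom_comp]
  have : IsAffineHom τ := isAffineHom_spec_map _
  have := X.bm_affine τ hτ
  exact ⟨K, _, inferInstance, f3, C₂.pull (X.bm τ hτ), hC₂.pull _, ⟨l₂.bm τ hτ⟩⟩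
end partDsec

/-! ### Many sections of ample cocycles -/
section extend
variable {X : Scheme.{u}}

theorem mem_ev {T : Scheme.{u}} {U : X.Opens} (f : Γ(X, U)) (x : T ⟶ X) (h) (z : T) :
    z ∈ T.basicOpen (ev f x h) ↔ x z ∈ X.basicOpen f := by
  rw [ev_basicOpen]; rfl

/-- restriction -/
def rs {U V : X.Opens} (h : V ≤ U) (f : Γ(X, U)) : Γ(X, V) := X.presheaf.map (homOfLE h).op f
theorem ev_rs {U V : X.Opens} (i : V ≤ U) (f : Γ(X, U)) {T : Scheme.{u}} (x : T ⟶ X) (h : Land x V) :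
    ev (rs i f) x h = ev f x (h.mono i) := ev_res _ _ _ _

theorem ext_A {V U₀ : X.Opens} (hV : IsAffineOpen V) (τ : Γ(X, V)) (f : Γ(X, U₀)) (hle : X.basicOpen τ ≤ U₀) :
    ∃ n : ℕ, ∀ N, n ≤ N → ∃ y : Γ(X, V), ∀ {T : Scheme.{u}} (x : T ⟶ X) (h : Land x V) (hD : Land x (X.basicOpen τ)) (h0 : Land x U₀),
      ev y x h = ev τ x h ^ N * ev f x h0 := by
  obtain ⟨n, y, hy⟩ := exists_eq_pow_mul_of_isCompact_of_isQuasiSeparated X V hV.isCompact hV.isQuasiSeparated τ (rs hle f)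
  refine ⟨n, fun N hN => ⟨τ ^ (N - n) * y, ?_⟩⟩
  intro T x h hD h0
  have e1 : rs (X.basicOpen_le τ) y = rs (X.basicOpen_le τ) τ ^ n * rs hle f := hy
  have e2 := congrArg (fun a => ev a x hD) e1
  simp only [ev_mul, ev_pow, ev_rs] at e2
  rw [ev_mul, ev_pow, e2, ← mul_assoc, ← pow_add, Nat.sub_add_cancel hN]

theorem ext_B {O : X.Opens} (hO : IsCompact (O : Set X)) (τ a b : Γ(X, O))
    (H : ev a (X.basicOpen τ).ι ((Land.ι _).mono (X.basicOpen_le τ)) = ev b (X.basicOpen τ).ι ((Land.ι _).mono (X.basicOpen_le τ))) :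
    ∃ n : ℕ, ∀ N, n ≤ N → τ ^ N * a = τ ^ N * b := by
  have h1 : rs (X.basicOpen_le τ) a = rs (X.basicOpen_le τ) b := by
    apply ev_ext
    rw [ev_rs, ev_rs, H]
  obtain ⟨n, hn⟩ := exists_pow_mul_eq_zero_of_res_basicOpen_eq_zero_of_isCompact X hO (a - b) τ (by
    show rs (X.basicOpen_le τ) (a - b) = 0
    have : rs (X.basicOpen_le τ) (a - b) = rs (X.basicOpen_le τ) a - rs (X.basicOpen_le τ) b := map_sub _ _ _
    rw [this, h1, sub_self])
  refine ⟨n, fun N hN => ?_⟩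
  rw [← sub_eq_zero, ← mul_sub, ← Nat.sub_add_cancel hN, pow_add, mul_assoc, hn, mul_zero]

namespace Cocyc
variable {C : Cocyc X}

/-- product of sections -/
abbrev HS.mul {m n : ℕ} (s : C.HS m) (t : C.HS n) : C.HS (m + n) where
  σ i := s.σ i * t.σ i
  hom i j T x hi hj hij := by
    rw [ev_mul, ev_mul, s.hom i j x hi hj hij, t.hom i j x hi hj hij, pow_add]; ring

/-- power of sections -/
abbrev HS.pow {m : ℕ} (s : C.HS m) (n : ℕ) : C.HS (m * n) where
  σ i := s.σ i ^ n
  hom i j T x hi hj hij := by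
    rw [ev_pow, ev_pow, s.hom i j x hi hj hij, pow_mul]; ring

/-- sum of sections -/
abbrev HS.sum {m : ℕ} {ι : Type*} (A : Finset ι) (s : ι → C.HS m) : C.HS m where
  σ i := ∑ a ∈ A, (s a).σ i
  hom i j T x hi hj hij := by
    rw [ev_sum, ev_sum, Finset.mul_sum]
    exact Finset.sum_congr rfl fun a _ => (s a).hom i j x hi hj hij

/-- change of degree -/
abbrev HS.cast {m n : ℕ} (h : m = n) (s : C.HS m) : C.HS n where
  σ i := s.σ i
  hom i j T x hi hj hij := by
    rw [← h]; exact s.hom i j x hi hj hij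

/-- nonvanishing locus -/
def HS.nz {m : ℕ} (s : C.HS m) : X.Opens := ⨆ i, X.basicOpen (s.σ i)

theorem HS.mem_nz {m : ℕ} (s : C.HS m) {i : C.J} {x : X} (h : x ∈ C.V i) : x ∈ s.nz ↔ x ∈ X.basicOpen (s.σ i) := by
  have := s.nv i
  constructor
  · intro h'
    have h2 : x ∈ C.V i ⊓ ⨆ i, X.basicOpen (s.σ i) := ⟨h, h'⟩
    rwa [this] at h2
  · intro h'
    rw [← this] at h'
    exact h'.2

theorem HS.pow_nz {m : ℕ} (s : C.HS m) {n : ℕ} (hn : 0 < n) : (s.pow n).nz = s.nz := by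
  unfold HS.nz
  exact iSup_congr fun i => Scheme.basicOpen_pow _ _ hn

theorem ext_sec [QuasiSeparatedSpace X] (hV : ∀ i, IsAffineOpen (C.V i)) {m : ℕ} (τ : C.HS m) {f : Γ(X, τ.nz)} :
    ∃ (n : ℕ) (s : C.HS (m * n)), s.nz ⊓ τ.nz = X.basicOpen f := by
  have := C.fin
  have hle : ∀ i, X.basicOpen (τ.σ i) ≤ τ.nz := le_iSup (fun i => X.basicOpen (τ.σ i))
  choose n hn using fun i => ext_A (hV i) (τ.σ i) f (hle i)
  obtain ⟨N, hN⟩ := Finite.bddAbove_range n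
  choose y hy using fun i => hn i N (hN ⟨i, rfl⟩)
  have hB : ∀ i j, ∃ n : ℕ, ∀ N', n ≤ N' → (rs inf_le_right (τ.σ j) : Γ(X, C.V i ⊓ C.V j)) ^ N' * rs inf_le_right (y j) =
      (rs inf_le_right (τ.σ j)) ^ N' * (C.g i j ^ (m * N) * rs inf_le_left (y i)) := by
    intro i j
    apply ext_B
    · exact QuasiSeparatedSpace.inter_isCompact _ _ (C.V i).2 (hV i).isCompact (C.V j).2 (hV j).isCompact
    · set D := X.basicOpen (rs inf_le_right (τ.σ j) : Γ(X, C.V i ⊓ C.V j)) with hD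
      have l0 : Land D.ι (C.V i ⊓ C.V j) := (Land.ι _).mono (X.basicOpen_le _)
      have hd : D = (C.V i ⊓ C.V j) ⊓ X.basicOpen (τ.σ j) := Scheme.basicOpen_res _ _ _
      have l2 : Land D.ι (X.basicOpen (τ.σ j)) := (Land.ι D).mono (hd.le.trans inf_le_right)
      have l3 : Land D.ι τ.nz := l2.mono (hle j)
      have l4 : Land D.ι (X.basicOpen (τ.σ i)) := Land.iff.mpr fun t =>
        (τ.mem_nz (Land.iff.mp l0.left t)).mp (Land.iff.mp l3 t)
      rw [ev_mul, ev_pow, ev_rs, ev_rs, hy j _ l0.right l2 l3, hy i _ l0.left l4 l3, τ.hom i j D.ι l0.left l0.right l0]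
      ring
  choose n' hn' using hB
  obtain ⟨M, hM⟩ := Finite.bddAbove_range (fun q : C.J × C.J => n' q.1 q.2)
  have hM' : ∀ i j, n' i j ≤ M := fun i j => hM ⟨(i, j), rfl⟩
  refine ⟨N + M, ⟨fun i => y i * τ.σ i ^ M, ?_⟩, ?_⟩
  · intro i j T x hi hj hij
    have e := congrArg (fun a => ev a x hij) (hn' i j M (hM' i j))
    simp only [ev_mul, ev_pow, ev_rs] at e
    rw [ev_mul, ev_mul, ev_pow, ev_pow, mul_comm, e, τ.hom i j x hi hj hij]
    ring
  · ext z
    obtain ⟨i, hi⟩ := C.cov z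
    by_cases hz : z ∈ τ.nz
    swap
    · exact ⟨fun h => absurd h.2 hz, fun h => absurd (X.basicOpen_le _ h) hz⟩
    have hz' := (τ.mem_nz hi).mp hz
    have l1 := (Land.ι (X.basicOpen (τ.σ i)))
    have l2 : Land (X.basicOpen (τ.σ i)).ι (C.V i) := l1.mono (X.basicOpen_le _)
    have e := hy i (X.basicOpen (τ.σ i)).ι l2 l1 (l1.mono (hle i))
    have k0 := mem_ev (τ.σ i) (X.basicOpen (τ.σ i)).ι l2 ⟨z, hz'⟩
    have k1 := mem_ev (y i) (X.basicOpen (τ.σ i)).ι l2 ⟨z, hz'⟩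
    have k2 := mem_ev f (X.basicOpen (τ.σ i)).ι (l1.mono (hle i)) ⟨z, hz'⟩
    have k3 : ∀ n : ℕ, (⟨z, hz'⟩ : (X.basicOpen (τ.σ i)).toScheme) ∈ (X.basicOpen (τ.σ i)).toScheme.basicOpen (ev (τ.σ i) (X.basicOpen (τ.σ i)).ι l2 ^ n) := by
      intro n
      induction n with
      | zero => rw [pow_zero, Scheme.basicOpen_of_isUnit _ isUnit_one]; trivial
      | succ n ih => rw [pow_succ, Scheme.basicOpen_mul]; exact ⟨ih, k0.mpr hz'⟩
    have k4 : z ∈ X.basicOpen (τ.σ i ^ M) := by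
      have := mem_ev (τ.σ i ^ M) (X.basicOpen (τ.σ i)).ι l2 ⟨z, hz'⟩
      rw [ev_pow] at this
      exact this.mp (k3 M)
    rw [e, Scheme.basicOpen_mul] at k1
    have k5 : z ∈ X.basicOpen (y i) ↔ z ∈ X.basicOpen f := 
      ⟨fun h => k2.mp (k1.mpr h).2, fun h => k1.mp ⟨k3 N, k2.mpr h⟩⟩
    refine Iff.trans (and_congr_left fun _ => HS.mem_nz _ hi) ?_
    refine Iff.trans ?_ k5
    simp only [Scheme.basicOpen_mul]
    exact ⟨fun h => h.1.1, fun h => ⟨⟨h, k4⟩, hz⟩⟩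

theorem HS.mul_nz {m n : ℕ} (s : C.HS m) (t : C.HS n) : (s.mul t).nz = s.nz ⊓ t.nz := by
  ext z
  obtain ⟨i, hi⟩ := C.cov z
  refine Iff.trans (HS.mem_nz _ hi) (Iff.trans ?_ (and_congr (HS.mem_nz s hi) (HS.mem_nz t hi)).symm)
  have : X.basicOpen ((s.mul t).σ i) = X.basicOpen (s.σ i) ⊓ X.basicOpen (t.σ i) := Scheme.basicOpen_mul _ _ _
  rw [this]; rfl

/-- sections separate a point from a closed set -/
theorem Ample.exists_sec (hC : C.Ample) (hV : ∀ i, IsAffineOpen (C.V i)) (x : X) (O : X.Opens) (hx : x ∈ O) :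
    ∃ m, 0 < m ∧ ∃ s : C.HS m, x ∈ s.nz ∧ s.nz ≤ O := by
  obtain ⟨h1, h2, h3⟩ := hC
  obtain ⟨m, hm, τ, U, hU, hxU, hτ⟩ := h3 x
  obtain rfl : U = τ.nz := hτ.eq
  obtain ⟨f, hf, hxf⟩ := hU.exists_basicOpen_le ⟨x, hx⟩ hxU
  obtain ⟨n, s, hs⟩ := ext_sec hV τ (f := f)
  refine ⟨m * n + m, by omega, s.mul τ, ?_, ?_⟩
  · rw [HS.mul_nz, hs]; exact hxf
  · rw [HS.mul_nz, hs]; exact hf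

theorem mem_basicOpen_sum {ι : Type*} [DecidableEq ι] {U : X.Opens} (A : Finset ι) (f : ι → Γ(X, U)) (x : X) (a : ι) (ha : a ∈ A)
    (h : x ∈ X.basicOpen (f a)) (h' : ∀ b ∈ A, b ≠ a → x ∉ X.basicOpen (f b)) : x ∈ X.basicOpen (∑ b ∈ A, f b) := by
  have hx : x ∈ U := X.basicOpen_le _ h
  rw [X.mem_basicOpen _ _ hx] at h ⊢
  rw [map_sum, ← Finset.add_sum_erase _ _ ha]
  by_contra hc
  have k1 : ∑ b ∈ A.erase a, (X.presheaf.germ U x hx).hom (f b) ∈ IsLocalRing.maximalIdeal (X.presheaf.stalk x) := by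
    refine Ideal.sum_mem _ fun b hb => ?_
    obtain ⟨h1, h2⟩ := Finset.mem_erase.mp hb
    have := h' b h2 h1
    rwa [X.mem_basicOpen _ _ hx] at this
  have k2 := (IsLocalRing.mem_maximalIdeal _).mpr (mem_nonunits_iff.mpr hc)
  have k3 := (Ideal.add_mem_iff_left _ k1).mp k2
  exact k3 h

theorem mem_basicOpen_sum' {ι : Type*} {U : X.Opens} (A : Finset ι) (f : ι → Γ(X, U)) (x : X)
    (h : x ∈ X.basicOpen (∑ b ∈ A, f b)) : ∃ b ∈ A, x ∈ X.basicOpen (f b) := by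
  have hx : x ∈ U := X.basicOpen_le _ h
  rw [X.mem_basicOpen _ _ hx, map_sum] at h
  by_contra! hc
  refine (?_ : ¬ _) h
  refine (IsLocalRing.mem_maximalIdeal _).mp (Ideal.sum_mem _ fun b hb => ?_)
  have := hc b hb
  rwa [X.mem_basicOpen _ _ hx] at this

/-- sections for finite discrete sets -/
theorem Ample.exists_sec_finite (hC : C.Ample) (hV : ∀ i, IsAffineOpen (C.V i)) (F : Finset X) (W : X.Opens) (hF : ∀ x ∈ F, x ∈ W)
    (hd : ∀ x ∈ F, ∃ O : X.Opens, x ∈ O ∧ ∀ y ∈ F, y ∈ O → y = x) :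
    ∃ m, 0 < m ∧ ∃ s : C.HS m, (∀ x ∈ F, x ∈ s.nz) ∧ s.nz ≤ W := by
  classical
  choose O hxO hO using fun x : F => hd x x.2
  choose m hm s hxs hs using fun x : F => hC.exists_sec hV x (W ⊓ O x) ⟨hF x x.2, hxO x⟩
  let M := ∏ x, m x
  have hM : 0 < M := Finset.prod_pos fun x _ => hm x
  have hd : ∀ x, m x ∣ M := fun x => Finset.dvd_prod_of_mem _ (Finset.mem_univ _)
  have hp : ∀ x, 0 < M / m x := fun x => Nat.div_pos (Nat.le_of_dvd hM (hd x)) (hm x)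
  let t (x : F) : C.HS M := ((s x).pow (M / m x)).cast (Nat.mul_div_cancel' (hd x))
  have ht : ∀ x, (t x).nz = (s x).nz := fun x => (s x).pow_nz (hp x)
  refine ⟨M, hM, HS.sum Finset.univ t, ?_, ?_⟩
  · intro x hx
    obtain ⟨i, hi⟩ := C.cov x
    rw [HS.mem_nz _ hi]
    refine mem_basicOpen_sum _ _ _ ⟨x, hx⟩ (Finset.mem_univ _) ?_ ?_
    · rw [← HS.mem_nz _ hi, ht]; exact hxs ⟨x, hx⟩
    · intro b _ hb
      rw [← HS.mem_nz _ hi, ht]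
      intro h
      have := hO b x hx (hs b h).2
      exact hb (Subtype.ext this.symm)
  · intro z hz
    obtain ⟨i, hi⟩ := C.cov z
    rw [HS.mem_nz _ hi] at hz
    obtain ⟨b, _, hb⟩ := mem_basicOpen_sum' _ _ _ hz
    rw [← HS.mem_nz _ hi, ht] at hb
    exact (hs b hb).1
end Cocyc
end extend

/-! ### Norms along a finite field extension -/
section normring

theorem alg_norm_map {A B A' B' : Type u} [CommRing A] [CommRing B] [CommRing A'] [CommRing B'] [Algebra A B] [Algebra A' B']
    {ι : Type} [Fintype ι] (b : Module.Basis ι A B) (b' : Module.Basis ι A' B') (f : A →+* A') (g : B →+* B')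
    (hfg : ∀ a, g (algebraMap A B a) = algebraMap A' B' (f a)) (hb : ∀ i, g (b i) = b' i) (x : B) :
    f (Algebra.norm A x) = Algebra.norm A' (g x) := by
  classical
  have hr : ∀ y i, b'.repr (g y) i = f (b.repr y i) := by
    intro y i
    have : g y = ∑ i, f (b.repr y i) • b' i := by
      conv_lhs => rw [← b.sum_repr y]
      simp only [Algebra.smul_def, map_sum, map_mul, hfg, hb]
    rw [this, b'.repr_sum_self]
  rw [Algebra.norm_eq_matrix_det b, Algebra.norm_eq_matrix_det b', RingHom.map_det]
  congr 1
  ext i j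
  simp only [RingHom.mapMatrix_apply, Matrix.map_apply, Algebra.leftMulMatrix_eq_repr_mul]
  rw [← hr, map_mul, hb]

theorem isUnit_norm_iff' {A B : Type u} [CommRing A] [CommRing B] [Algebra A B]
    {ι : Type} [Fintype ι] (b : Module.Basis ι A B) (x : B) : IsUnit (Algebra.norm A x) ↔ IsUnit x := by
  refine ⟨fun h => ?_, fun h => h.map _⟩
  have := Module.Free.of_basis b
  have := Module.Finite.of_basis b
  rw [Algebra.norm_apply, ← LinearMap.isUnit_iff_isUnit_det, Module.End.isUnit_iff] at h
  obtain ⟨y, hy⟩ := h.2 1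
  exact IsUnit.of_mul_eq_one y hy

end normring

section normsch
variable {K : Type u} [Field K] [Algebra k K] {ι : Type} [Fintype ι] (b : Module.Basis ι k K)
variable {P T : Scheme.{u}}

/-- pullback of scalars -/
def qs (q : P ⟶ Spk K) (c : K) : Γ(P, ⊤) := q.appTop ((Scheme.ΓSpecIso (.of K)).inv c)

theorem qs_comp {P' : Scheme.{u}} (e : P' ⟶ P) (q : P ⟶ Spk K) (c : K) : qs (e ≫ q) c = e.appTop (qs q c) :=
  appTop_comp _ _ _

/-- linear combination -/
def lc (p : P ⟶ T) (q : P ⟶ Spk K) (a : ι → Γ(T, ⊤)) : Γ(P, ⊤) := ∑ i, p.appTop (a i) * qs q (b i)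

theorem lc_comp {P' T' : Scheme.{u}} (φ : P' ⟶ P) (τ : T' ⟶ T) (p : P ⟶ T) (q : P ⟶ Spk K) (p' : P' ⟶ T') (q' : P' ⟶ Spk K)
    (hp : φ ≫ p = p' ≫ τ) (hq : φ ≫ q = q') (a : ι → Γ(T, ⊤)) :
    φ.appTop (lc b p q a) = lc b p' q' (fun i => τ.appTop (a i)) := by
  simp only [lc, map_sum, map_mul, ← hq, qs_comp]
  refine Finset.sum_congr rfl fun i _ => ?_
  rw [← appTop_comp, hp, appTop_comp]

theorem appTop_inv {X Y : Scheme.{u}} (e : X ≅ Y) (f : Γ(X, ⊤)) : e.hom.appTop (e.inv.appTop f) = f := by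
  rw [← appTop_comp, e.hom_inv_id]; simp

theorem lc_bij_iso {P' T' : Scheme.{u}} (φ : P' ≅ P) (τ : T' ≅ T) (p : P ⟶ T) (q : P ⟶ Spk K) (p' : P' ⟶ T') (q' : P' ⟶ Spk K)
    (hp : φ.hom ≫ p = p' ≫ τ.hom) (hq : φ.hom ≫ q = q') (H : Function.Bijective (lc b p q)) :
    Function.Bijective (lc b p' q') := by
  have key : ∀ a, lc b p' q' a = φ.hom.appTop (lc b p q (fun i => τ.inv.appTop (a i))) := by
    intro a
    rw [lc_comp b φ.hom τ.hom p q p' q' hp hq]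
    congr 1
    ext i; rw [appTop_inv]
  constructor
  · intro a a' h
    rw [key, key] at h
    have h2 := congrArg φ.inv.appTop h
    have e5 := appTop_inv φ.symm
    simp only [Iso.symm_hom, Iso.symm_inv] at e5
    rw [e5, e5] at h2
    have h3 := H.1 h2
    ext i
    have h4 := congrArg τ.hom.appTop (congrFun h3 i)
    rwa [appTop_inv, appTop_inv] at h4
  · intro f
    obtain ⟨a, ha⟩ := H.2 (φ.inv.appTop f)
    refine ⟨fun i => τ.hom.appTop (a i), ?_⟩
    rw [key]
    have : (fun i => τ.inv.appTop (τ.hom.appTop (a i))) = a := by ext i; exact appTop_inv τ.symm _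
    rw [this, ha, appTop_inv]

open TensorProduct in
theorem lc_bij_spec (A : Type u) [CommRing A] [Algebra k A] :
    Function.Bijective (lc b (Spec.map (CommRingCat.ofHom (S := A ⊗[k] K) Algebra.TensorProduct.includeLeftRingHom))
      (Spec.map (CommRingCat.ofHom (S := A ⊗[k] K) (Algebra.TensorProduct.includeRight.toRingHom)))) := by
  let B := b.baseChange A
  let e : (ι → Γ(Spec (.of A), ⊤)) ≃ (ι → A) := Equiv.piCongrRight fun i => (Scheme.ΓSpecIso (.of A)).commRingCatIsoToRingEquiv.toEquiv
  let e' : (A ⊗[k] K) ≃ Γ(Spec (.of (A ⊗[k] K)), ⊤) := (Scheme.ΓSpecIso (.of (A ⊗[k] K))).commRingCatIsoToRingEquiv.symm.toEquiv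
  have : lc b (Spec.map (CommRingCat.ofHom (S := A ⊗[k] K) Algebra.TensorProduct.includeLeftRingHom))
      (Spec.map (CommRingCat.ofHom (S := A ⊗[k] K) (Algebra.TensorProduct.includeRight.toRingHom))) =
      e' ∘ B.equivFun.symm ∘ e := by
    ext a
    have : B.equivFun.symm (e a) = ∑ i, (e a i) ⊗ₜ (b i) := by
      rw [Module.Basis.equivFun_symm_apply]
      refine Finset.sum_congr rfl fun i _ => ?_
      rw [Module.Basis.baseChange_apply, TensorProduct.smul_tmul', smul_eq_mul, mul_one]
    simp only [Function.comp_apply, this]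
    show _ = (Scheme.ΓSpecIso (.of (A ⊗[k] K))).inv _
    rw [map_sum]
    unfold lc
    refine Finset.sum_congr rfl fun i _ => ?_
    have h1 : (e a i) ⊗ₜ[k] (b i) = (CommRingCat.ofHom (S := A ⊗[k] K) Algebra.TensorProduct.includeLeftRingHom (e a i) : A ⊗[k] K) * 
      (CommRingCat.ofHom (S := A ⊗[k] K) (Algebra.TensorProduct.includeRight.toRingHom) (b i)) := by
      simp
    rw [h1, map_mul]
    congr 1
    · have := congrArg (fun f => f.hom (e a i)) (Scheme.ΓSpecIso_inv_naturality (CommRingCat.ofHom (S := A ⊗[k] K) Algebra.TensorProduct.includeLeftRingHom))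
      refine Eq.trans ?_ this.symm
      have h3 : a i = (Scheme.ΓSpecIso (.of A)).inv (e a i) := 
        ((Scheme.ΓSpecIso (.of A)).commRingCatIsoToRingEquiv.symm_apply_apply _).symm
      conv_lhs => rw [h3]
      rfl
    · have := congrArg (fun f => f.hom (b i)) (Scheme.ΓSpecIso_inv_naturality (CommRingCat.ofHom (S := A ⊗[k] K) (Algebra.TensorProduct.includeRight.toRingHom)))
      exact this.symm
  rw [this]
  exact e'.bijective.comp (B.equivFun.symm.bijective.comp e.bijective)

theorem lc_bij_affine [IsAffine T] {p : P ⟶ T} {q : P ⟶ Spk K} {t : T ⟶ Spk k} (h : IsPullback p q t (twri k K)) :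
    Function.Bijective (lc b p q) := by
  let φ : CommRingCat.of k ⟶ Γ(T, ⊤) := Spec.preimage (T.isoSpec.inv ≫ t)
  let _ : Algebra k Γ(T, ⊤) := φ.hom.toAlgebra
  have hp := isPullback_SpecMap_of_isPushout _ _ _ _ (CommRingCat.isPushout_tensorProduct k Γ(T, ⊤) K)
  have ht : t = T.isoSpec.hom ≫ Spec.map (CommRingCat.ofHom (algebraMap k Γ(T, ⊤))) := by
    have : CommRingCat.ofHom (algebraMap k Γ(T, ⊤)) = φ := rfl
    rw [this, Spec.map_preimage, Iso.hom_inv_id_assoc]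
  have h2 : IsPullback (p ≫ T.isoSpec.hom) q (Spec.map (CommRingCat.ofHom (algebraMap k Γ(T, ⊤)))) (twri k K) := by
    refine IsPullback.of_iso h (Iso.refl _) T.isoSpec (Iso.refl _) (Iso.refl _) (by simp) (by simp) (by simp [ht]) (by simp)
  refine lc_bij_iso b (h2.isoIsPullback _ _ hp) T.isoSpec _ _ p q ?_ ?_ (lc_bij_spec b Γ(T, ⊤))
  · exact h2.isoIsPullback_hom_fst _ _ hp
  · exact h2.isoIsPullback_hom_snd _ _ hp

theorem pb_restrict {p : P ⟶ T} {q : P ⟶ Spk K} {t : T ⟶ Spk k} (h : IsPullback p q t (twri k K)) {T' : Scheme.{u}} (s : T' ⟶ T) :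
    IsPullback (pullback.snd p s) (pullback.fst p s ≫ q) (s ≫ t) (twri k K) := 
  (IsPullback.of_hasPullback p s).flip.paste_vert h

theorem lc_inj {p : P ⟶ T} {q : P ⟶ Spk K} {t : T ⟶ Spk k} (h : IsPullback p q t (twri k K)) :
    Function.Injective (lc b p q) := by
  intro a a' e
  ext i
  apply fun_ext_local
  intro z
  obtain ⟨U, hU, hz, -⟩ := exists_isAffineOpen_mem_and_subset (x := z) (U := ⊤) trivial
  refine ⟨U, hz, ?_⟩
  have : IsAffine U.toScheme := hU
  have e2 := congrArg (pullback.fst p U.ι).appTop e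
  rw [lc_comp b (pullback.fst p U.ι) U.ι p q (pullback.snd p U.ι) (pullback.fst p U.ι ≫ q) pullback.condition rfl,
    lc_comp b (pullback.fst p U.ι) U.ι p q (pullback.snd p U.ι) (pullback.fst p U.ι ≫ q) pullback.condition rfl] at e2
  exact congrFun ((lc_bij_affine b (pb_restrict h U.ι)).1 e2) i

theorem lc_bij {p : P ⟶ T} {q : P ⟶ Spk K} {t : T ⟶ Spk k} (h : IsPullback p q t (twri k K)) :
    Function.Bijective (lc b p q) := by
  refine ⟨lc_inj b h, fun f => ?_⟩
  have key := fun i => locfun (T := T) (fun {T'} t' f' => ∃ a : ι → Γ(T', ⊤), a i = f' ∧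
      (pullback.fst p t').appTop f = lc b (pullback.snd p t') (pullback.fst p t' ≫ q) a) ?_ ?_ ?_
  rotate_left
  · rintro T' T'' s t' f' ⟨a, ha, e⟩
    refine ⟨fun i => s.appTop (a i), congrArg s.appTop ha, ?_⟩
    let φ : pullback p (s ≫ t') ⟶ pullback p t' := pullback.lift (pullback.fst _ _) (pullback.snd _ _ ≫ s)
      (by rw [pullback.condition, Category.assoc])
    have e1 : φ ≫ pullback.fst _ _ = pullback.fst p (s ≫ t') := pullback.lift_fst _ _ _
    have e2 : φ ≫ pullback.snd _ _ = pullback.snd p (s ≫ t') ≫ s := pullback.lift_snd _ _ _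
    rw [← lc_comp b φ s (pullback.snd p t') (pullback.fst p t' ≫ q) _ _ e2 (by rw [← Category.assoc, e1]), ← e,
      ← appTop_comp, e1]
  · rintro T' t' f f' ⟨a, rfl, e⟩ ⟨a', rfl, e'⟩
    exact congrFun (lc_inj b (pb_restrict h t') (e.symm.trans e')) i
  · intro z
    obtain ⟨U, hU, hz, -⟩ := exists_isAffineOpen_mem_and_subset (x := z) (U := ⊤) trivial
    have : IsAffine U.toScheme := hU
    obtain ⟨a, ha⟩ := (lc_bij_affine b (pb_restrict h U.ι)).2 ((pullback.fst p U.ι).appTop f)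
    exact ⟨U, hz, a i, a, rfl, ha.symm⟩
  choose a ha using key
  refine ⟨a, fun_ext_local fun z => ?_⟩
  obtain ⟨U, hU, hz, -⟩ := exists_isAffineOpen_mem_and_subset (x := p z) (U := ⊤) trivial
  have : IsAffine U.toScheme := hU
  refine ⟨p ⁻¹ᵁ U, hz, ?_⟩
  obtain ⟨a', ha'⟩ := (lc_bij_affine b (pb_restrict h U.ι)).2 ((pullback.fst p U.ι).appTop f)
  have e0 : ∀ i, U.ι.appTop (a i) = a' i := fun i => ha i U.ι _ ⟨a', rfl, ha'.symm⟩
  have e1 : (pullback.fst p U.ι).appTop (lc b p q a) = (pullback.fst p U.ι).appTop f := by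
    rw [lc_comp b (pullback.fst p U.ι) U.ι p q (pullback.snd p U.ι) (pullback.fst p U.ι ≫ q) pullback.condition rfl, ← ha']
    congr 1; ext i; exact e0 i
  let φ : (p ⁻¹ᵁ U).toScheme ⟶ pullback p U.ι := pullback.lift (p ⁻¹ᵁ U).ι (p ∣_ U) (by rw [morphismRestrict_ι])
  have e2 : φ ≫ pullback.fst p U.ι = (p ⁻¹ᵁ U).ι := pullback.lift_fst _ _ _
  rw [← e2, appTop_comp, appTop_comp, e1]

/-- `P = T ×_k K` -/
def KB (k : Type u) [Field k] {K : Type u} [Field K] [Algebra k K] {P T : Scheme.{u}} (p : P ⟶ T) (q : P ⟶ Spk K) : Prop :=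
  ∃ t : T ⟶ Spk k, IsPullback p q t (twri k K)

/-- norm -/
def nm (p : P ⟶ T) : Γ(P, ⊤) →* Γ(T, ⊤) :=
  letI : Algebra Γ(T, ⊤) Γ(P, ⊤) := p.appTop.hom.toAlgebra
  Algebra.norm Γ(T, ⊤)

theorem KB.basis {p : P ⟶ T} {q : P ⟶ Spk K} (h : KB k p q) :
    letI : Algebra Γ(T, ⊤) Γ(P, ⊤) := p.appTop.hom.toAlgebra
    ∃ b' : Module.Basis ι Γ(T, ⊤) Γ(P, ⊤), ∀ i, b' i = qs q (b i) := by
  classical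
  obtain ⟨t, h⟩ := h
  letI : Algebra Γ(T, ⊤) Γ(P, ⊤) := p.appTop.hom.toAlgebra
  let f : (ι → Γ(T, ⊤)) →ₗ[Γ(T, ⊤)] Γ(P, ⊤) := 
    { toFun := lc b p q
      map_add' := by
        intro a a'
        simp only [lc, Pi.add_apply, map_add, add_mul, Finset.sum_add_distrib]
      map_smul' := by
        intro c a
        simp only [lc, Pi.smul_apply, smul_eq_mul, map_mul, Algebra.smul_def, mul_assoc]
        exact (Finset.mul_sum _ _ _).symm }
  refine ⟨Module.Basis.ofEquivFun (LinearEquiv.ofBijective f (lc_bij b h)).symm, fun i => ?_⟩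
  rw [Module.Basis.coe_ofEquivFun]
  show lc b p q (Pi.single i 1) = _
  unfold lc
  rw [Finset.sum_eq_single i]
  · simp
  · intro j _ hj
    rw [Pi.single_eq_of_ne hj, map_zero, zero_mul]
  · simp

variable [Module.Finite k K]

theorem nm_nat {P' T' : Scheme.{u}} {φ : P' ⟶ P} {τ : T' ⟶ T} {p : P ⟶ T} {q : P ⟶ Spk K} {p' : P' ⟶ T'} {q' : P' ⟶ Spk K}
    (h : KB k p q) (h' : KB k p' q') (hp : φ ≫ p = p' ≫ τ) (hq : φ ≫ q = q') (f : Γ(P, ⊤)) :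
    τ.appTop (nm p f) = nm p' (φ.appTop f) := by
  obtain ⟨b1, e1⟩ := h.basis (Module.finBasis k K)
  obtain ⟨b2, e2⟩ := h'.basis (Module.finBasis k K)
  letI : Algebra Γ(T, ⊤) Γ(P, ⊤) := p.appTop.hom.toAlgebra
  letI : Algebra Γ(T', ⊤) Γ(P', ⊤) := p'.appTop.hom.toAlgebra
  refine alg_norm_map b1 b2 τ.appTop.hom φ.appTop.hom ?_ ?_ f
  · intro a
    exact ((appTop_comp _ _ _).symm.trans (by rw [hp])).trans (appTop_comp p' τ a)
  · intro i
    rw [e1, e2, ← hq, qs_comp]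

theorem nm_unit {p : P ⟶ T} {q : P ⟶ Spk K} (h : KB k p q) {f : Γ(P, ⊤)} : IsUnit (nm p f) ↔ IsUnit f := by
  obtain ⟨b1, e1⟩ := h.basis (Module.finBasis k K)
  letI : Algebra Γ(T, ⊤) Γ(P, ⊤) := p.appTop.hom.toAlgebra
  exact isUnit_norm_iff' b1 f

end normsch

/-! ### Twisted ratios of sections -/
section ratio
variable {G : GroupSchemeOver k} {Y : SchemeOver k} {α : ActionOver G Y} {C : Cocyc Y.carrier}

/-- local equation of a twisted ratio -/
def REQ (l : Lin α C) {m : ℕ} (s s' : C.HS m) {T : Scheme.{u}} (g : T ⟶ G.carrier) (y : T ⟶ Y.carrier)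
    (a b : C.J) (w : Γ(T, ⊤)) : Prop :=
  ∀ h ha hb, w * ev (s'.σ b) (α.act g y h) hb = ev (s.σ a) y ha * l.u a b g y h ha hb ^ m

/-- twisted ratio -/
def IsR (l : Lin α C) {m : ℕ} (s s' : C.HS m) {T : Scheme.{u}} (g : T ⟶ G.carrier) (y : T ⟶ Y.carrier)
    (w : Γ(T, ⊤)) : Prop :=
  ∀ ⦃T' : Scheme.{u}⦄ (t : T' ⟶ T) (a b : C.J), REQ l s s' (t ≫ g) (t ≫ y) a b (t.appTop w)

variable {l : Lin α C} {m : ℕ} {s s' s'' : C.HS m} {T T' : Scheme.{u}} {g g' : T ⟶ G.carrier} {y y' : T ⟶ Y.carrier}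
  {w w' : Γ(T, ⊤)}

theorem IsR.comp (H : IsR l s s' g y w) (t : T' ⟶ T) : IsR l s s' (t ≫ g) (t ≫ y) (t.appTop w) := by
  intro T'' t' a b
  rw [← Category.assoc, ← Category.assoc, ← appTop_comp]
  exact H _ _ _

theorem IsR.congr (H : IsR l s s' g y w) (hg : g = g') (hy : y = y') : IsR l s s' g' y' w := by
  subst hg hy; exact H

theorem IsR.self (H : IsR l s s' g y w) (a b : C.J) : REQ l s s' g y a b w := by
  have := H (𝟙 T) a b
  rw [Category.id_comp, Category.id_comp] at this
  simpa using this

theorem REQ.comp {a b : C.J} (h ha hb) (H : w * ev (s'.σ b) (α.act g y h) hb = ev (s.σ a) y ha * l.u a b g y h ha hb ^ m)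
    (t : T' ⟶ T) : REQ l s s' (t ≫ g) (t ≫ y) a b (t.appTop w) := by
  intro h' ha' hb'
  rw [l.u_nat a b t g y h ha hb h' ha' hb', ev_comp _ _ ha _ ha', ← map_pow, ← map_mul, ← H, map_mul]
  congr 1
  rw [← ev_comp _ _ _ _ (hb.comp t)]
  exact ev_congr rfl (α.act_natural _ _ _ _ _).symm _ _

theorem REQ.change {a b : C.J} (a' b' : C.J) (h ha hb) (H : w * ev (s'.σ b) (α.act g y h) hb = ev (s.σ a) y ha * l.u a b g y h ha hb ^ m) :
    REQ l s s' g y a' b' w := by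
  intro h' ha' hb'
  have e1 := s'.hom b b' (α.act g y h) hb hb' (hb.inf hb')
  have e2 := l.right a b b' g y h ha hb hb' (hb.inf hb')
  have e3 := l.left a a' b' g y h ha ha' hb' (ha.inf ha')
  have e4 := s.hom a a' y ha ha' (ha.inf ha')
  calc w * ev (s'.σ b') (α.act g y h) hb' = ev (C.g b b') (α.act g y h) (hb.inf hb') ^ m * (w * ev (s'.σ b) (α.act g y h) hb) := by
          rw [e1]; ring
    _ = ev (s.σ a) y ha * l.u a b' g y h ha hb' ^ m := by rw [H, e2]; ring
    _ = _ := by rw [e3, e4]; ring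

theorem IsR.of (a b : C.J) (h ha hb) (H : w * ev (s'.σ b) (α.act g y h) hb = ev (s.σ a) y ha * l.u a b g y h ha hb ^ m) :
    IsR l s s' g y w := by
  intro T' t a' b'
  have h' : (t ≫ g) ≫ G.str = (t ≫ y) ≫ Y.str := by simp only [Category.assoc, h]
  have ha' := ha.comp t
  have hb' : Land (α.act (t ≫ g) (t ≫ y) h') (C.V b) := (hb.comp t).congr (α.act_natural _ _ _ _ _)
  exact REQ.change a' b' h' ha' hb' (REQ.comp h ha hb H t h' ha' hb')

/-- restriction to preimage open -/
theorem res_fac (t : T' ⟶ T) (O : T.Opens) : (t ∣_ O) ≫ O.ι = (t ⁻¹ᵁ O).ι ≫ t := morphismRestrict_ι _ _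

theorem IsR.loc (H : ∀ z : T, ∃ O : T.Opens, z ∈ O ∧ IsR l s s' (O.ι ≫ g) (O.ι ≫ y) (O.ι.appTop w)) :
    IsR l s s' g y w := by
  intro T' t a b h ha hb
  apply fun_ext_local
  intro z
  obtain ⟨O, hO, H⟩ := H (t z)
  refine ⟨t ⁻¹ᵁ O, hO, ?_⟩
  have H2 := H.comp (t ∣_ O)
  rw [← appTop_comp, res_fac, appTop_comp] at H2
  have H3 := H2.congr (g' := (t ⁻¹ᵁ O).ι ≫ t ≫ g) (y' := (t ⁻¹ᵁ O).ι ≫ t ≫ y)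
    (by rw [← Category.assoc, res_fac, Category.assoc]) (by rw [← Category.assoc, res_fac, Category.assoc])
  have h' : ((t ⁻¹ᵁ O).ι ≫ t ≫ g) ≫ G.str = ((t ⁻¹ᵁ O).ι ≫ t ≫ y) ≫ Y.str := by
    rw [Category.assoc, h]; simp only [Category.assoc]
  have hn := α.act_natural (t ⁻¹ᵁ O).ι (t ≫ g) (t ≫ y) h h'
  have := H3.self a b h' (ha.comp _) ((hb.comp _).congr hn)
  rw [map_mul, map_mul, map_pow, ← l.u_nat a b (t ⁻¹ᵁ O).ι _ _ h ha hb h' (ha.comp _) ((hb.comp _).congr hn), ev_comp', ev_comp']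
  refine Eq.trans ?_ this
  congr 1
  exact ev_congr rfl hn _ _

/-- local index choice -/
theorem exists_ab (h : g ≫ G.str = y ≫ Y.str) (z : T) : ∃ O : T.Opens, z ∈ O ∧ ∃ a b, Land (O.ι ≫ y) (C.V a) ∧
    ∃ h', Land (α.act (O.ι ≫ g) (O.ι ≫ y) h') (C.V b) := by
  obtain ⟨a, ha⟩ := C.cov (y z)
  obtain ⟨b, hb⟩ := C.cov ((α.act g y h) z)
  let O := y ⁻¹ᵁ C.V a ⊓ (α.act g y h) ⁻¹ᵁ C.V b
  have h' : (O.ι ≫ g) ≫ G.str = (O.ι ≫ y) ≫ Y.str := by rw [Category.assoc, h, Category.assoc]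
  refine ⟨O, ⟨ha, hb⟩, a, b, Cocyc.land_pre (Land.left (Land.ι O)), h', ?_⟩
  exact (Cocyc.land_pre (Land.right (Land.ι O))).congr (α.act_natural _ _ _ _ _)

theorem HS_unit (s : C.HS m) {b : C.J} {x : T ⟶ Y.carrier} (hb : Land x (C.V b)) (hs : Land x s.nz) : IsUnit (ev (s.σ b) x hb) := by
  rw [isUnit_iff_basicOpen, ev_basicOpen]
  exact eq_top_iff.mpr fun z _ => (s.mem_nz (Land.iff.mp hb z)).mp (Land.iff.mp hs z)

theorem HS_land (s : C.HS m) {b : C.J} {x : T ⟶ Y.carrier} (hb : Land x (C.V b)) (hs : IsUnit (ev (s.σ b) x hb)) : Land x s.nz := by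
  rw [isUnit_iff_basicOpen, ev_basicOpen] at hs
  exact Land.iff.mpr fun z => (s.mem_nz (Land.iff.mp hb z)).mpr (hs.ge trivial : z ∈ _)

theorem IsR.uniq (H : IsR l s s' g y w) (H' : IsR l s s' g y w') (h) (hs : Land (α.act g y h) s'.nz) : w = w' := by
  apply fun_ext_local
  intro z
  obtain ⟨O, hO, a, b, ha, h', hb⟩ := exists_ab (C := C) (α := α) h z
  refine ⟨O, hO, ?_⟩
  have := (H O.ι a b h' ha hb).trans (H' O.ι a b h' ha hb).symm
  exact (HS_unit s' hb ((hs.comp O.ι).congr (α.act_natural _ _ _ _ _))).mul_right_cancel this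

theorem IsR.exists_of (a b : C.J) (h) (ha : Land y (C.V a)) (hb : Land (α.act g y h) (C.V b)) (hs : Land (α.act g y h) s'.nz) : ∃ w, IsR l s s' g y w := by
  obtain ⟨v, hv⟩ := HS_unit s' hb hs
  refine ⟨ev (s.σ a) y ha * l.u a b g y h ha hb ^ m * ↑v⁻¹, IsR.of a b h ha hb ?_⟩
  rw [← hv, mul_assoc, Units.inv_mul, mul_one]

theorem IsR.ex (h) (hs : Land (α.act g y h) s'.nz) : ∃ w, IsR l s s' g y w := by
  have hh : ∀ {T' : Scheme.{u}} (t : T' ⟶ T), (t ≫ g) ≫ G.str = (t ≫ y) ≫ Y.str := fun t => by simp only [Category.assoc, h]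
  have hn : ∀ {T' : Scheme.{u}} (t : T' ⟶ T), Land (α.act (t ≫ g) (t ≫ y) (hh t)) s'.nz := 
    fun t => (hs.comp t).congr (α.act_natural _ _ _ _ _)
  have key := locfun (T := T) (fun {T'} t w => IsR l s s' (t ≫ g) (t ≫ y) w) ?_ ?_ ?_
  · obtain ⟨w, hw⟩ := key
    refine ⟨w, ?_⟩
    intro T' t a b h' ha hb
    obtain ⟨w', hw'⟩ := IsR.exists_of (l := l) (s := s) a b h' ha hb (hn t)
    rw [hw t w' hw']
    exact hw'.self a b h' ha hb
  · intro T' T'' q t f hf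
    exact (hf.comp q).congr (by simp) (by simp)
  · intro T' t f f' hf hf'
    exact hf.uniq hf' (hh t) (hn t)
  · intro z
    obtain ⟨O, hO, a, b, ha, h', hb⟩ := exists_ab (C := C) (α := α) h z
    exact ⟨O, hO, IsR.exists_of a b h' ha hb (hn _)⟩

theorem IsR.one (s : C.HS m) (y : T ⟶ Y.carrier) : IsR l s s (y ≫ Y.str ≫ G.one) y 1 := by
  intro T' t a b h ha hb
  have e : t ≫ y ≫ Y.str ≫ G.one = (t ≫ y) ≫ Y.str ≫ G.one := by simp
  have h' : ((t ≫ y) ≫ Y.str ≫ G.one) ≫ G.str = (t ≫ y) ≫ Y.str := by rw [← e, h]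
  have e1 : α.act (t ≫ y ≫ Y.str ≫ G.one) (t ≫ y) h = t ≫ y := (α.act_congr e rfl _ h').trans (α.one_act _ _)
  have hb2 := hb.congr e1
  rw [map_one, one_mul, ev_congr rfl e1 hb hb2, s.hom a b (t ≫ y) ha hb2 (ha.inf hb2), mul_comm,
    l.u_congr a b e rfl h ha hb h' ha (hb2.congr (α.one_act _ _).symm), l.u_one a b _ h' ha _ (ha.inf hb2)]

theorem IsR.mul (h₁) (h₂ : G.mul g g' h₁ ≫ G.str = y ≫ Y.str) (h₃) (h₄ : g ≫ G.str = α.act g' y h₃ ≫ Y.str) (H : IsR l s s' g' y w) (H' : IsR l s' s'' g (α.act g' y h₃) w') :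
    IsR l s s'' (G.mul g g' h₁) y (w * w') := by
  apply IsR.loc
  intro z
  obtain ⟨a, ha⟩ := C.cov (y z)
  obtain ⟨b, hb⟩ := C.cov ((α.act g' y h₃) z)
  obtain ⟨c, hc⟩ := C.cov ((α.act g (α.act g' y h₃) h₄) z)
  let O := y ⁻¹ᵁ C.V a ⊓ (α.act g' y h₃) ⁻¹ᵁ C.V b ⊓ (α.act g (α.act g' y h₃) h₄) ⁻¹ᵁ C.V c
  refine ⟨O, ⟨⟨ha, hb⟩, hc⟩, ?_⟩
  have la : Land (O.ι ≫ y) (C.V a) := Cocyc.land_pre (Land.left (Land.left (Land.ι O)))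
  have lb : Land (O.ι ≫ α.act g' y h₃) (C.V b) := Cocyc.land_pre (Land.right (Land.left (Land.ι O)))
  have lc : Land (O.ι ≫ α.act g (α.act g' y h₃) h₄) (C.V c) := Cocyc.land_pre (Land.right (Land.ι O))
  have k1 : (O.ι ≫ g) ≫ G.str = (O.ι ≫ g') ≫ G.str := by simp only [Category.assoc, h₁]
  have k3 : (O.ι ≫ g') ≫ G.str = (O.ι ≫ y) ≫ Y.str := by simp only [Category.assoc, h₃]
  have e2 : O.ι ≫ G.mul g g' h₁ = G.mul (O.ι ≫ g) (O.ι ≫ g') k1 := G.mul_natural _ _ _ _ _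
  have k2 : (G.mul (O.ι ≫ g) (O.ι ≫ g') k1) ≫ G.str = (O.ι ≫ y) ≫ Y.str := by rw [← e2, Category.assoc, h₂, Category.assoc]
  have e3 : O.ι ≫ α.act g' y h₃ = α.act (O.ι ≫ g') (O.ι ≫ y) k3 := α.act_natural _ _ _ _ _
  have k4 : (O.ι ≫ g) ≫ G.str = α.act (O.ι ≫ g') (O.ι ≫ y) k3 ≫ Y.str := by rw [← e3, Category.assoc, h₄, Category.assoc]
  have k4' : (O.ι ≫ g) ≫ G.str = (O.ι ≫ α.act g' y h₃) ≫ Y.str := by rw [Category.assoc, h₄, Category.assoc]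
  have e4 : O.ι ≫ α.act g (α.act g' y h₃) h₄ = α.act (O.ι ≫ g) (α.act (O.ι ≫ g') (O.ι ≫ y) k3) k4 :=
    (α.act_natural _ _ _ _ k4').trans (α.act_congr rfl e3 _ _)
  have e5 : α.act (G.mul (O.ι ≫ g) (O.ι ≫ g') k1) (O.ι ≫ y) k2 = α.act (O.ι ≫ g) (α.act (O.ι ≫ g') (O.ι ≫ y) k3) k4 :=
    α.mul_act _ _ _ _ _ _ _
  have lb' := lb.congr e3
  have lc' := lc.congr e4
  have lc'' := lc'.congr e5.symm
  have r1 := H O.ι a b k3 la lb'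
  have r2 := ((H'.comp O.ι).congr rfl e3).self b c k4 lb' lc'
  refine IsR.congr ?_ e2.symm rfl
  refine IsR.of a c k2 la lc'' ?_
  rw [l.u_mul a b c _ _ _ k1 k2 k3 k4 la lb' lc'' lc', ev_congr rfl e5 lc'' lc', mul_pow, ← mul_assoc, ← r1, map_mul,
    mul_assoc, r2]
  ring

theorem IsR.unit {y : T ⟶ Y.carrier} (H : IsR l s s' (y ≫ Y.str ≫ G.one) y w) (hs : Land y s'.nz) : IsUnit w ↔ Land y s.nz := by
  have key : ∀ z : T, ∃ (a : C.J) (O : T.Opens) (_ : z ∈ O) (la : Land (O.ι ≫ y) (C.V a)), 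
      O.ι.appTop w * ev (s'.σ a) (O.ι ≫ y) la = ev (s.σ a) (O.ι ≫ y) la := by
    intro z
    obtain ⟨a, ha⟩ := C.cov (y z)
    let O := y ⁻¹ᵁ C.V a
    have la : Land (O.ι ≫ y) (C.V a) := Cocyc.land_pre (Land.ι O)
    have e : O.ι ≫ y ≫ Y.str ≫ G.one = (O.ι ≫ y) ≫ Y.str ≫ G.one := by simp
    have h' : ((O.ι ≫ y) ≫ Y.str ≫ G.one) ≫ G.str = (O.ι ≫ y) ≫ Y.str := by simp [G.one_str]
    have la' := la.congr (α.one_act _ h').symm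
    refine ⟨a, O, ha, la, ?_⟩
    have := ((H.comp O.ι).congr e rfl).self a a h' la la'
    rw [ev_congr rfl (α.one_act _ h') la' la, l.u_one a a _ h' la la' (la.inf la), C.g_self, one_pow, mul_one] at this
    exact this
  constructor
  · intro hw
    refine Land.iff.mpr fun z => ?_
    obtain ⟨a, O, hz, la, e⟩ := key z
    have : Land (O.ι ≫ y) s.nz := by
      apply HS_land s la
      rw [← e]
      exact (hw.map _).mul (HS_unit s' la (hs.comp _))
    exact Land.iff.mp this ⟨z, hz⟩
  · intro hy
    apply isUnit_local
    intro z
    obtain ⟨a, O, hz, la, e⟩ := key z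
    refine ⟨O, hz, ?_⟩
    have h1 := HS_unit s la (hy.comp _)
    rw [← e] at h1
    exact isUnit_of_mul_isUnit_left h1

open Classical in
/-- the twisted ratio -/
def RR (l : Lin α C) {m : ℕ} (s s' : C.HS m) {T : Scheme.{u}} (g : T ⟶ G.carrier) (y : T ⟶ Y.carrier) : Γ(T, ⊤) :=
  if h : ∃ w, IsR l s s' g y w then h.choose else 0

theorem RR_spec (h) (hs : Land (α.act g y h) s'.nz) : IsR l s s' g y (RR l s s' g y) := by
  have := IsR.ex (l := l) (s := s) h hs
  unfold RR
  rw [dif_pos this]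
  exact this.choose_spec

end ratio

/-! ### Norms of twisted ratios -/
section nu
open SchemeOver
variable {K : Type u} [Field K] [Algebra k K]
variable {G : GroupSchemeOver k} {X : SchemeOver k} {α : ActionOver G X} {C : Cocyc (X.bc (twri k K)).carrier}

/-- points of the base change over a point of `X` -/
structure IsK {P T : Scheme.{u}} (x : T ⟶ X.carrier) (p : P ⟶ T) (q : P ⟶ Spk K) (y : P ⟶ (X.bc (twri k K)).carrier) : Prop where
  pb : IsPullback p q (x ≫ X.str) (twri k K)
  h1 : y ≫ X.p1 _ = p ≫ x
  h2 : y ≫ X.p2 _ = q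

section
variable {P T T' : Scheme.{u}} {x : T ⟶ X.carrier} {p : P ⟶ T} {q : P ⟶ Spk K} {y : P ⟶ (X.bc (twri k K)).carrier}

theorem IsK.kb (h : IsK x p q y) : KB k p q := ⟨_, h.pb⟩

/-- standard lift -/
def sK (K : Type u) [Field K] [Algebra k K] (x : T ⟶ X.carrier) : pullback (x ≫ X.str) (twri k K) ⟶ (X.bc (twri k K)).carrier :=
  X.bl _ (pullback.fst _ _ ≫ x) (pullback.snd _ _) (by rw [Category.assoc, pullback.condition])

theorem IsK.std (x : T ⟶ X.carrier) : IsK x (pullback.fst (x ≫ X.str) (twri k K)) (pullback.snd _ _) (sK K x) :=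
  ⟨IsPullback.of_hasPullback _ _, bl_p1 _ _ _ _ _, bl_p2 _ _ _ _ _⟩

theorem IsK.comp (h : IsK x p q y) (t : T' ⟶ T) :
    IsK (t ≫ x) (pullback.snd p t) (pullback.fst p t ≫ q) (pullback.fst p t ≫ y) := by
  refine ⟨?_, ?_, ?_⟩
  · rw [Category.assoc]; exact pb_restrict h.pb t
  · rw [Category.assoc, h.h1, ← Category.assoc, pullback.condition, Category.assoc]
  · rw [Category.assoc, h.h2]

theorem IsK.pb' (h : IsK x p q y) : IsPullback y p (X.p1 _) x := by
  refine IsPullback.of_right (h₁₂ := X.p2 _) (v₁₃ := twri k K) (h₂₂ := X.str) ?_ h.h1 (X.bc_pb _).flip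
  rw [h.h2]; exact h.pb.flip

theorem IsK.surj (h : IsK x p q y) (z : T) (v : (X.bc (twri k K)).carrier) (e : X.p1 _ v = x z) : ∃ w : P, y w = v ∧ p w = z := by
  obtain ⟨a, h1, h2⟩ := Scheme.Pullback.exists_preimage_pullback v z e
  refine ⟨h.pb'.isoPullback.inv a, ?_, ?_⟩
  · rw [← h1, ← h.pb'.isoPullback_inv_fst]; rfl
  · rw [← h2, ← h.pb'.isoPullback_inv_snd]; rfl

theorem IsK.sch (h : IsK x p q y) {g : T ⟶ G.carrier} (hg : g ≫ G.str = x ≫ X.str) : (p ≫ g) ≫ G.str = y ≫ (X.bc (twri k K)).str := by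
  rw [bc_str, ← Category.assoc, h.h1, Category.assoc, Category.assoc, hg]

theorem IsK.act (α : ActionOver G X) (h : IsK x p q y) {g : T ⟶ G.carrier} (hg : g ≫ G.str = x ≫ X.str) (hg') :
    IsK (α.act g x hg) p q ((α.bc _).act (p ≫ g) y hg') := by
  have e : (p ≫ g) ≫ G.str = (p ≫ x) ≫ X.str := by simp only [Category.assoc, hg]
  refine ⟨?_, ?_, ?_⟩
  · rw [α.act_str]; exact h.pb
  · rw [α.bc_p1 _ _ _ _ (by rw [h.h1, e]), α.act_natural _ _ _ _ e]
    exact α.act_congr rfl h.h1 _ _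
  · rw [α.bc_p2, h.h2]

theorem IsK.map {P' : Scheme.{u}} {p' : P' ⟶ T} {q' : P' ⟶ Spk K} {y' : P' ⟶ (X.bc (twri k K)).carrier}
    (h : IsK x p q y) (h' : IsK x p' q' y') : ∃ φ : P' ⟶ P, φ ≫ p = p' ∧ φ ≫ q = q' ∧ φ ≫ y = y' := by
  refine ⟨h.pb.lift p' q' h'.pb.w, h.pb.lift_fst _ _ _, h.pb.lift_snd _ _ _, ?_⟩
  apply bc_ext
  · rw [Category.assoc, h.h1, ← Category.assoc, h.pb.lift_fst, h'.h1]
  · rw [Category.assoc, h.h2, h.pb.lift_snd, h'.h2]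

end

variable [Module.Finite k K]

theorem p1_finite (X : SchemeOver k) (K : Type u) [Field K] [Algebra k K] [Module.Finite k K] : IsFinite (X.p1 (twri k K)) := by
  have : IsFinite (twri k K) := by
    unfold twri
    rw [IsFinite.SpecMap_iff]
    exact RingHom.finite_algebraMap.mpr inferInstance
  exact inferInstanceAs (IsFinite (pullback.fst X.str (twri k K)))

/-- the locus over which `s` is nowhere vanishing -/
def Ws {m : ℕ} (s : C.HS m) : X.carrier.Opens :=
  ⟨{x | ∀ v, X.p1 (twri k K) v = x → v ∈ s.nz}, by
    have := p1_finite X K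
    have : IsClosed ((X.p1 (twri k K)) '' (s.nz : Set _)ᶜ) := (X.p1 (twri k K)).isClosedMap _ s.nz.2.isClosed_compl
    have h2 : {x | ∀ v, X.p1 (twri k K) v = x → v ∈ s.nz} = ((X.p1 (twri k K)) '' (s.nz : Set _)ᶜ)ᶜ := by
      ext x
      simp only [Set.mem_setOf_eq, Set.mem_compl_iff, Set.mem_image, not_exists, not_and, SetLike.mem_coe]
      exact ⟨fun h v hv e => hv (h v e), fun h v e => by_contra fun hv => h v hv e⟩
    rw [h2]
    exact this.isOpen_compl⟩

section
variable {P T T' : Scheme.{u}} {x : T ⟶ X.carrier} {p : P ⟶ T} {q : P ⟶ Spk K} {y : P ⟶ (X.bc (twri k K)).carrier}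
variable {m : ℕ} {s s' s'' : C.HS m} {l : Lin (α.bc (twri k K)) C} {g g' : T ⟶ G.carrier}

theorem Ws_land (h : IsK x p q y) : Land x (Ws s) ↔ Land y s.nz := by
  rw [Land.iff, Land.iff]
  constructor
  · intro H z
    refine H (p z) (y z) ?_
    have := congrArg (fun f : P ⟶ X.carrier => f z) h.h1
    exact this
  · intro H z v e
    obtain ⟨w, rfl, -⟩ := h.surj z v e
    exact H w

/-- norm of the twisted ratio -/
def nu (l : Lin (α.bc (twri k K)) C) (s s' : C.HS m) {T : Scheme.{u}} (g : T ⟶ G.carrier) (x : T ⟶ X.carrier) : Γ(T, ⊤) :=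
  nm (pullback.fst (x ≫ X.str) (twri k K)) (RR l s s' (pullback.fst (x ≫ X.str) (twri k K) ≫ g) (sK K x))

theorem nu_R (h : IsK x p q y) (hg) (hl : Land (α.act g x hg) (Ws s')) :
    IsR l s s' (p ≫ g) y (RR l s s' (p ≫ g) y) :=
  RR_spec (h.sch hg) ((Ws_land (h.act α hg (h.sch hg))).mp hl)

theorem nu_eq (h : IsK x p q y) (hg) (hl : Land (α.act g x hg) (Ws s')) {w : Γ(P, ⊤)} (hw : IsR l s s' (p ≫ g) y w) :
    nu l s s' g x = nm p w := by
  obtain ⟨φ, e1, e2, e3⟩ := (IsK.std x).map h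
  have := nm_nat (k := k) (τ := 𝟙 T) (IsK.std x).kb h.kb (e1.trans (Category.comp_id _).symm) e2
    (RR l s s' (pullback.fst (x ≫ X.str) (twri k K) ≫ g) (sK K x))
  have h1 := ((nu_R (l := l) (s := s) (IsK.std x) hg hl).comp φ).congr (g' := p ≫ g) (by rw [← Category.assoc, e1]) e3
  rw [hw.uniq h1 (h.sch hg) ((Ws_land (h.act α hg (h.sch hg))).mp hl), ← this]
  simp [nu]

theorem nu_congr {x' : T ⟶ X.carrier} (e : g = g') (e' : x = x') : nu l s s' g x = nu l s s' g' x' := by subst e e'; rfl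

theorem nu_nat (t : T' ⟶ T) (hg) (hl : Land (α.act g x hg) (Ws s')) : nu l s s' (t ≫ g) (t ≫ x) = t.appTop (nu l s s' g x) := by
  have h := IsK.std (K := K) x
  have h' := h.comp t
  have hR := nu_R (l := l) (s := s) h hg hl
  have hR' := (hR.comp (pullback.fst _ t)).congr (g' := pullback.snd _ t ≫ t ≫ g)
    (by rw [← Category.assoc, pullback.condition, Category.assoc]) rfl
  have hg' : (t ≫ g) ≫ G.str = (t ≫ x) ≫ X.str := by simp only [Category.assoc, hg]
  rw [nu_eq h' hg' ((hl.comp t).congr (α.act_natural _ _ _ _ _)) hR', nu_eq h hg hl hR]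
  exact (nm_nat h.kb h'.kb pullback.condition rfl _).symm

theorem one_sch (x : T ⟶ X.carrier) : (x ≫ X.str ≫ G.one) ≫ G.str = x ≫ X.str := by simp [G.one_str]

theorem IsK.one (h : IsK x p q y) : p ≫ x ≫ X.str ≫ G.one = y ≫ (X.bc (twri k K)).str ≫ G.one := by
  rw [bc_str, Category.assoc, ← Category.assoc y, h.h1, Category.assoc]

theorem nu_one (hl : Land x (Ws s)) : nu l s s (x ≫ X.str ≫ G.one) x = 1 := by
  have h := IsK.std (K := K) x
  rw [nu_eq h (one_sch x) (hl.congr (α.one_act _ _).symm) ((IsR.one s _).congr h.one.symm rfl), map_one]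

theorem nu_mul (h₁) (h₂ : G.mul g g' h₁ ≫ G.str = x ≫ X.str) (h₃) (h₄ : g ≫ G.str = α.act g' x h₃ ≫ X.str)
    (hl : Land (α.act g' x h₃) (Ws s')) (hl' : Land (α.act g (α.act g' x h₃) h₄) (Ws s'')) :
    nu l s s'' (G.mul g g' h₁) x = nu l s s' g' x * nu l s' s'' g (α.act g' x h₃) := by
  have h := IsK.std (K := K) x
  have h' := h.act α h₃ (h.sch h₃)
  have R1 := nu_R (l := l) (s := s) h h₃ hl
  have R2 := nu_R (l := l) (s := s') h' h₄ hl'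
  have k1 : (pullback.fst (x ≫ X.str) (twri k K) ≫ g) ≫ G.str = (pullback.fst (x ≫ X.str) (twri k K) ≫ g') ≫ G.str := by
    simp only [Category.assoc, h₁]
  have e1 : pullback.fst (x ≫ X.str) (twri k K) ≫ G.mul g g' h₁ = G.mul _ _ k1 := G.mul_natural _ _ _ _ _
  have R3 := IsR.mul k1 (by rw [← e1]; exact h.sch h₂) (h.sch h₃) (h'.sch h₄) R1 R2
  rw [nu_eq h h₂ (hl'.congr (α.mul_act _ _ _ _ _ _ _).symm) (R3.congr e1.symm rfl), nu_eq h h₃ hl R1, nu_eq h' h₄ hl' R2, map_mul]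

theorem nu_unit (hl : Land x (Ws s')) : IsUnit (nu l s s' (x ≫ X.str ≫ G.one) x) ↔ Land x (Ws s) := by
  have h := IsK.std (K := K) x
  have hl2 := hl.congr (α.one_act _ (one_sch x)).symm
  have R := nu_R (l := l) (s := s) h (one_sch x) hl2
  rw [nu_eq h (one_sch x) hl2 R, nm_unit h.kb, (R.congr h.one rfl).unit ((Ws_land h).mp hl), Ws_land h]

end
end nu

/-! ### The norm cocycle on `X` -/
section normcocycle
open SchemeOver
variable {K : Type u} [Field K] [Algebra k K]
variable {G : GroupSchemeOver k} {X : SchemeOver k} {α : ActionOver G X} {C : Cocyc (X.bc (twri k K)).carrier}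
variable [Module.Finite k K]
variable {m : ℕ}

theorem G_mul_congr (G : GroupSchemeOver k) {T : Scheme.{u}} {a a' b b' : T ⟶ G.carrier} (e : a = a') (e' : b = b')
    (h : a ≫ G.str = b ≫ G.str) (h' : a' ≫ G.str = b' ≫ G.str) : G.mul a b h = G.mul a' b' h' := by
  subst e e'; rfl

theorem n1_nat (l : Lin (α.bc (twri k K)) C) (s s' : C.HS m) {T T' : Scheme.{u}} (t : T' ⟶ T) (x : T ⟶ X.carrier)
    (h : Land x (Ws s')) :
    nu l s s' ((t ≫ x) ≫ X.str ≫ G.one) (t ≫ x) = t.appTop (nu l s s' (x ≫ X.str ≫ G.one) x) := by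
  refine (nu_congr (by simp) rfl).trans (nu_nat t (one_sch x) ?_)
  rw [α.one_act]; exact h

theorem n1_mul (l : Lin (α.bc (twri k K)) C) (s s' s'' : C.HS m) {T : Scheme.{u}} (x : T ⟶ X.carrier)
    (h' : Land x (Ws s')) (h'' : Land x (Ws s'')) :
    nu l s s'' (x ≫ X.str ≫ G.one) x = nu l s s' (x ≫ X.str ≫ G.one) x * nu l s' s'' (x ≫ X.str ≫ G.one) x := by
  have e := α.one_act x (one_sch x)
  have h4 : (x ≫ X.str ≫ G.one) ≫ G.str = α.act (x ≫ X.str ≫ G.one) x (one_sch x) ≫ X.str := by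
    rw [e]; exact one_sch x
  have e1 : ((x ≫ X.str ≫ G.one) ≫ G.str ≫ G.one) = x ≫ X.str ≫ G.one := by
    rw [← Category.assoc, one_sch, Category.assoc]
  have em : G.mul (x ≫ X.str ≫ G.one) (x ≫ X.str ≫ G.one) rfl = x ≫ X.str ≫ G.one :=
    (G_mul_congr G e1.symm rfl rfl (by rw [e1])).trans (G.one_mul (x ≫ X.str ≫ G.one) (by rw [e1]))
  have := nu_mul (l := l) (s := s) (s' := s') (s'' := s'') (x := x) (g := x ≫ X.str ≫ G.one) (g' := x ≫ X.str ≫ G.one)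
    rfl (by rw [em]; exact one_sch x) (one_sch x) h4 (by rw [e]; exact h')
    (by rw [α.act_congr rfl e h4 (one_sch x), e]; exact h'')
  rw [nu_congr em rfl, nu_congr (l := l) (s := s') (s' := s'') rfl e] at this
  exact this

theorem exists_nuf (l : Lin (α.bc (twri k K)) C) (s s' : C.HS m) (U : X.carrier.Opens) (hU : U ≤ Ws s') :
    ∃ f : Γ(X.carrier, U), ∀ {T : Scheme.{u}} (x : T ⟶ X.carrier) (h : Land x U),
      ev f x h = nu l s s' (x ≫ X.str ≫ G.one) x :=
  exists_ev (fun x h => nu l s s' (x ≫ X.str ≫ G.one) x) (fun t x h h' => n1_nat l s s' t x (h.mono hU))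

/-- the function with values the norms of the ratios -/
def nuf (l : Lin (α.bc (twri k K)) C) (s s' : C.HS m) (U : X.carrier.Opens) (hU : U ≤ Ws s') : Γ(X.carrier, U) :=
  (exists_nuf l s s' U hU).choose

theorem nuf_ev (l : Lin (α.bc (twri k K)) C) (s s' : C.HS m) (U : X.carrier.Opens) (hU : U ≤ Ws s')
    {T : Scheme.{u}} (x : T ⟶ X.carrier) (h : Land x U) :
    ev (nuf l s s' U hU) x h = nu l s s' (x ≫ X.str ≫ G.one) x :=
  (exists_nuf l s s' U hU).choose_spec x h

theorem nuf_basicOpen (l : Lin (α.bc (twri k K)) C) (s s' : C.HS m) (U : X.carrier.Opens) (hU : U ≤ Ws s') :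
    X.carrier.basicOpen (nuf l s s' U hU) = U ⊓ Ws s := by
  have key : ∀ D : X.carrier.Opens, D ≤ U → (D ≤ X.carrier.basicOpen (nuf l s s' U hU) ↔ D ≤ Ws s) := by
    intro D hD
    have a : Land D.ι U := (Land.ι D).mono hD
    have h1 := nu_unit (l := l) (s := s) (s' := s') (a.mono hU)
    rw [← nuf_ev l s s' U hU D.ι a, isUnit_iff_basicOpen, ev_basicOpen] at h1
    have h2 : ∀ O : X.carrier.Opens, Land D.ι O ↔ D ≤ O := by
      intro O
      rw [Land.iff]
      exact ⟨fun h z hz => h ⟨z, hz⟩, fun h t => h t.2⟩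
    rw [← h2, ← h2, ← h1]
    exact top_le_iff
  refine le_antisymm ?_ ?_
  · exact le_inf (X.carrier.basicOpen_le _) ((key _ (X.carrier.basicOpen_le _)).mp le_rfl)
  · exact (key _ inf_le_left).mpr inf_le_right

variable {J : Type u} [Finite J]

/-- the norm cocycle -/
def nCoc (l : Lin (α.bc (twri k K)) C) (s : J → C.HS m) (hc : ∀ x : X.carrier, ∃ j, x ∈ Ws (s j)) : Cocyc X.carrier where
  J := J
  fin := inferInstance
  V j := Ws (s j)
  cov := hc
  g i j := nuf l (s i) (s j) (Ws (s i) ⊓ Ws (s j)) inf_le_right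
  g_self i T x h := (nuf_ev _ _ _ _ _ x h).trans (nu_one h.left)
  g_mul i j n T x h h' h'' := by
    rw [nuf_ev, nuf_ev, nuf_ev]
    exact (n1_mul l (s i) (s j) (s n) x h.right h'.right).symm

/-- its linearization -/
def nLin (l : Lin (α.bc (twri k K)) C) (s : J → C.HS m) (hc : ∀ x : X.carrier, ∃ j, x ∈ Ws (s j)) : Lin α (nCoc l s hc) where
  u i j T g x h hi hj := nu l (s i) (s j) g x
  u_nat i j T T' t g x h hi hj h' hi' hj' := nu_nat t h hj
  u_one i j T x h hi hj hij := (nuf_ev l (s i) (s j) (Ws (s i) ⊓ Ws (s j)) inf_le_right x hij).symm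
  u_mul i j n T g g' x h₁ h₂ h₃ h₄ hi hj hl hl' := nu_mul h₁ h₂ h₃ h₄ hj hl'

/-- its sections -/
def nSec (l : Lin (α.bc (twri k K)) C) (s : J → C.HS m) (hc : ∀ x : X.carrier, ∃ j, x ∈ Ws (s j)) (j : J) :
    (nCoc l s hc).HS 1 where
  σ i := nuf l (s j) (s i) (Ws (s i)) le_rfl
  hom i i' T x hi hj hij := by
    rw [pow_one]
    refine (nuf_ev l (s j) (s i') _ le_rfl x hj).trans ?_
    refine Eq.trans ?_ (congrArg₂ (· * ·) (nuf_ev l (s i) (s i') (Ws (s i) ⊓ Ws (s i')) inf_le_right x hij).symm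
      (nuf_ev l (s j) (s i) _ le_rfl x hi).symm)
    exact (n1_mul l (s j) (s i) (s i') x hi hj).trans (mul_comm _ _)

theorem nSec_NV (l : Lin (α.bc (twri k K)) C) (s : J → C.HS m) (hc : ∀ x : X.carrier, ∃ j, x ∈ Ws (s j)) (j : J) :
    (nSec l s hc j).NV (Ws (s j)) := fun i => (nuf_basicOpen l (s j) (s i) (Ws (s i)) le_rfl).symm

end normcocycle

/-! ### Descent along finite extensions -/
section partE
open SchemeOver

theorem affine_of_local {X : Scheme.{u}} {W U : X.Opens} (hU : IsAffineOpen U) (hW : W ≤ U)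
    (h : ∀ x : X, ∃ O : X.Opens, x ∈ O ∧ IsAffineOpen O ∧ IsAffineOpen (O ⊓ W)) : IsAffineOpen W := by
  have e : ∀ O : X.Opens, W.ι ''ᵁ (W.ι ⁻¹ᵁ O) = O ⊓ W := by
    intro O; rw [Scheme.Hom.image_preimage_eq_opensRange_inf, Scheme.Opens.opensRange_ι, inf_comm]
  have : IsAffineHom W.ι := by
    apply isAffineHom_of_forall_exists_isAffineOpen
    intro x
    obtain ⟨O, h1, h2, h3⟩ := h x
    refine ⟨O, h1, h2, ?_⟩
    rw [← Scheme.Hom.isAffineOpen_iff_of_isOpenImmersion W.ι, e]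
    exact h3
  have := IsAffineHom.isAffine_preimage (f := W.ι) U hU
  rw [← Scheme.Hom.isAffineOpen_iff_of_isOpenImmersion W.ι, e, inf_eq_right.mpr hW] at this
  exact this

variable {K : Type u} [Field K] [Algebra k K]
variable {G : GroupSchemeOver k} {X : SchemeOver k} {α : ActionOver G X} {C : Cocyc (X.bc (twri k K)).carrier}
variable [Module.Finite k K]

theorem mem_Ws {m : ℕ} (s : C.HS m) (x : X.carrier) : x ∈ Ws s ↔ ∀ v, X.p1 (twri k K) v = x → v ∈ s.nz := Iff.rfl

theorem Ws_congr {m n : ℕ} {s : C.HS m} {t : C.HS n} (h : s.nz = t.nz) : Ws s = Ws t := by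
  ext x
  exact forall₂_congr fun v _ => by rw [h]

theorem exists_Ws (hC : C.Ample) (hV : ∀ i, IsAffineOpen (C.V i)) (x : X.carrier) :
    ∃ m, 0 < m ∧ ∃ s : C.HS m, x ∈ Ws s ∧ ∃ U, IsAffineOpen U ∧ Ws s ≤ U := by
  have := p1_finite X K
  obtain ⟨U, hU, hxU, -⟩ := exists_isAffineOpen_mem_and_subset (x := x) (U := ⊤) trivial
  have hfin := (X.p1 (twri k K)).finite_preimage_singleton x
  have hdis := (X.p1 (twri k K)).isDiscrete_preimage_singleton x
  obtain ⟨m, hm, s, h1, h2⟩ := hC.exists_sec_finite hV hfin.toFinset ((X.p1 (twri k K)) ⁻¹ᵁ U) (by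
      intro y hy
      have : X.p1 (twri k K) y = x := by simpa using hy
      show X.p1 (twri k K) y ∈ U
      rw [this]; exact hxU) (by
      intro y hy
      have hy' : y ∈ (X.p1 (twri k K)) ⁻¹' {x} := by simpa using hy
      obtain ⟨O, hO, hO'⟩ := isDiscrete_iff_forall_mem_exists_isOpen.mp hdis y hy'
      refine ⟨⟨O, hO⟩, (hO'.ge rfl).1, ?_⟩
      intro z hz hzO
      exact hO'.le ⟨hzO, by simpa using hz⟩)
  refine ⟨m, hm, s, fun v hv => h1 v (by simpa using hv), U, hU, fun z hz => ?_⟩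
  have := SchemeOver.p1_surj (twri k K) X
  obtain ⟨v, rfl⟩ := (X.p1 (twri k K)).surjective z
  exact h2 (hz v rfl)

theorem partE' (hC : C.Ample) (hV : ∀ i, IsAffineOpen (C.V i)) (l : Lin (α.bc (twri k K)) C) :
    ∃ C' : Cocyc X.carrier, C'.Ample ∧ Nonempty (Lin α C') := by
  have := p1_finite X K
  have := SchemeOver.p1_surj (twri k K) X
  have := hC.1
  have := hC.2.1
  obtain ⟨hcX, hqX⟩ := qcqs_of_surj (X.p1 (twri k K))
  choose d hd s hs U hU hsU using exists_Ws (X := X) hC hV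
  obtain ⟨F, hF⟩ := isCompact_univ.elim_finite_subcover (fun x => (Ws (s x) : Set X.carrier)) (fun x => (Ws (s x)).isOpen)
    (fun x _ => Set.mem_iUnion.mpr ⟨x, hs x⟩)
  have hdiv : ∀ j : F, ∃ n, 0 < n ∧ d j * n = ∏ x ∈ F, d x := by
    intro j
    obtain ⟨n, hn⟩ := Finset.dvd_prod_of_mem d j.2
    refine ⟨n, ?_, hn.symm⟩
    rcases Nat.eq_zero_or_pos n with rfl | h
    · exact absurd hn (by rw [mul_zero]; exact (Finset.prod_pos fun x _ => hd x).ne')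
    · exact h
  choose n hn hdn using hdiv
  let t : F → C.HS (∏ x ∈ F, d x) := fun j => ((s j).pow (n j)).cast (hdn j)
  have ht : ∀ j, Ws (t j) = Ws (s j) := fun j => Ws_congr ((s j).pow_nz (hn j))
  have hc : ∀ x : X.carrier, ∃ j, x ∈ Ws (t j) := by
    intro x
    obtain ⟨y, hy, hxy⟩ := Set.mem_iUnion₂.mp (hF (Set.mem_univ x))
    exact ⟨⟨y, hy⟩, by rw [ht]; exact hxy⟩
  refine ⟨nCoc l t hc, ⟨hcX, hqX, ?_⟩, ⟨nLin l t hc⟩⟩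
  intro x
  obtain ⟨j, hj⟩ := hc x
  refine ⟨1, one_pos, nSec l t hc j, Ws (t j), ?_, hj, nSec_NV l t hc j⟩
  refine affine_of_local (hU j) (by rw [ht]; exact hsU j) ?_
  intro y
  obtain ⟨i, hi⟩ := hc y
  obtain ⟨O, hO, hyO, hOi⟩ := exists_isAffineOpen_mem_and_subset (x := y) (U := Ws (t i)) hi
  refine ⟨O, hyO, hO, ?_⟩
  rw [← nuf_basicOpen l (t j) (t i) O hOi]
  exact hO.basicOpen _

theorem partE (hC : C.Ample) (l : Lin (α.bc (twri k K)) C) :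
    ∃ C' : Cocyc X.carrier, C'.Ample ∧ Nonempty (Lin α C') := by
  obtain ⟨C', h1, ⟨l'⟩, h2⟩ := exists_refine hC l
  exact partE' h1 h2 l'

end partE

/-- Let `k` be a field, `G` an algebraic group over `k`, `X` a `G`-scheme,
and `k'/k` a field extension. Let `G'` (acting on `X'`) be the base change of `G` (acting on
`X`) to `k'`, presented by cartesian squares compatible with the group and action structure.
Then `X` admits an ample `G`-linearized line bundle if and only if `X'` admits an ample
`G'`-linearized line bundle. -/
theorem ample_linearized_iff_base_change
    {k : Type u} [Field k] (k' : Type u) [Field k'] [Algebra k k']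
    (G : GroupSchemeOver k) (hGalg : G.IsAlgebraic)
    (X : SchemeOver k) (α : ActionOver G X)
    (G' : GroupSchemeOver k') (prG : G'.carrier ⟶ G.carrier)
    (hGpb : IsPullback prG G'.str G.str (Spec.map (CommRingCat.ofHom (algebraMap k k'))))
    (hGmul : ∀ {T : Scheme.{u}} (a b : T ⟶ G'.carrier) (h h'),
      G'.mul a b h ≫ prG = G.mul (a ≫ prG) (b ≫ prG) h')
    (X' : SchemeOver k') (prX : X'.carrier ⟶ X.carrier)
    (hXpb : IsPullback prX X'.str X.str (Spec.map (CommRingCat.ofHom (algebraMap k k'))))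
    (α' : ActionOver G' X')
    (hαcompat : ∀ {T : Scheme.{u}} (g : T ⟶ G'.carrier) (x : T ⟶ X'.carrier) (h h'),
      α'.act g x h ≫ prX = α.act (g ≫ prG) (x ≫ prX) h') :
    (∃ L : LineBundle X.carrier, IsAmple L ∧ α.IsLinearized L) ↔
    (∃ L' : LineBundle X'.carrier, IsAmple L' ∧ α'.IsLinearized L') := by
  have hone : G'.one ≫ prG = twri k k' ≫ G.one := one_bc (r := twri k k') hGpb.w hGmul
  constructor
  · rintro ⟨L, hL, hlin⟩
    obtain ⟨C, hC, ⟨l⟩⟩ := partA α L hL hlin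
    have haff : IsAffineHom prX :=
      MorphismProperty.of_isPullback (P := @IsAffineHom) hXpb.flip (isAffineHom_spec_map _)
    exact partB (hC.pull prX) (l.pull α' prG prX (twri k k') hGpb.w hXpb.w hGmul hone hαcompat)
  · rintro ⟨L', hL', hlin'⟩
    obtain ⟨C, hC, ⟨l⟩⟩ := partA α' L' hL' hlin'
    obtain ⟨l1⟩ := Lin.start (r := twri k k') (α := α) hXpb hGpb l hGmul hαcompat
    have hiso : IsIso (stE (r := twri k k') hXpb) := stE_iso hXpb
    obtain ⟨K, i1, i2, i3, C', hC', ⟨l'⟩⟩ := partD hGalg (hC.pull (stE (r := twri k k') hXpb)) l1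
    obtain ⟨C'', hC'', ⟨l''⟩⟩ := partE hC' l'
    exact partB hC'' l''
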